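/- Kato–Ponce commutator estimate: for s > 0 and 1 < p < ∞, with Λ = (I−Δ)^{1/2}, one has ‖Λ^s(fg) − f Λ^s g‖_{L^p} ≤ C(‖∇f‖_{L^{p₁}}‖g‖_{W^{s−1,p₂}} + ‖f‖_{W^{s,p₃}}‖g‖_{L^{p₄}}) whenever 1/p = 1/p₁ + 1/p₂ = 1/p₃ + 1/p₄ with 1 < p₂, p₃ < ∞. -/

import Mathlib

open MeasureTheory FourierTransform
open scoped ENNReal

/-- Euclidean ℝ³. -/
abbrev E3 : Type := EuclideanSpace ℝ (Fin 3)

/-- The Bessel potential operator `Λˢ = (I − Δ)^{s/2}`, defined as the Fourier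
multiplier with symbol `(1 + |ξ|²)^{s/2}`. -/
noncomputable def Lam (s : ℝ) (f : E3 → ℂ) : E3 → ℂ :=
  𝓕⁻ fun ξ : E3 => (((1 + ‖ξ‖ ^ 2) ^ (s / 2) : ℝ) : ℂ) * 𝓕 f ξ

/-- The `Hˢ` Sobolev norm, defined on the Fourier side. -/
noncomputable def HsNorm (s : ℝ) (f : E3 → ℂ) : ℝ :=
  (∫ ξ : E3, (1 + ‖ξ‖ ^ 2) ^ s * ‖𝓕 f ξ‖ ^ 2) ^ (1 / 2 : ℝ)

/-- Partial derivative `∂_k` of a complex-valued function on ℝ³. -/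
noncomputable def pdC (k : Fin 3) (f : E3 → ℂ) : E3 → ℂ :=
  fun x => fderiv ℝ f x (EuclideanSpace.single k 1)

/-- Membership in `Hˢ` (together with integrability, so that the Fourier transform is
given by the Fourier integral). -/
def MemHs (s : ℝ) (f : E3 → ℂ) : Prop :=
  Integrable f volume ∧
    Integrable (fun ξ : E3 => (1 + ‖ξ‖ ^ 2) ^ s * ‖𝓕 f ξ‖ ^ 2) volume

set_option linter.unusedSectionVars false

set_option linter.unusedSectionVars false

namespace KP

open Metric Set Filter

section CZ

variable {H H₁ H₂ : Type} [NormedAddCommGroup H] [NormedSpace ℂ H] [CompleteSpace H]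
  [SecondCountableTopology H]
  [NormedAddCommGroup H₁] [NormedSpace ℂ H₁] [CompleteSpace H₁] [SecondCountableTopology H₁]
  [NormedAddCommGroup H₂] [NormedSpace ℂ H₂] [CompleteSpace H₂] [SecondCountableTopology H₂]

/-- Admissible inputs: strongly measurable, integrable, bounded. -/
structure Adm {H : Type} [NormedAddCommGroup H] (f : E3 → H) : Prop where
  meas : StronglyMeasurable f
  int : Integrable f
  bdd : ∃ M : ℝ, ∀ x, ‖f x‖ ≤ M

/-- Nice kernels: continuous, integrable, bounded. -/
structure NK {H₁ H₂ : Type} [NormedAddCommGroup H₁] [NormedSpace ℂ H₁]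
    [NormedAddCommGroup H₂] [NormedSpace ℂ H₂] (K : E3 → H₁ →L[ℂ] H₂) : Prop where
  cont : Continuous K
  int : Integrable K
  bdd : ∃ M : ℝ, ∀ x, ‖K x‖ ≤ M

/-- Convolution operator. -/
noncomputable def T {H₁ H₂ : Type} [NormedAddCommGroup H₁] [NormedSpace ℂ H₁]
    [NormedAddCommGroup H₂] [NormedSpace ℂ H₂] (K : E3 → H₁ →L[ℂ] H₂) (f : E3 → H₁) : E3 → H₂ :=
  fun x => ∫ y, K (x - y) (f y)

lemma T_meas {K : E3 → H₁ →L[ℂ] H₂} (hK : NK K) {f : E3 → H₁} (hf : StronglyMeasurable f) :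
    StronglyMeasurable (Function.uncurry fun x y => K (x - y) (f y)) := by
  have h1 : StronglyMeasurable (fun p : E3 × E3 => K (p.1 - p.2)) :=
    (hK.cont.comp (continuous_fst.sub continuous_snd)).stronglyMeasurable
  have h2 : StronglyMeasurable (fun p : E3 × E3 => f p.2) := hf.comp_measurable measurable_snd
  exact (isBoundedBilinearMap_apply (𝕜 := ℂ) (E := H₁) (F := H₂)).continuous.comp_stronglyMeasurable
    (h1.prodMk h2)

lemma T_integrable {K : E3 → H₁ →L[ℂ] H₂} (hK : NK K) {f : E3 → H₁} (hf : Adm f) (x : E3) :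
    Integrable (fun y => K (x - y) (f y)) := by
  obtain ⟨M, hM⟩ := hK.bdd
  refine (hf.int.norm.const_mul M).mono' ?_ (Eventually.of_forall fun y => ?_)
  · exact ((T_meas hK hf.meas).comp_measurable (measurable_prodMk_left (x := x))).aestronglyMeasurable
  · exact ((K (x - y)).le_opNorm (f y)).trans
      (mul_le_mul_of_nonneg_right (hM _) (norm_nonneg _))

lemma T_add {K : E3 → H₁ →L[ℂ] H₂} (hK : NK K) {f g : E3 → H₁} (hf : Adm f) (hg : Adm g)
    (x : E3) : T K (fun y => f y + g y) x = T K f x + T K g x := by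
  simp only [T, map_add]
  exact integral_add (T_integrable hK hf x) (T_integrable hK hg x)

lemma T_sub {K : E3 → H₁ →L[ℂ] H₂} (hK : NK K) {f g : E3 → H₁} (hf : Adm f) (hg : Adm g)
    (x : E3) : T K (fun y => f y - g y) x = T K f x - T K g x := by
  simp only [T, map_sub]
  exact integral_sub (T_integrable hK hf x) (T_integrable hK hg x)

lemma T_congr {K : E3 → H₁ →L[ℂ] H₂} {f g : E3 → H₁} (h : f =ᵐ[volume] g)
    (x : E3) : T K f x = T K g x := by
  simp only [T]
  apply integral_congr_ae
  filter_upwards [h] with y hy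
  rw [hy]

lemma T_enorm_le {K : E3 → H₁ →L[ℂ] H₂} (f : E3 → H₁) (x : E3) :
    ‖T K f x‖ₑ ≤ ∫⁻ y, ‖K (x - y)‖ₑ * ‖f y‖ₑ := by
  refine (enorm_integral_le_lintegral_enorm _).trans (lintegral_mono fun y => ?_)
  exact (K (x - y)).le_opENorm (f y)

lemma T_adm {K : E3 → H₁ →L[ℂ] H₂} (hK : NK K) {f : E3 → H₁} (hf : Adm f) : Adm (T K f) := by
  have hm : StronglyMeasurable (T K f) := (T_meas hK hf.meas).integral_prod_right
  refine ⟨hm, ⟨hm.aestronglyMeasurable, ?_⟩, ?_⟩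
  · rw [HasFiniteIntegral]
    have hKm : Measurable fun p : E3 × E3 => ‖K (p.1 - p.2)‖ₑ :=
      (hK.cont.comp (continuous_fst.sub continuous_snd)).enorm.measurable
    have hfm : Measurable fun p : E3 × E3 => ‖f p.2‖ₑ := hf.meas.enorm.comp measurable_snd
    calc ∫⁻ x, ‖T K f x‖ₑ ≤ ∫⁻ x, ∫⁻ y, ‖K (x - y)‖ₑ * ‖f y‖ₑ :=
          lintegral_mono fun x => T_enorm_le f x
      _ = ∫⁻ y, ∫⁻ x, ‖K (x - y)‖ₑ * ‖f y‖ₑ := by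
          rw [lintegral_lintegral_swap]
          exact (hKm.mul hfm).aemeasurable
      _ = ∫⁻ y, (∫⁻ x, ‖K x‖ₑ) * ‖f y‖ₑ := by
          congr 1; ext y
          rw [lintegral_mul_const, lintegral_sub_right_eq_self (fun x => ‖K x‖ₑ)]
          exact (hK.cont.comp (continuous_id.sub continuous_const)).enorm.measurable
      _ = (∫⁻ x, ‖K x‖ₑ) * ∫⁻ y, ‖f y‖ₑ := by
          rw [lintegral_const_mul _ hf.meas.enorm]
      _ < ⊤ := ENNReal.mul_lt_top hK.int.2 hf.int.2
  · obtain ⟨M, hM⟩ := hK.bdd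
    refine ⟨∫ y, M * ‖f y‖, fun x => ?_⟩
    refine norm_integral_le_of_norm_le (hf.int.norm.const_mul M) (Eventually.of_forall fun y => ?_)
    exact ((K (x - y)).le_opNorm (f y)).trans
      (mul_le_mul_of_nonneg_right (hM _) (norm_nonneg _))

lemma Adm.indicator {f : E3 → H} (hf : Adm f) {s : Set E3} (hs : MeasurableSet s) :
    Adm (s.indicator f) := by
  obtain ⟨M, hM⟩ := hf.bdd
  refine ⟨hf.meas.indicator hs, hf.int.indicator hs, M, fun x => ?_⟩
  exact (norm_indicator_le_norm_self f x).trans (hM x)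

end CZ
end KP

namespace KP

open Metric Set Filter

section CZ2

variable {H : Type} [NormedAddCommGroup H] [NormedSpace ℂ H] [CompleteSpace H]
  [SecondCountableTopology H]

lemma vol_ball_mul (c : E3) {r t : ℝ} (hr : 0 ≤ r) (ht : 0 ≤ t) :
    volume (closedBall c (t * r)) = ENNReal.ofReal (t ^ 3) * volume (closedBall c r) := by
  rw [Measure.addHaar_closedBall _ _ (mul_nonneg ht hr), Measure.addHaar_closedBall _ _ hr]
  simp only [finrank_euclideanSpace, Fintype.card_fin]
  rw [mul_pow, ENNReal.ofReal_mul (by positivity), mul_assoc]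

lemma vol_ball_pos (c : E3) {r : ℝ} (hr : 0 < r) : 0 < volume (closedBall c r) :=
  measure_closedBall_pos _ _ hr

lemma vol_ball_fin (c : E3) (r : ℝ) : volume (closedBall c r) < ⊤ := measure_closedBall_lt_top

/-- the bad condition. -/
def BadBall (f : E3 → H) (l : ℝ) (x : E3) (r : ℝ) : Prop :=
  0 < r ∧ ENNReal.ofReal l * volume (closedBall x r) < ∫⁻ y in closedBall x r, ‖f y‖ₑ

lemma bad_bounded {f : E3 → H} (hf : Adm f) {l : ℝ} (hl : 0 < l) :
    ∃ R : ℝ, ∀ x r, BadBall f l x r → r ≤ R := by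
  set V := (volume (closedBall (0 : E3) 1)).toReal
  have hV : 0 < V := ENNReal.toReal_pos (vol_ball_pos _ one_pos).ne' (vol_ball_fin _ _).ne
  set I := (∫⁻ y, ‖f y‖ₑ).toReal
  have hI : 0 ≤ I := ENNReal.toReal_nonneg
  refine ⟨max 1 (I / (l * V)), fun x r hr => ?_⟩
  by_contra! hcon
  have h1 : 1 < r := (le_max_left _ _).trans_lt hcon
  have h2 : I / (l * V) < r := (le_max_right _ _).trans_lt hcon
  rw [div_lt_iff₀ (by positivity)] at h2
  have h3 : volume (closedBall x r) = ENNReal.ofReal (r ^ 3) * ENNReal.ofReal V := by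
    have := vol_ball_mul x (r := 1) (t := r) (by norm_num) (by linarith)
    rw [mul_one] at this
    rw [this, ENNReal.ofReal_toReal (vol_ball_fin _ _).ne, Measure.addHaar_closedBall_center]
  have h4 : ∫⁻ y in closedBall x r, ‖f y‖ₑ ≤ ENNReal.ofReal I := by
    rw [ENNReal.ofReal_toReal hf.int.2.ne]
    exact setLIntegral_le_lintegral _ _
  have h5 := hr.2.trans_le h4
  rw [h3, ← ENNReal.ofReal_mul (by positivity), ← ENNReal.ofReal_mul hl.le] at h5
  have h6 := (ENNReal.ofReal_lt_ofReal_iff_of_nonneg (by positivity)).1 h5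
  have h7 : r ≤ r ^ 3 := by nlinarith [sq_nonneg (r-1)]
  have : r * (l * V) ≤ l * (r ^ 3 * V) := by
    have := mul_le_mul_of_nonneg_right h7 (by positivity : 0 ≤ l * V)
    linarith
  linarith

lemma exists_halt {f : E3 → H} (hf : Adm f) {l : ℝ} (hl : 0 < l) {x : E3}
    (hx : ∃ r, BadBall f l x r) : ∃ r, BadBall f l x r ∧ ¬ BadBall f l x (5 * r) := by
  by_contra! hcon
  obtain ⟨r, hr⟩ := hx
  obtain ⟨R, hR⟩ := bad_bounded hf hl
  have : ∀ n : ℕ, BadBall f l x (5 ^ n * r) := by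
    intro n
    induction n with
    | zero => simpa using hr
    | succ n ih =>
      have := hcon _ ih
      rwa [← mul_assoc, ← pow_succ'] at this
  have hr0 := hr.1
  obtain ⟨n, hn⟩ := pow_unbounded_of_one_lt (R / r) (by norm_num : (1:ℝ) < 5)
  rw [div_lt_iff₀ hr0] at hn
  exact absurd (hR _ _ (this n)) (not_le.2 hn)

lemma ae_good {f : E3 → H} (hf : Adm f) {l : ℝ} (hl : 0 < l) :
    ∀ᵐ x, (¬ ∃ r, BadBall f l x r) → ‖f x‖ ≤ l := by
  have h := IsUnifLocDoublingMeasure.ae_tendsto_average (volume : Measure E3)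
    (f := fun x => ‖f x‖) hf.int.norm.locallyIntegrable 1
  filter_upwards [h] with x hx hbad
  have h1 : Tendsto (fun n : ℕ => (1 : ℝ) / ((n : ℝ) + 1)) atTop (nhdsWithin 0 (Ioi 0)) := by
    refine tendsto_nhdsWithin_iff.2 ⟨tendsto_one_div_add_atTop_nhds_zero_nat, ?_⟩
    exact Eventually.of_forall fun n => by
      show (0 : ℝ) < 1 / ((n : ℝ) + 1)
      positivity
  have h2 := hx (fun _ : ℕ => x) (fun n : ℕ => (1 : ℝ) / ((n : ℝ) + 1)) h1
    (Eventually.of_forall fun n => mem_closedBall_self (by positivity))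
  refine le_of_tendsto h2 (Eventually.of_forall fun n => ?_)
  push Not at hbad
  have h3 := hbad (1 / ((n : ℝ) + 1))
  have hr : (0:ℝ) < 1 / ((n : ℝ) + 1) := by positivity
  generalize (1 : ℝ) / ((n : ℝ) + 1) = r at h3 hr
  have h4 : ∫⁻ y in closedBall x r, ‖f y‖ₑ ≤ ENNReal.ofReal l * volume (closedBall x r) := by
    by_contra! hc
    exact h3 ⟨hr, hc⟩
  have h5 : ∫ y in closedBall x r, ‖f y‖ ≤ l * volume.real (closedBall x r) := by
    rw [integral_norm_eq_lintegral_enorm hf.int.1.restrict]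
    refine ENNReal.toReal_le_of_le_ofReal (by positivity) (h4.trans ?_)
    rw [ENNReal.ofReal_mul hl.le, measureReal_def, ENNReal.ofReal_toReal (vol_ball_fin _ _).ne]
  rw [setAverage_eq, smul_eq_mul, inv_mul_le_iff₀, mul_comm]
  · exact h5
  · exact ENNReal.toReal_pos (vol_ball_pos _ hr).ne' (vol_ball_fin _ _).ne

/-- Calderon-Zygmund decomposition. -/
lemma cz_decomp {f : E3 → H} (hf : Adm f) {l : ℝ} (hl : 0 < l) :
    ∃ (ι : Type) (_ : Countable ι) (c : ι → E3) (r : ι → ℝ) (Q : ι → Set E3) (g : E3 → H),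
      (∀ i, 0 < r i) ∧ (∀ i, MeasurableSet (Q i)) ∧ Pairwise (Function.onFun Disjoint Q) ∧
      (∀ i, Q i ⊆ closedBall (c i) (r i)) ∧ Adm g ∧ (∀ x, ‖g x‖ ≤ 125 * l) ∧
      (∫⁻ x, ‖g x‖ₑ ≤ ∫⁻ x, ‖f x‖ₑ) ∧
      (∀ᵐ x, x ∉ ⋃ i, Q i → f x = g x) ∧ (∀ i, ∫ x in Q i, (f x - g x) = 0) ∧
      (∑' i, volume (closedBall (c i) (2 * r i))) ≤ 1000 * ((∫⁻ x, ‖f x‖ₑ) / ENNReal.ofReal l) := by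
  classical
  have hhalt : ∀ x : {x // ∃ r, BadBall f l x r},
      ∃ r, BadBall f l x.1 r ∧ ¬ BadBall f l x.1 (5 * r) := fun x => exists_halt hf hl x.2
  choose ρ hρ hρ' using hhalt
  obtain ⟨R, hR⟩ := bad_bounded hf hl
  obtain ⟨u, -, hud, huc⟩ := Vitali.exists_disjoint_subfamily_covering_enlargement_closedBall
    (univ : Set {x // ∃ r, BadBall f l x r}) (fun x => x.1) ρ R (fun a _ => hR _ _ (hρ a)) 5
    (by norm_num)
  have hcount : u.Countable := hud.countable_of_nonempty_interior fun i _ =>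
    ⟨i.1, ball_subset_interior_closedBall (mem_ball_self (hρ i).1)⟩
  have : Countable u := hcount.to_subtype
  obtain ⟨e, he⟩ := exists_injective_nat u
  set B : u → Set E3 := fun i => closedBall i.1.1 (ρ i.1) with hB
  set B5 : u → Set E3 := fun i => closedBall i.1.1 (5 * ρ i.1) with hB5
  have hBB5 : ∀ i, B i ⊆ B5 i := fun i => closedBall_subset_closedBall (by
    have := (hρ i.1).1; linarith)
  have hBd : Pairwise (Function.onFun Disjoint B) := fun i j hij =>
    hud i.2 j.2 (fun h => hij (Subtype.ext h))
  have hBm : ∀ i, MeasurableSet (B i) := fun i => measurableSet_closedBall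
  have hB5m : ∀ i, MeasurableSet (B5 i) := fun i => measurableSet_closedBall
  set Q : u → Set E3 := fun i => B i ∪ ((B5 i \ ⋃ j, B j) \ ⋃ j : {j // e j < e i}, B5 j.1) with hQ
  have hQm : ∀ i, MeasurableSet (Q i) := fun i =>
    (hBm i).union (((hB5m i).diff (MeasurableSet.iUnion hBm)).diff
      (MeasurableSet.iUnion fun j => hB5m j.1))
  have hBQ : ∀ i, B i ⊆ Q i := fun i => subset_union_left
  have hQ5 : ∀ i, Q i ⊆ B5 i := fun i => union_subset (hBB5 i) (fun x hx => hx.1.1)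
  have hQd : Pairwise (Function.onFun Disjoint Q) := by
    have key : ∀ i j, e i < e j → Disjoint (Q i) (Q j) := by
      intro i j hij
      have hne : i ≠ j := fun h => by simp [h] at hij
      refine Set.disjoint_left.2 fun x hxi hxj => ?_
      rcases hxj with hxj | hxj
      · rcases hxi with hxi | hxi
        · exact Set.disjoint_left.1 (hBd hne) hxi hxj
        · exact hxi.1.2 (mem_iUnion.2 ⟨j, hxj⟩)
      · exact hxj.2 (mem_iUnion.2 ⟨⟨i, hij⟩, hQ5 i hxi⟩)
    intro i j hij
    rcases lt_trichotomy (e i) (e j) with h | h | h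
    · exact key i j h
    · exact absurd (he h) hij
    · exact (key j i h).symm
  have hcov : ∀ x, (∃ r, BadBall f l x r) → x ∈ ⋃ i, Q i := by
    intro x hx
    obtain ⟨b, hb, hsub⟩ := huc ⟨x, hx⟩ (mem_univ _)
    have hx5 : x ∈ B5 ⟨b, hb⟩ := hsub (mem_closedBall_self (hρ ⟨x, hx⟩).1.le)
    by_cases h1 : x ∈ ⋃ j, B j
    · obtain ⟨j, hj⟩ := mem_iUnion.1 h1
      exact mem_iUnion.2 ⟨j, hBQ j hj⟩
    · have hex : ∃ n, ∃ i : u, e i = n ∧ x ∈ B5 i := ⟨_, _, rfl, hx5⟩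
      obtain ⟨i, hi, hxi⟩ := Nat.find_spec hex
      refine mem_iUnion.2 ⟨i, Or.inr ⟨⟨hxi, h1⟩, ?_⟩⟩
      intro hmem
      obtain ⟨⟨j, hj⟩, hxj⟩ := mem_iUnion.1 hmem
      exact Nat.find_min hex (hi ▸ hj) ⟨j, rfl, hxj⟩
  have hQvol : ∀ i, volume (Q i) ≠ ⊤ := fun i =>
    ((measure_mono (hQ5 i)).trans_lt (vol_ball_fin _ _)).ne
  have hQpos : ∀ i, 0 < volume (Q i) := fun i =>
    (vol_ball_pos _ (hρ i.1).1).trans_le (measure_mono (hBQ i))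
  have hQint : ∀ i, ∫⁻ y in Q i, ‖f y‖ₑ ≤ ENNReal.ofReal (125 * l) * volume (Q i) := by
    intro i
    have h1 : ∫⁻ y in B5 i, ‖f y‖ₑ ≤ ENNReal.ofReal l * volume (B5 i) := by
      by_contra! hc
      exact hρ' i.1 ⟨by have := (hρ i.1).1; linarith, hc⟩
    calc ∫⁻ y in Q i, ‖f y‖ₑ ≤ ∫⁻ y in B5 i, ‖f y‖ₑ := lintegral_mono_set (hQ5 i)
      _ ≤ ENNReal.ofReal l * volume (B5 i) := h1
      _ = ENNReal.ofReal (125 * l) * volume (B i) := by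
        rw [hB5, vol_ball_mul _ (hρ i.1).1.le (by norm_num), ← mul_assoc,
          ← ENNReal.ofReal_mul hl.le, show l * 5 ^ 3 = 125 * l by ring]
      _ ≤ _ := by gcongr; exact hBQ i
  -- the good function
  set A : u → H := fun i => ⨍ y in Q i, f y with hA
  have hAe : ∀ i, ‖A i‖ₑ * volume (Q i) ≤ ∫⁻ y in Q i, ‖f y‖ₑ := by
    intro i
    have h1 : ‖(volume.real (Q i)) • A i‖ₑ ≤ ∫⁻ y in Q i, ‖f y‖ₑ := by
      rw [hA, measure_smul_setAverage _ (hQvol i)]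
      exact enorm_integral_le_lintegral_enorm _
    rw [enorm_smul, mul_comm] at h1
    convert h1 using 2
    rw [Real.enorm_eq_ofReal measureReal_nonneg, measureReal_def, ENNReal.ofReal_toReal (hQvol i)]
  have hAn : ∀ i, ‖A i‖ ≤ 125 * l := by
    intro i
    have h1 := (hAe i).trans (hQint i)
    have h2 : ‖A i‖ₑ ≤ ENNReal.ofReal (125 * l) :=
      (ENNReal.mul_le_mul_iff_left (hQpos i).ne' (hQvol i)).1 h1
    rwa [← ofReal_norm, ENNReal.ofReal_le_ofReal_iff (by positivity)] at h2
  borelize H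
  have hUm : MeasurableSet (⋃ i, Q i) := MeasurableSet.iUnion hQm
  set f0 : E3 → H := {x | ‖f x‖ ≤ l}.indicator f with hf0
  have hf0m : Measurable f0 := hf.meas.measurable.indicator
    (measurableSet_le hf.meas.norm.measurable measurable_const)
  obtain ⟨g, hgm, hg⟩ := exists_measurable_piecewise (ι := Option u)
    (fun o => match o with | none => (⋃ i, Q i)ᶜ | some i => Q i)
    (fun o => by cases o with
      | none => exact hUm.compl
      | some i => exact hQm i)
    (fun o => match o with | none => f0 | some i => fun _ => A i)
    (fun o => by cases o with
      | none => exact hf0m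
      | some i => exact measurable_const)
    (by
      intro o o' hoo x hx
      exfalso
      rcases o with _ | i <;> rcases o' with _ | j
      · exact hoo rfl
      · exact hx.1 (mem_iUnion.2 ⟨j, hx.2⟩)
      · exact hx.2 (mem_iUnion.2 ⟨i, hx.1⟩)
      · exact Set.disjoint_left.1 (hQd (fun h => hoo (by rw [h]))) hx.1 hx.2)
  have hg0 : ∀ x, x ∉ ⋃ i, Q i → g x = f0 x := fun x hx => hg none hx
  have hgi : ∀ i, ∀ x ∈ Q i, g x = A i := fun i x hx => hg (some i) hx
  have hf0n : ∀ x, ‖f0 x‖ ≤ l := by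
    intro x
    by_cases h : ‖f x‖ ≤ l
    · rw [hf0, indicator_of_mem (by exact h)]; exact h
    · rw [hf0, indicator_of_notMem (by exact h)]; simpa using hl.le
  have hgn : ∀ x, ‖g x‖ ≤ 125 * l := by
    intro x
    by_cases h : x ∈ ⋃ i, Q i
    · obtain ⟨i, hi⟩ := mem_iUnion.1 h
      rw [hgi i x hi]; exact hAn i
    · rw [hg0 x h]; exact (hf0n x).trans (by linarith)
  have hgint : ∫⁻ x, ‖g x‖ₑ ≤ ∫⁻ x, ‖f x‖ₑ := by
    rw [← lintegral_add_compl (fun x => ‖g x‖ₑ) hUm, ← lintegral_add_compl (fun x => ‖f x‖ₑ) hUm]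
    gcongr ?_ + ?_
    · rw [lintegral_iUnion hQm hQd, lintegral_iUnion hQm hQd]
      refine ENNReal.tsum_le_tsum fun i => ?_
      rw [setLIntegral_congr_fun (hQm i) (fun x hx => by rw [hgi i x hx]), setLIntegral_const]
      exact hAe i
    · refine setLIntegral_mono' hUm.compl fun x hx => ?_
      rw [hg0 x hx, hf0]
      exact enorm_indicator_le_enorm_self _ _
  have hgAdm : Adm g := ⟨hgm.stronglyMeasurable,
    ⟨hgm.aestronglyMeasurable, hgint.trans_lt hf.int.2⟩, _, hgn⟩
  refine ⟨u, this, fun i => i.1.1, fun i => 5 * ρ i.1, Q, g, fun i => by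
    have := (hρ i.1).1; positivity, hQm, hQd, hQ5, hgAdm, hgn, hgint, ?_, ?_, ?_⟩
  · filter_upwards [ae_good hf hl] with x hx hxQ
    rw [hg0 x hxQ, hf0, indicator_of_mem]
    exact hx fun h => hxQ (hcov x h)
  · intro i
    rw [integral_sub hf.int.integrableOn hgAdm.int.integrableOn,
      setIntegral_congr_fun (hQm i) (fun x hx => hgi i x hx), setIntegral_const, hA,
      measure_smul_setAverage _ (hQvol i), sub_self]
  · have h1 : ∀ i : u, volume (closedBall i.1.1 (2 * (5 * ρ i.1))) ≤
        1000 * ((∫⁻ y in B i, ‖f y‖ₑ) / ENNReal.ofReal l) := by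
      intro i
      rw [← mul_assoc, vol_ball_mul _ (hρ i.1).1.le (by norm_num)]
      have : ENNReal.ofReal ((2 * 5 : ℝ) ^ 3) = 1000 := by norm_num
      rw [this]
      gcongr
      rw [ENNReal.le_div_iff_mul_le (Or.inl (by simpa using hl)) (Or.inl ENNReal.ofReal_ne_top),
        mul_comm]
      exact (hρ i.1).2.le
    calc _ ≤ ∑' i : u, 1000 * ((∫⁻ y in B i, ‖f y‖ₑ) / ENNReal.ofReal l) :=
          ENNReal.tsum_le_tsum h1
      _ = 1000 * ((∑' i : u, ∫⁻ y in B i, ‖f y‖ₑ) / ENNReal.ofReal l) := by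
          rw [ENNReal.tsum_mul_left]; simp only [div_eq_mul_inv]; rw [ENNReal.tsum_mul_right]
      _ ≤ _ := by
          rw [← lintegral_iUnion hBm hBd]
          gcongr
          exact Measure.restrict_le_self

end CZ2
end KP

namespace KP

open Metric Set Filter

section CZ3

variable {H₁ H₂ : Type}
  [NormedAddCommGroup H₁] [NormedSpace ℂ H₁] [CompleteSpace H₁] [SecondCountableTopology H₁]
  [NormedAddCommGroup H₂] [NormedSpace ℂ H₂] [CompleteSpace H₂] [SecondCountableTopology H₂]

/-- Hormander condition. -/
def Hor {H₁ H₂ : Type} [NormedAddCommGroup H₁] [NormedSpace ℂ H₁]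
    [NormedAddCommGroup H₂] [NormedSpace ℂ H₂] (K : E3 → H₁ →L[ℂ] H₂) (B : ℝ≥0∞) : Prop :=
  ∀ R : ℝ, 0 < R → ∀ y : E3, ‖y‖ ≤ R → ∫⁻ x in {x | 2 * R < ‖x‖}, ‖K (x - y) - K x‖ₑ ≤ B

/-- a-priori bound on bounded functions at level `l`. -/
def Gr {H₁ H₂ : Type} [NormedAddCommGroup H₁] [NormedSpace ℂ H₁]
    [NormedAddCommGroup H₂] [NormedSpace ℂ H₂] (K : E3 → H₁ →L[ℂ] H₂) (r a : ℝ) (A : ℝ≥0∞) : Prop :=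
  ∀ g : E3 → H₁, Adm g → ∀ l : ℝ, 0 < l → (∀ x, ‖g x‖ ≤ l) →
    volume {x | a * l < ‖T K g x‖} ≤ A * ∫⁻ x, (‖g x‖ₑ / ENNReal.ofReal l) ^ r

lemma bad_part {K : E3 → H₁ →L[ℂ] H₂} (hK : NK K) {B : ℝ≥0∞} (hH : Hor K B)
    {b : E3 → H₁} (hb : Adm b) {ι : Type} [Countable ι] (c : ι → E3) (r : ι → ℝ) (Q : ι → Set E3)
    (hr : ∀ i, 0 < r i) (hQm : ∀ i, MeasurableSet (Q i)) (hQd : Pairwise (Function.onFun Disjoint Q))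
    (hQ : ∀ i, Q i ⊆ closedBall (c i) (r i)) (hb0 : ∀ᵐ x, x ∉ ⋃ i, Q i → b x = 0)
    (hbi : ∀ i, ∫ x in Q i, b x = 0) :
    ∫⁻ x in (⋃ i, closedBall (c i) (2 * r i))ᶜ, ‖T K b x‖ₑ ≤ B * ∫⁻ x, ‖b x‖ₑ := by
  have hUm : MeasurableSet (⋃ i, Q i) := MeasurableSet.iUnion hQm
  have hpt : ∀ x, ‖T K b x‖ₑ ≤ ∑' i, ∫⁻ y in Q i, ‖K (x - y) - K (x - c i)‖ₑ * ‖b y‖ₑ := by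
    intro x
    have hInt := T_integrable hK hb x
    have h1 : T K b x = ∑' i, ∫ y in Q i, K (x - y) (b y) := by
      rw [← integral_iUnion hQm hQd hInt.integrableOn, T]
      symm
      apply setIntegral_eq_integral_of_ae_compl_eq_zero
      filter_upwards [hb0] with y hy hyU
      rw [hy hyU, map_zero]
    rw [h1]
    refine (enorm_tsum_le_tsum_enorm).trans (ENNReal.tsum_le_tsum fun i => ?_)
    have h2 : ∫ y in Q i, K (x - y) (b y) = ∫ y in Q i, (K (x - y) - K (x - c i)) (b y) := by
      have h3 : ∫ y in Q i, K (x - c i) (b y) = 0 := by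
        rw [ContinuousLinearMap.integral_comp_comm _ hb.int.integrableOn, hbi, map_zero]
      simp only [ContinuousLinearMap.sub_apply]
      rw [integral_sub hInt.integrableOn
        ((K (x - c i)).integrable_comp hb.int).integrableOn, h3, sub_zero]
    rw [h2]
    refine (enorm_integral_le_lintegral_enorm _).trans (lintegral_mono fun y => ?_)
    exact ContinuousLinearMap.le_opENorm _ _
  have hKm : ∀ i, Measurable fun p : E3 × E3 => ‖K (p.1 - p.2) - K (p.1 - c i)‖ₑ * ‖b p.2‖ₑ := by
    intro i
    refine Measurable.mul ?_ (hb.meas.enorm.comp measurable_snd)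
    exact ((hK.cont.comp (continuous_fst.sub continuous_snd)).sub
      (hK.cont.comp (continuous_fst.sub continuous_const))).enorm.measurable
  calc ∫⁻ x in (⋃ i, closedBall (c i) (2 * r i))ᶜ, ‖T K b x‖ₑ
      ≤ ∫⁻ x in (⋃ i, closedBall (c i) (2 * r i))ᶜ,
          ∑' i, ∫⁻ y in Q i, ‖K (x - y) - K (x - c i)‖ₑ * ‖b y‖ₑ := lintegral_mono fun x => hpt x
    _ = ∑' i, ∫⁻ x in (⋃ i, closedBall (c i) (2 * r i))ᶜ,
          ∫⁻ y in Q i, ‖K (x - y) - K (x - c i)‖ₑ * ‖b y‖ₑ := by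
        rw [lintegral_tsum]
        intro i
        exact (Measurable.lintegral_prod_right' (hKm i)).aemeasurable
    _ ≤ ∑' i, B * ∫⁻ y in Q i, ‖b y‖ₑ := by
        refine ENNReal.tsum_le_tsum fun i => ?_
        rw [lintegral_lintegral_swap (hKm i).aemeasurable, ← lintegral_const_mul _ hb.meas.enorm]
        refine setLIntegral_mono' (hQm i) fun y hy => ?_
        rw [lintegral_mul_const]
        swap
        · exact ((hK.cont.comp (continuous_id.sub continuous_const)).sub
            (hK.cont.comp (continuous_id.sub continuous_const))).enorm.measurable
        gcongr
        have hy' : ‖y - c i‖ ≤ r i := by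
          have := hQ i hy
          rwa [mem_closedBall, dist_eq_norm] at this
        refine le_trans ?_ (hH (r i) (hr i) (y - c i) hy')
        have hms : MeasurableSet {x : E3 | 2 * r i < ‖x‖} :=
          measurableSet_lt measurable_const measurable_norm
        rw [← lintegral_indicator hms, ← lintegral_sub_right_eq_self
            ({x : E3 | 2 * r i < ‖x‖}.indicator fun x => ‖K (x - (y - c i)) - K x‖ₑ) (c i),
          ← lintegral_indicator (MeasurableSet.iUnion fun i => measurableSet_closedBall).compl]
        refine lintegral_mono fun x => ?_
        by_cases hx : x ∈ (⋃ i, closedBall (c i) (2 * r i))ᶜ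
        · have hx2 : x - c i ∈ {x : E3 | 2 * r i < ‖x‖} := by
            by_contra hc
            apply hx
            refine mem_iUnion.2 ⟨i, ?_⟩
            rw [mem_closedBall, dist_eq_norm]
            exact not_lt.1 hc
          rw [indicator_of_mem hx, indicator_of_mem hx2, show x - c i - (y - c i) = x - y by abel]
        · rw [indicator_of_notMem hx]; exact bot_le
    _ = B * ∑' i, ∫⁻ y in Q i, ‖b y‖ₑ := ENNReal.tsum_mul_left
    _ = B * ∫⁻ y in ⋃ i, Q i, ‖b y‖ₑ := by rw [lintegral_iUnion hQm hQd]
    _ ≤ _ := by gcongr; exact Measure.restrict_le_self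

lemma weak_type {K : E3 → H₁ →L[ℂ] H₂} (hK : NK K) {B : ℝ≥0∞} (hH : Hor K B) {r a : ℝ}
    {A : ℝ≥0∞} (hr : 1 ≤ r) (ha : 0 ≤ a) (hG : Gr K r a A) {f : E3 → H₁} (hf : Adm f) {l : ℝ}
    (hl : 0 < l) :
    volume {x | (125 * a + 1) * l < ‖T K f x‖} ≤
      (A + 1000 + 2 * B) * ((∫⁻ x, ‖f x‖ₑ) / ENNReal.ofReal l) := by
  obtain ⟨ι, _, c, ρ, Q, g, hρ, hQm, hQd, hQ, hg, hgl, hgf, hfg, hbi, hvol⟩ := cz_decomp hf hl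
  set b : E3 → H₁ := fun x => f x - g x with hbdef
  have hb : Adm b := by
    obtain ⟨M, hM⟩ := hf.bdd
    obtain ⟨M', hM'⟩ := hg.bdd
    exact ⟨hf.meas.sub hg.meas, hf.int.sub hg.int, M + M', fun x =>
      (norm_sub_le _ _).trans (add_le_add (hM x) (hM' x))⟩
  have hTf : ∀ x, T K f x = T K g x + T K b x := by
    intro x
    rw [← T_add hK hg hb]
    congr 1
    ext y
    simp [hbdef]
  have hbn : ∫⁻ x, ‖b x‖ₑ ≤ 2 * ∫⁻ x, ‖f x‖ₑ := by
    calc ∫⁻ x, ‖b x‖ₑ ≤ ∫⁻ x, (‖f x‖ₑ + ‖g x‖ₑ) := lintegral_mono fun x => enorm_sub_le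
      _ = (∫⁻ x, ‖f x‖ₑ) + ∫⁻ x, ‖g x‖ₑ := lintegral_add_left hf.meas.enorm _
      _ ≤ _ := by rw [two_mul]; gcongr
  set U := ⋃ i, closedBall (c i) (2 * ρ i) with hU
  have hUm : MeasurableSet U := MeasurableSet.iUnion fun i => measurableSet_closedBall
  have hl0 : ENNReal.ofReal l ≠ 0 := by simpa using hl
  have hsub : {x | (125 * a + 1) * l < ‖T K f x‖} ⊆
      {x | a * (125 * l) < ‖T K g x‖} ∪ U ∪ ({x | ENNReal.ofReal l ≤ ‖T K b x‖ₑ} ∩ Uᶜ) := by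
    intro x hx
    by_contra hc
    simp only [mem_union, mem_inter_iff, not_or, not_and, mem_setOf_eq, mem_compl_iff] at hc
    have h1 := not_lt.1 hc.1.1
    have h3 : ‖T K b x‖ < l := by
      by_contra! hcc
      refine hc.2 ?_ hc.1.2
      rw [← ofReal_norm]
      exact ENNReal.ofReal_le_ofReal hcc
    have h4 : ‖T K f x‖ ≤ ‖T K g x‖ + ‖T K b x‖ := by rw [hTf]; exact norm_add_le _ _
    have h5 : (125 * a + 1) * l < ‖T K f x‖ := hx
    linarith
  have p1 : volume {x | a * (125 * l) < ‖T K g x‖} ≤ A * ((∫⁻ x, ‖f x‖ₑ) / ENNReal.ofReal l) := by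
    refine (hG g hg (125 * l) (by positivity) hgl).trans ?_
    gcongr
    rw [div_eq_mul_inv, ← lintegral_mul_const _ hf.meas.enorm] 
    calc ∫⁻ x, (‖g x‖ₑ / ENNReal.ofReal (125 * l)) ^ r
        ≤ ∫⁻ x, ‖g x‖ₑ * (ENNReal.ofReal l)⁻¹ := by
          refine lintegral_mono fun x => ?_
          have h1 : ‖g x‖ₑ / ENNReal.ofReal (125 * l) ≤ 1 := by
            refine ENNReal.div_le_of_le_mul ?_
            rw [one_mul, ← ofReal_norm]
            exact ENNReal.ofReal_le_ofReal (hgl x)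
          refine (ENNReal.rpow_le_rpow_of_exponent_ge h1 hr).trans ?_
          rw [ENNReal.rpow_one, div_eq_mul_inv]
          gcongr
          linarith
      _ = (∫⁻ x, ‖g x‖ₑ) * (ENNReal.ofReal l)⁻¹ := lintegral_mul_const _ hg.meas.enorm
      _ ≤ (∫⁻ x, ‖f x‖ₑ) * (ENNReal.ofReal l)⁻¹ := by gcongr
      _ = _ := (lintegral_mul_const _ hf.meas.enorm).symm
  have p2 : volume U ≤ 1000 * ((∫⁻ x, ‖f x‖ₑ) / ENNReal.ofReal l) :=
    (measure_iUnion_le _).trans hvol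
  have p3 : volume ({x | ENNReal.ofReal l ≤ ‖T K b x‖ₑ} ∩ Uᶜ) ≤
      2 * B * ((∫⁻ x, ‖f x‖ₑ) / ENNReal.ofReal l) := by
    have hTb := T_adm hK hb
    have h1 := mul_meas_ge_le_lintegral (μ := volume.restrict Uᶜ) hTb.meas.enorm (ENNReal.ofReal l)
    rw [Measure.restrict_apply (measurableSet_le measurable_const hTb.meas.enorm)] at h1
    have h2 := bad_part hK hH hb c ρ Q hρ hQm hQd hQ (by
      filter_upwards [hfg] with x hx hxU
      rw [hbdef]; simp [hx hxU]) hbi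
    rw [← mul_div_assoc, ENNReal.le_div_iff_mul_le (Or.inl hl0) (Or.inl ENNReal.ofReal_ne_top),
      mul_comm]
    refine h1.trans (h2.trans ?_)
    calc B * ∫⁻ x, ‖b x‖ₑ ≤ B * (2 * ∫⁻ x, ‖f x‖ₑ) := by gcongr
      _ = _ := by ring
  calc _ ≤ _ := measure_mono hsub
    _ ≤ _ := (measure_union_le _ _).trans (add_le_add_left (measure_union_le _ _) _)
    _ ≤ A * ((∫⁻ x, ‖f x‖ₑ) / ENNReal.ofReal l) + 1000 * ((∫⁻ x, ‖f x‖ₑ) / ENNReal.ofReal l) +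
      2 * B * ((∫⁻ x, ‖f x‖ₑ) / ENNReal.ofReal l) := by gcongr
    _ = _ := by ring

end CZ3
end KP

namespace KP

open Metric Set Filter

lemma inner1 {q φ : ℝ} (hq : 1 < q) (hφ : 0 ≤ φ) :
    ∫⁻ t in Ioi (0:ℝ), (Ioi t).indicator (fun v => ENNReal.ofReal (v / t)) φ * ENNReal.ofReal (t ^ (q - 1)) ≤
      ENNReal.ofReal (1 / (q - 1)) * ENNReal.ofReal (φ ^ q) := by
  have hI : IntervalIntegrable (fun t : ℝ => φ * t ^ (q - 2)) volume 0 φ :=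
    (intervalIntegral.intervalIntegrable_rpow' (by linarith)).const_mul φ
  rw [intervalIntegrable_iff_integrableOn_Ioc_of_le hφ] at hI
  have h1 : ∫⁻ t in Ioi (0:ℝ), (Ioi t).indicator (fun v => ENNReal.ofReal (v / t)) φ * ENNReal.ofReal (t ^ (q - 1))
      ≤ ∫⁻ t in Ioi (0:ℝ), (Ioc 0 φ).indicator (fun t => ENNReal.ofReal (φ * t ^ (q - 2))) t := by
    refine setLIntegral_mono' measurableSet_Ioi fun t ht => ?_
    have ht0 : (0:ℝ) < t := ht
    by_cases h : t < φ
    · rw [indicator_of_mem (show φ ∈ Ioi t from h), indicator_of_mem (show t ∈ Ioc 0 φ from ⟨ht0, h.le⟩),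
        ← ENNReal.ofReal_mul (by positivity)]
      apply le_of_eq
      congr 1
      rw [div_mul_eq_mul_div, mul_div_assoc, ← Real.rpow_sub_one ht0.ne']
      congr 2; ring
    · rw [indicator_of_notMem (show φ ∉ Ioi t from h), zero_mul]
      exact bot_le
  refine h1.trans ?_
  rw [lintegral_indicator measurableSet_Ioc, Measure.restrict_restrict measurableSet_Ioc,
    inter_eq_left.2 Ioc_subset_Ioi_self, ← ofReal_integral_eq_lintegral_ofReal hI]
  · rw [← ENNReal.ofReal_mul (by apply div_nonneg <;> linarith)]
    apply ENNReal.ofReal_le_ofReal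
    rw [← intervalIntegral.integral_of_le hφ, intervalIntegral.integral_const_mul,
      integral_rpow (Or.inl (by linarith)), Real.zero_rpow (by linarith), sub_zero,
      show q - 2 + 1 = q - 1 by ring]
    rcases hφ.eq_or_lt with h | h
    · rw [← h, Real.zero_rpow (by linarith)]; simp [Real.zero_rpow (show q ≠ 0 by linarith)]
    · rw [Real.rpow_sub_one h.ne']
      apply le_of_eq; field_simp
  · filter_upwards [ae_restrict_mem measurableSet_Ioc] with t ht
    have := ht.1
    positivity

lemma inner2 {q r φ : ℝ} (hq : 1 < q) (hr : q < r) (hφ : 0 ≤ φ) :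
    ∫⁻ t in Ioi (0:ℝ), (Iic t).indicator (fun v => ENNReal.ofReal ((v / t) ^ r)) φ * ENNReal.ofReal (t ^ (q - 1)) ≤
      ENNReal.ofReal (1 / (r - q)) * ENNReal.ofReal (φ ^ q) := by
  rcases hφ.eq_or_lt with h0 | h0
  · rw [← h0]
    refine le_trans (le_of_eq ?_) bot_le
    rw [show (⊥ : ℝ≥0∞) = 0 from rfl]
    calc _ = ∫⁻ t in Ioi (0:ℝ), 0 := by
          congr 1; ext t
          rw [indicator_apply]
          split_ifs <;> simp [Real.zero_rpow (show r ≠ 0 by linarith)]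
      _ = 0 := by simp
  have hI := (integrableOn_Ioi_rpow_of_lt (show q - 1 - r < -1 by linarith) h0).const_mul (φ ^ r)
  have h1 : ∫⁻ t in Ioi (0:ℝ), (Iic t).indicator (fun v => ENNReal.ofReal ((v / t) ^ r)) φ * ENNReal.ofReal (t ^ (q - 1))
      ≤ ∫⁻ t in Ioi (0:ℝ), (Ici φ).indicator (fun t => ENNReal.ofReal (φ ^ r * t ^ (q - 1 - r))) t := by
    refine setLIntegral_mono' measurableSet_Ioi fun t ht => ?_
    have ht0 : (0:ℝ) < t := ht
    by_cases h : φ ≤ t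
    · rw [indicator_of_mem (show φ ∈ Iic t from h), indicator_of_mem (show t ∈ Ici φ from h),
        ← ENNReal.ofReal_mul (by positivity)]
      apply le_of_eq
      congr 1
      rw [Real.div_rpow hφ ht0.le, Real.rpow_sub ht0 (q - 1) r]; ring
    · rw [indicator_of_notMem (show φ ∉ Iic t from h), zero_mul]
      exact bot_le
  refine h1.trans ?_
  rw [lintegral_indicator measurableSet_Ici, Measure.restrict_restrict measurableSet_Ici,
    inter_eq_left.2 (Ici_subset_Ioi.2 h0), setLIntegral_congr Ioi_ae_eq_Ici.symm,
    ← ofReal_integral_eq_lintegral_ofReal hI]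
  · rw [← ENNReal.ofReal_mul (by apply div_nonneg <;> linarith)]
    apply ENNReal.ofReal_le_ofReal
    rw [integral_const_mul, integral_Ioi_rpow_of_lt (by linarith) h0, show q - 1 - r + 1 = q - r by ring,
      Real.rpow_sub h0, show r - q = -(q - r) by ring]
    have : q - r ≠ 0 := by linarith
    have h3 : φ ^ r ≠ 0 := by positivity
    apply le_of_eq
    have h4 : -(q - r) ≠ 0 := neg_ne_zero.2 this
    rw [neg_div, one_div, inv_neg]
    field_simp
  · filter_upwards [ae_restrict_mem measurableSet_Ioi] with t ht
    have : 0 < t := h0.trans ht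
    positivity

lemma marc_aux {φ G : E3 → ℝ} (hφm : Measurable φ) (hφ : ∀ x, 0 ≤ φ x) (hGm : Measurable G)
    (hG : ∀ x, 0 ≤ G x) {κ q r : ℝ} (hκ : 0 < κ) (hq : 1 < q) (hr : q < r) {W A : ℝ≥0∞}
    (h : ∀ l : ℝ, 0 < l → volume {x | κ * l < G x} ≤
      W * (∫⁻ x, (Ioi l).indicator (fun v => ENNReal.ofReal (v / l)) (φ x)) +
      A * ∫⁻ x, (Iic l).indicator (fun v => ENNReal.ofReal ((v / l) ^ r)) (φ x)) :
    ∫⁻ x, ENNReal.ofReal (G x ^ q) ≤ ENNReal.ofReal (κ ^ q) * (ENNReal.ofReal q *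
      (W * ENNReal.ofReal (1 / (q - 1)) + A * ENNReal.ofReal (1 / (r - q)))) *
        ∫⁻ x, ENNReal.ofReal (φ x ^ q) := by
  have m1 : Measurable fun p : ℝ × E3 =>
      (Ioi p.1).indicator (fun v => ENNReal.ofReal (v / p.1)) (φ p.2) := by
    have : (fun p : ℝ × E3 => (Ioi p.1).indicator (fun v => ENNReal.ofReal (v / p.1)) (φ p.2)) =
      {p : ℝ × E3 | p.1 < φ p.2}.indicator (fun p => ENNReal.ofReal (φ p.2 / p.1)) := by
      ext p; simp only [indicator_apply]; rfl
    rw [this]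
    refine Measurable.indicator ?_ (measurableSet_lt measurable_fst (hφm.comp measurable_snd))
    exact ((hφm.comp measurable_snd).div measurable_fst).ennreal_ofReal
  have m2 : Measurable fun p : ℝ × E3 =>
      (Iic p.1).indicator (fun v => ENNReal.ofReal ((v / p.1) ^ r)) (φ p.2) := by
    have : (fun p : ℝ × E3 => (Iic p.1).indicator (fun v => ENNReal.ofReal ((v / p.1) ^ r)) (φ p.2)) =
      {p : ℝ × E3 | φ p.2 ≤ p.1}.indicator (fun p => ENNReal.ofReal ((φ p.2 / p.1) ^ r)) := by
      ext p; simp only [indicator_apply]; rfl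
    rw [this]
    refine Measurable.indicator ?_ (measurableSet_le (hφm.comp measurable_snd) measurable_fst)
    exact (((hφm.comp measurable_snd).div measurable_fst).pow_const r).ennreal_ofReal
  have m3 : Measurable fun p : ℝ × E3 => ENNReal.ofReal (p.1 ^ (q - 1)) :=
    (measurable_fst.pow_const _).ennreal_ofReal
  have mt : Measurable fun t : ℝ => ENNReal.ofReal (t ^ (q - 1)) :=
    (measurable_id.pow_const _).ennreal_ofReal
  have hlc := lintegral_rpow_eq_lintegral_meas_lt_mul (volume : Measure E3) (f := fun x => G x / κ)
    (p := q) (Eventually.of_forall fun x => div_nonneg (hG x) hκ.le) (hGm.div_const κ).aemeasurable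
    (by linarith)
  have hL : ∫⁻ x, ENNReal.ofReal (G x ^ q) =
      ENNReal.ofReal (κ ^ q) * ∫⁻ x, ENNReal.ofReal ((G x / κ) ^ q) := by
    rw [← lintegral_const_mul _ ((hGm.div_const κ).pow_const q).ennreal_ofReal]
    congr 1; ext x
    rw [← ENNReal.ofReal_mul (by positivity), Real.div_rpow (hG x) hκ.le]
    congr 1
    have : κ ^ q ≠ 0 := by positivity
    field_simp
  rw [hL, hlc, mul_assoc, mul_assoc]
  gcongr
  calc ∫⁻ t in Ioi (0:ℝ), volume {a | t < G a / κ} * ENNReal.ofReal (t ^ (q - 1))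
      ≤ ∫⁻ t in Ioi (0:ℝ), (W * (∫⁻ x, (Ioi t).indicator (fun v => ENNReal.ofReal (v / t)) (φ x) * ENNReal.ofReal (t ^ (q - 1))) +
      A * ∫⁻ x, (Iic t).indicator (fun v => ENNReal.ofReal ((v / t) ^ r)) (φ x) * ENNReal.ofReal (t ^ (q - 1))) := by
        refine setLIntegral_mono' measurableSet_Ioi fun t ht => ?_
        have n1 : Measurable fun x => (Ioi t).indicator (fun v => ENNReal.ofReal (v / t)) (φ x) :=
          m1.comp measurable_prodMk_left
        have n2 : Measurable fun x => (Iic t).indicator (fun v => ENNReal.ofReal ((v / t) ^ r)) (φ x) :=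
          m2.comp measurable_prodMk_left
        rw [lintegral_mul_const _ n1, lintegral_mul_const _ n2, ← mul_assoc, ← mul_assoc, ← add_mul]
        gcongr
        refine le_trans (measure_mono ?_) (h t ht)
        intro x hx
        have hx' : t < G x / κ := hx
        rw [lt_div_iff₀ hκ] at hx'
        show κ * t < G x
        linarith
    _ = W * (∫⁻ t in Ioi (0:ℝ), ∫⁻ x, (Ioi t).indicator (fun v => ENNReal.ofReal (v / t)) (φ x) * ENNReal.ofReal (t ^ (q - 1))) +
      A * ∫⁻ t in Ioi (0:ℝ), ∫⁻ x, (Iic t).indicator (fun v => ENNReal.ofReal ((v / t) ^ r)) (φ x) * ENNReal.ofReal (t ^ (q - 1)) := by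
        have a1 : Measurable fun t : ℝ => ∫⁻ x, (Ioi t).indicator (fun v => ENNReal.ofReal (v / t)) (φ x) * ENNReal.ofReal (t ^ (q - 1)) :=
          Measurable.lintegral_prod_right' (m1.mul m3)
        have a2 : Measurable fun t : ℝ => ∫⁻ x, (Iic t).indicator (fun v => ENNReal.ofReal ((v / t) ^ r)) (φ x) * ENNReal.ofReal (t ^ (q - 1)) :=
          Measurable.lintegral_prod_right' (m2.mul m3)
        rw [lintegral_add_left (a1.const_mul W), lintegral_const_mul _ a1, lintegral_const_mul _ a2]
    _ = W * (∫⁻ x, ∫⁻ t in Ioi (0:ℝ), (Ioi t).indicator (fun v => ENNReal.ofReal (v / t)) (φ x) * ENNReal.ofReal (t ^ (q - 1))) +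
      A * ∫⁻ x, ∫⁻ t in Ioi (0:ℝ), (Iic t).indicator (fun v => ENNReal.ofReal ((v / t) ^ r)) (φ x) * ENNReal.ofReal (t ^ (q - 1)) := by
        congr 2
        · exact lintegral_lintegral_swap (m1.mul m3).aemeasurable
        · exact lintegral_lintegral_swap (m2.mul m3).aemeasurable
    _ ≤ W * (∫⁻ x, ENNReal.ofReal (1 / (q - 1)) * ENNReal.ofReal (φ x ^ q)) +
        A * ∫⁻ x, ENNReal.ofReal (1 / (r - q)) * ENNReal.ofReal (φ x ^ q) := by
        gcongr with x x
        · exact inner1 hq (hφ x)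
        · exact inner2 hq hr (hφ x)
    _ = _ := by
        have mq : Measurable fun x => ENNReal.ofReal (φ x ^ q) := (hφm.pow_const q).ennreal_ofReal
        rw [lintegral_const_mul _ mq, lintegral_const_mul _ mq]; ring

section CZ4
variable {H₁ H₂ : Type}
  [NormedAddCommGroup H₁] [NormedSpace ℂ H₁] [CompleteSpace H₁] [SecondCountableTopology H₁]
  [NormedAddCommGroup H₂] [NormedSpace ℂ H₂] [CompleteSpace H₂] [SecondCountableTopology H₂]

/-- constant in the Marcinkiewicz interpolation -/
noncomputable def mC (B : ℝ≥0∞) (r a : ℝ) (A : ℝ≥0∞) (q : ℝ) : ℝ≥0∞ :=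
  ENNReal.ofReal ((125 * a + 1 + a) ^ q) * (ENNReal.ofReal q *
      ((A + 1000 + 2 * B) * ENNReal.ofReal (1 / (q - 1)) + A * ENNReal.ofReal (1 / (r - q))))

lemma mC_ne_top {B : ℝ≥0∞} {r a : ℝ} {A : ℝ≥0∞} {q : ℝ} (hB : B ≠ ⊤) (hA : A ≠ ⊤) :
    mC B r a A q ≠ ⊤ := by
  unfold mC
  finiteness

lemma strong_type {K : E3 → H₁ →L[ℂ] H₂} (hK : NK K) {B : ℝ≥0∞} (hH : Hor K B) {r a q : ℝ}
    {A : ℝ≥0∞} (ha : 0 ≤ a) (hG : Gr K r a A) (hq : 1 < q) (hr : q < r) {f : E3 → H₁} (hf : Adm f) :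
    ∫⁻ x, ‖T K f x‖ₑ ^ q ≤ mC B r a A q * ∫⁻ x, ‖f x‖ₑ ^ q := by
  have hTf := T_adm hK hf
  have key := marc_aux (φ := fun x => ‖f x‖) (G := fun x => ‖T K f x‖) hf.meas.norm.measurable
    (fun x => norm_nonneg _) hTf.meas.norm.measurable (fun x => norm_nonneg _)
    (κ := 125 * a + 1 + a) (q := q) (r := r) (by positivity) hq hr (W := A + 1000 + 2 * B) (A := A) ?_
  · have e1 : ∀ (H : Type) [NormedAddCommGroup H] (h : E3 → H),
        (fun x => ENNReal.ofReal (‖h x‖ ^ q)) = fun x => ‖h x‖ₑ ^ q := by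
      intro H _ h; ext x
      rw [← ENNReal.ofReal_rpow_of_nonneg (norm_nonneg _) (by linarith), ofReal_norm]
    rw [e1, e1] at key
    exact key
  intro l hl
  set S : Set E3 := {x | l < ‖f x‖} with hS
  have hSm : MeasurableSet S := measurableSet_lt measurable_const hf.meas.norm.measurable
  have hl0 : ENNReal.ofReal l ≠ 0 := by simpa using hl
  have h1 := hf.indicator hSm
  have h2 := hf.indicator hSm.compl
  have w1 := weak_type hK hH (by linarith) ha hG h1 hl
  have w2 := hG _ h2 l hl (by
    intro x
    by_cases hx : x ∈ S
    · rw [indicator_of_notMem (by simpa using hx)]; simpa using hl.le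
    · rw [indicator_of_mem (by simpa using hx)]; exact not_lt.1 hx)
  have hsplit : ∀ x, T K f x = T K (S.indicator f) x + T K (Sᶜ.indicator f) x := by
    intro x
    rw [← T_add hK h1 h2]
    congr 1
    ext y
    exact (congrFun (indicator_self_add_compl S f) y).symm
  have hsub : {x | (125 * a + 1 + a) * l < ‖T K f x‖} ⊆
      {x | (125 * a + 1) * l < ‖T K (S.indicator f) x‖} ∪ {x | a * l < ‖T K (Sᶜ.indicator f) x‖} := by
    intro x hx
    by_contra hc
    simp only [mem_union, not_or] at hc
    have c1 : ‖T K (S.indicator f) x‖ ≤ (125 * a + 1) * l := not_lt.1 hc.1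
    have c2 : ‖T K (Sᶜ.indicator f) x‖ ≤ a * l := not_lt.1 hc.2
    have c3 : (125 * a + 1 + a) * l < ‖T K f x‖ := hx
    rw [hsplit] at c3
    have := norm_add_le (T K (S.indicator f) x) (T K (Sᶜ.indicator f) x)
    linarith
  refine (measure_mono hsub).trans ((measure_union_le _ _).trans ?_)
  refine add_le_add (w1.trans (le_of_eq ?_)) (w2.trans (le_of_eq ?_))
  · congr 1
    rw [div_eq_mul_inv, ← lintegral_mul_const _ h1.meas.enorm]
    congr 1; ext x
    by_cases hx : l < ‖f x‖
    · rw [indicator_of_mem (show x ∈ S from hx), indicator_of_mem (show ‖f x‖ ∈ Ioi l from hx),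
        ENNReal.ofReal_div_of_pos hl, ofReal_norm, div_eq_mul_inv]
    · rw [indicator_of_notMem (show x ∉ S from hx), indicator_of_notMem (show ‖f x‖ ∉ Ioi l from hx)]
      simp
  · congr 1
    congr 1; ext x
    by_cases hx : l < ‖f x‖
    · rw [indicator_of_notMem (show x ∉ Sᶜ from fun h => h hx), indicator_of_notMem (show ‖f x‖ ∉ Iic l from not_le.2 hx)]
      simp [show 0 < r by linarith]
    · rw [indicator_of_mem (show x ∈ Sᶜ from hx), indicator_of_mem (show ‖f x‖ ∈ Iic l from not_lt.1 hx),
        ← ENNReal.ofReal_rpow_of_nonneg (by positivity) (by linarith), ENNReal.ofReal_div_of_pos hl, ofReal_norm]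

end CZ4
end KP

namespace KP

open Metric Set Filter

/-- strong boundedness of `T K` -/
def Bd {H₁ H₂ : Type} [NormedAddCommGroup H₁] [NormedSpace ℂ H₁]
    [NormedAddCommGroup H₂] [NormedSpace ℂ H₂] (K : E3 → H₁ →L[ℂ] H₂) (q : ℝ) (C : ℝ≥0∞) : Prop :=
  ∀ f : E3 → H₁, Adm f → ∫⁻ x, ‖T K f x‖ₑ ^ q ≤ C * ∫⁻ x, ‖f x‖ₑ ^ q

section CZ5
variable {H₁ H₂ : Type}
  [NormedAddCommGroup H₁] [InnerProductSpace ℂ H₁] [CompleteSpace H₁] [SecondCountableTopology H₁]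
  [NormedAddCommGroup H₂] [InnerProductSpace ℂ H₂] [CompleteSpace H₂] [SecondCountableTopology H₂]

/-- dual kernel -/
noncomputable def dual {H₁ H₂ : Type} [NormedAddCommGroup H₁] [InnerProductSpace ℂ H₁] [CompleteSpace H₁]
  [NormedAddCommGroup H₂] [InnerProductSpace ℂ H₂] [CompleteSpace H₂]
    (K : E3 → H₁ →L[ℂ] H₂) : E3 → H₂ →L[ℂ] H₁ :=
  fun z => ContinuousLinearMap.adjoint (K (-z))

lemma dual_dual (K : E3 → H₁ →L[ℂ] H₂) : dual (dual K) = K := by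
  ext z : 1
  simp [dual]

lemma NK.dual {K : E3 → H₁ →L[ℂ] H₂} (hK : NK K) : NK (dual K) := by
  have hc : Continuous (KP.dual K) :=
    (ContinuousLinearMap.adjoint (𝕜 := ℂ) (E := H₁) (F := H₂)).continuous.comp
      (hK.cont.comp continuous_neg)
  have hn : ∀ z, ‖KP.dual K z‖ = ‖K (-z)‖ := fun z => LinearIsometryEquiv.norm_map _ _
  refine ⟨hc, ?_, ?_⟩
  · refine (hK.int.comp_neg).norm.mono' hc.aestronglyMeasurable (Eventually.of_forall fun z => ?_)
    rw [hn]
  · obtain ⟨M, hM⟩ := hK.bdd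
    exact ⟨M, fun z => by rw [hn]; exact hM _⟩

lemma fubini_dual {K : E3 → H₁ →L[ℂ] H₂} (hK : NK K) {f : E3 → H₁} (hf : Adm f) {h : E3 → H₂}
    (hh : Adm h) :
    ∫ x, inner ℂ (h x) (T K f x) = ∫ y, inner ℂ (T (dual K) h y) (f y) := by
  have e1 : ∀ x, inner ℂ (h x) (T K f x) = ∫ y, inner ℂ (h x) (K (x - y) (f y)) := by
    intro x
    rw [T, integral_inner (T_integrable hK hf x)]
  have e2 : ∀ y, inner ℂ (T (dual K) h y) (f y) = ∫ x, inner ℂ (h x) (K (x - y) (f y)) := by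
    intro y
    have := integral_inner (𝕜 := ℂ) (T_integrable hK.dual hh y) (f y)
    rw [← inner_conj_symm, T, ← this, ← integral_conj]
    congr 1; ext x
    rw [inner_conj_symm, dual, ContinuousLinearMap.adjoint_inner_left, neg_sub]
  simp_rw [e1, e2]
  rw [integral_integral_swap]
  obtain ⟨M, hM⟩ := hK.bdd
  have hm : StronglyMeasurable (Function.uncurry fun x y => inner ℂ (h x) (K (x - y) (f y))) :=
    StronglyMeasurable.inner (𝕜 := ℂ) (hh.meas.comp_measurable measurable_fst) (T_meas hK hf.meas)
  have hi : Integrable (fun p : E3 × E3 => M * (‖h p.1‖ * ‖f p.2‖)) (volume.prod volume) :=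
    (hh.int.norm.mul_prod hf.int.norm).const_mul M
  refine hi.mono' hm.aestronglyMeasurable (Eventually.of_forall fun p => ?_)
  refine (norm_inner_le_norm _ _).trans ?_
  calc ‖h p.1‖ * ‖K (p.1 - p.2) (f p.2)‖ ≤ ‖h p.1‖ * (M * ‖f p.2‖) := by
        gcongr
        exact ((K (p.1 - p.2)).le_opNorm (f p.2)).trans
          (mul_le_mul_of_nonneg_right (hM _) (norm_nonneg _))
    _ = _ := by ring

lemma Adm.rpow_lt_top {H : Type} [NormedAddCommGroup H] {f : E3 → H} (hf : Adm f) {q : ℝ} (hq : 1 ≤ q) :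
    ∫⁻ x, ‖f x‖ₑ ^ q < ⊤ := by
  obtain ⟨M, hM⟩ := hf.bdd
  calc ∫⁻ x, ‖f x‖ₑ ^ q ≤ ∫⁻ x, ENNReal.ofReal (M) ^ (q - 1) * ‖f x‖ₑ := by
        refine lintegral_mono fun x => ?_
        have : ‖f x‖ₑ ^ q = ‖f x‖ₑ ^ (q - 1) * ‖f x‖ₑ := by
          nth_rw 3 [← ENNReal.rpow_one ‖f x‖ₑ]
          rw [← ENNReal.rpow_add_of_nonneg _ _ (by linarith) zero_le_one]
          congr 1; ring
        rw [this]
        gcongr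
        rw [← ofReal_norm]; exact ENNReal.ofReal_le_ofReal (hM x)
    _ = ENNReal.ofReal M ^ (q - 1) * ∫⁻ x, ‖f x‖ₑ := lintegral_const_mul _ hf.meas.enorm
    _ < ⊤ := ENNReal.mul_lt_top (ENNReal.rpow_lt_top_of_nonneg (by linarith) ENNReal.ofReal_ne_top) hf.int.2

lemma duality {K : E3 → H₁ →L[ℂ] H₂} (hK : NK K) {q q' : ℝ} (hq : 2 ≤ q) (hqq : q'.HolderConjugate q)
    {C : ℝ≥0∞} (hC : C ≠ ⊤)
    (hd : Bd (dual K) q' C) : Bd K q (C ^ (q - 1)) := by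
  intro f hf
  have hTf := T_adm hK hf
  obtain ⟨M, hM⟩ := hTf.bdd
  set h : E3 → H₂ := fun x => ((‖T K f x‖ ^ (q - 2) : ℝ) : ℂ) • T K f x with hh
  have hM0 : 0 ≤ M := (norm_nonneg _).trans (hM 0)
  have hnorm : ∀ x, ‖h x‖ = ‖T K f x‖ ^ (q - 2) * ‖T K f x‖ := by
    intro x
    rw [hh]; simp only [norm_smul, Complex.norm_real, Real.norm_eq_abs]
    rw [abs_of_nonneg (by positivity)]
  have hadm : Adm h := by
    have hm : StronglyMeasurable h := by
      refine StronglyMeasurable.smul ?_ hTf.meas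
      exact (Complex.measurable_ofReal.comp (hTf.meas.norm.measurable.pow_const _)).stronglyMeasurable
    refine ⟨hm, ?_, M ^ (q - 2) * M, fun x => ?_⟩
    · refine (hTf.int.norm.const_mul (M ^ (q - 2))).mono' hm.aestronglyMeasurable
        (Eventually.of_forall fun x => ?_)
      rw [hnorm]
      gcongr
      exact hM x
    · rw [hnorm]
      gcongr
      · exact hM x
      · exact hM x
  have hI1 : ∀ x, ‖T K f x‖ₑ ^ q = ‖(inner ℂ (h x) (T K f x) : ℂ)‖ₑ := by
    intro x
    rw [hh]
    simp only
    rw [inner_smul_left, inner_self_eq_norm_sq_to_K, Complex.conj_ofReal, enorm_mul, enorm_pow]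
    rw [← ofReal_norm, ← ofReal_norm, ← ofReal_norm]
    simp only [Complex.norm_real, norm_norm, Real.norm_eq_abs, Complex.coe_algebraMap, abs_norm]
    rw [abs_of_nonneg (by positivity), ← ENNReal.ofReal_pow (by positivity), ← ENNReal.ofReal_mul (by positivity),
      ENNReal.ofReal_rpow_of_nonneg (by positivity) (by linarith), ← Real.rpow_natCast _ 2,
      ← Real.rpow_add_of_nonneg (by positivity) (by linarith) (by norm_num)]
    congr 2
    norm_num
  have hI2 : ∀ x, inner ℂ (h x) (T K f x) = ((‖T K f x‖ ^ q : ℝ) : ℂ) := by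
    intro x
    rw [hh]
    simp only
    rw [inner_smul_left, inner_self_eq_norm_sq_to_K, Complex.conj_ofReal]
    simp only [Complex.coe_algebraMap]
    rw [← Complex.ofReal_pow, ← Complex.ofReal_mul, ← Real.rpow_natCast _ 2,
      ← Real.rpow_add_of_nonneg (by positivity) (by linarith) (by norm_num)]
    congr 2
    norm_num
  set I := ∫⁻ x, ‖T K f x‖ₑ ^ q with hIdef
  set J := ∫⁻ x, ‖f x‖ₑ ^ q with hJdef
  have hI : I = ‖∫ x, inner ℂ (h x) (T K f x)‖ₑ := by
    simp_rw [hI2]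
    rw [integral_complex_ofReal, ← ofReal_norm, Complex.norm_real, Real.norm_eq_abs,
      abs_of_nonneg (integral_nonneg fun x => by positivity), ofReal_integral_eq_lintegral_ofReal]
    · rw [hIdef]; congr 1; ext x
      rw [← ofReal_norm, ENNReal.ofReal_rpow_of_nonneg (by positivity) (by linarith)]
    · refine (hTf.int.norm.const_mul (M ^ (q - 1))).mono'
        (hTf.meas.norm.measurable.pow_const _).aestronglyMeasurable (Eventually.of_forall fun x => ?_)
      rw [Real.norm_eq_abs, abs_of_nonneg (by positivity)]
      calc ‖T K f x‖ ^ q = ‖T K f x‖ ^ (q - 1) * ‖T K f x‖ := by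
            rw [← Real.rpow_add_one' (norm_nonneg _) (by linarith)]; congr 1; ring
        _ ≤ _ := by
            gcongr
            · linarith
            · exact hM x
    · exact Eventually.of_forall fun x => by simp only [Pi.zero_apply]; positivity
  have hIt : I < ⊤ := hTf.rpow_lt_top (by linarith)
  have hdh := hd h hadm
  have hq0 : 0 < q := by linarith
  have hq'0 : 0 < q' := hqq.pos
  have hhI : ∫⁻ x, ‖h x‖ₑ ^ q' = I := by
    rw [hIdef]
    congr 1; ext x
    rw [← ofReal_norm, hnorm, ← ofReal_norm, ENNReal.ofReal_rpow_of_nonneg (by positivity) hq'0.le,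
      ENNReal.ofReal_rpow_of_nonneg (by positivity) hq0.le,
      ← Real.rpow_add_one' (norm_nonneg _) (by linarith), ← Real.rpow_mul (norm_nonneg _)]
    congr 2
    have := hqq.sub_one_mul_conj
    have h2 := hqq.symm.sub_one_mul_conj
    linarith
  have hTh := T_adm hK.dual hadm
  have key : I ≤ (C * I) ^ (1 / q') * J ^ (1 / q) := by
    calc I = ‖∫ y, inner ℂ (T (dual K) h y) (f y)‖ₑ := by rw [hI, fubini_dual hK hf hadm]
      _ ≤ ∫⁻ y, ‖T (dual K) h y‖ₑ * ‖f y‖ₑ := by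
          refine (enorm_integral_le_lintegral_enorm _).trans (lintegral_mono fun y => ?_)
          rw [← ofReal_norm, ← ofReal_norm, ← ofReal_norm, ← ENNReal.ofReal_mul (norm_nonneg _)]
          exact ENNReal.ofReal_le_ofReal (norm_inner_le_norm _ _)
      _ ≤ (∫⁻ y, ‖T (dual K) h y‖ₑ ^ q') ^ (1 / q') * (∫⁻ y, ‖f y‖ₑ ^ q) ^ (1 / q) :=
          ENNReal.lintegral_mul_le_Lp_mul_Lq _ hqq hTh.meas.enorm.aemeasurable hf.meas.enorm.aemeasurable
      _ ≤ _ := by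
          gcongr
          rw [hhI] at hdh; exact hdh
  rcases eq_or_ne I 0 with h0 | h0
  · rw [h0]; exact bot_le
  have hid : 1 / q = 1 - 1 / q' := by
    have := hqq.inv_add_inv_eq_one; simp only [one_div]; linarith
  have k2 : I ^ (1 / q) ≤ C ^ (1 / q') * J ^ (1 / q) := by
    have : I ^ (1 / q) = I / I ^ (1 / q') := by
      nth_rw 2 [← ENNReal.rpow_one I]
      rw [← ENNReal.rpow_sub _ _ h0 hIt.ne, ← hid]
    rw [this]
    refine ENNReal.div_le_of_le_mul (key.trans (le_of_eq ?_))
    rw [ENNReal.mul_rpow_of_nonneg _ _ (by positivity)]; ring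
  have k3 := ENNReal.rpow_le_rpow k2 hq0.le
  rw [← ENNReal.rpow_mul, one_div, inv_mul_cancel₀ hq0.ne', ENNReal.rpow_one,
    ENNReal.mul_rpow_of_nonneg _ _ hq0.le, ← ENNReal.rpow_mul, ← ENNReal.rpow_mul, inv_mul_cancel₀ hq0.ne',
    ENNReal.rpow_one] at k3
  have : 1 / q' * q = q - 1 := by
    rw [show 1 / q' = 1 - 1 / q by linarith]; field_simp
  rwa [this] at k3

lemma gr_of_bd {K : E3 → H₁ →L[ℂ] H₂} (hK : NK K) {A : ℝ≥0∞} (h : Bd K 2 A) : Gr K 2 1 A := by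
  intro g hg l hl _
  have hT := T_adm hK hg
  have hl0 : ENNReal.ofReal l ≠ 0 := by simpa using hl
  have h2 := h g hg
  have h1 := mul_meas_ge_le_lintegral (μ := volume) (hT.meas.enorm.pow_const (2:ℝ)) (ENNReal.ofReal l ^ (2:ℝ))
  have e : ∫⁻ x, (‖g x‖ₑ / ENNReal.ofReal l) ^ (2:ℝ) = (∫⁻ x, ‖g x‖ₑ ^ (2:ℝ)) / ENNReal.ofReal l ^ (2:ℝ) := by
    rw [div_eq_mul_inv, ← lintegral_mul_const _ (hg.meas.enorm.pow_const _)]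
    congr 1; ext x
    rw [ENNReal.div_rpow_of_nonneg _ _ (by norm_num), div_eq_mul_inv]
  rw [e, ← mul_div_assoc, ENNReal.le_div_iff_mul_le
    (Or.inl (by simp [hl])) (Or.inl (by finiteness)), mul_comm]
  refine le_trans ?_ (h1.trans h2)
  refine mul_le_mul_right (measure_mono fun x hx => ?_) _
  have hx' : 1 * l < ‖T K g x‖ := hx
  show ENNReal.ofReal l ^ (2:ℝ) ≤ _
  gcongr
  rw [← ofReal_norm]; exact ENNReal.ofReal_le_ofReal (by linarith)

/-- final Calderon-Zygmund constant -/
noncomputable def czC (q : ℝ) (A B : ℝ≥0∞) : ℝ≥0∞ :=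
  if q < 2 then mC B 2 1 A q else if q = 2 then A else (mC B 2 1 A (q / (q - 1))) ^ (q - 1)

lemma czC_ne_top {q : ℝ} {A B : ℝ≥0∞} (hA : A ≠ ⊤) (hB : B ≠ ⊤) (hq : 1 < q) : czC q A B ≠ ⊤ := by
  unfold czC
  split_ifs
  · exact mC_ne_top hB hA
  · exact hA
  · exact ENNReal.rpow_ne_top_of_nonneg (by linarith) (mC_ne_top hB hA)

lemma bd_dual2 {K : E3 → H₁ →L[ℂ] H₂} (hK : NK K) {A : ℝ≥0∞} (hA : A ≠ ⊤) (h : Bd K 2 A) :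
    Bd (dual K) 2 A := by
  have := duality (K := dual K) hK.dual (q := 2) (q' := 2) le_rfl Real.HolderConjugate.two_two hA
    (by rw [dual_dual]; exact h)
  have e : A ^ ((2:ℝ) - 1) = A := by norm_num
  rwa [e] at this

theorem CZmain {K : E3 → H₁ →L[ℂ] H₂} (hK : NK K) {A B : ℝ≥0∞} (hA : A ≠ ⊤) (hB : B ≠ ⊤)
    (hH : Hor K B) (hH' : Hor (dual K) B) (h2 : Bd K 2 A) {q : ℝ} (hq : 1 < q) :
    Bd K q (czC q A B) := by
  unfold czC
  split_ifs with h h'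
  · exact fun f hf => strong_type hK hH zero_le_one (gr_of_bd hK h2) hq h hf
  · rw [h']; exact h2
  · have hq2 : 2 < q := lt_of_le_of_ne (not_lt.1 h) (Ne.symm h')
    have hc : (q / (q - 1)).HolderConjugate q := (Real.HolderConjugate.conjExponent hq).symm
    refine duality hK hq2.le hc (mC_ne_top hB hA) fun f hf => ?_
    refine strong_type hK.dual hH' zero_le_one (gr_of_bd hK.dual (bd_dual2 hK hA h2)) hc.lt ?_ hf
    rw [div_lt_iff₀ (by linarith)]; linarith

end CZ5
end KP

namespace KP

open Metric Set Filter

lemma minsum_real {x : ℝ} (hx : 1 < x) (N : ℕ) :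
    ∀ t : ℝ, 0 < t → (1 ≤ t → ∑ k ∈ Finset.range N, min (x ^ k * t) ((x ^ k * t)⁻¹) ≤ x / (x - 1) * t⁻¹) ∧
      (t < 1 → ∑ k ∈ Finset.range N, min (x ^ k * t) ((x ^ k * t)⁻¹) ≤ (2 * x - t) / (x - 1)) := by
  have hx1 : 0 < x - 1 := by linarith
  induction N with
  | zero =>
    intro t ht
    constructor
    · intro _; simp only [Finset.range_zero, Finset.sum_empty]; positivity
    · intro h; simp only [Finset.range_zero, Finset.sum_empty]
      apply div_nonneg <;> linarith
  | succ N ih =>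
    intro t ht
    have e : ∑ k ∈ Finset.range (N + 1), min (x ^ k * t) ((x ^ k * t)⁻¹) =
        (∑ k ∈ Finset.range N, min (x ^ k * (x * t)) ((x ^ k * (x * t))⁻¹)) + min t t⁻¹ := by
      rw [Finset.sum_range_succ']
      congr 1
      · refine Finset.sum_congr rfl fun k _ => ?_
        rw [pow_succ, mul_assoc]
      · simp
    rw [e]
    have hxt : 0 < x * t := by positivity
    constructor
    · intro h
      have := (ih (x * t) hxt).1 (by nlinarith)
      have h2 : min t t⁻¹ ≤ t⁻¹ := min_le_right _ _
      have h3 : x / (x - 1) * (x * t)⁻¹ + t⁻¹ = x / (x - 1) * t⁻¹ := by field_simp; ring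
      linarith
    · intro h
      have h2 : min t t⁻¹ ≤ t := min_le_left _ _
      rcases lt_or_ge (x * t) 1 with h1 | h1
      · have := (ih (x * t) hxt).2 h1
        have h3 : (2 * x - x * t) / (x - 1) + t = (2 * x - t) / (x - 1) := by field_simp; ring
        linarith
      · have := (ih (x * t) hxt).1 h1
        have h3 : x / (x - 1) * (x * t)⁻¹ ≤ x / (x - 1) := by
          have : (x * t)⁻¹ ≤ 1 := inv_le_one_of_one_le₀ h1
          have h4 : 0 ≤ x / (x - 1) := by positivity
          nlinarith
        have h4 : x / (x - 1) + t ≤ (2 * x - t) / (x - 1) := by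
          rw [div_add' _ _ _ hx1.ne']
          gcongr
          nlinarith
        linarith

lemma minsum {x : ℝ} (hx : 1 < x) (N : ℕ) {t : ℝ} (ht : 0 < t) :
    ∑ k ∈ Finset.range N, min (x ^ k * t) ((x ^ k * t)⁻¹) ≤ 2 * x / (x - 1) := by
  have hx1 : 0 < x - 1 := by linarith
  rcases lt_or_ge t 1 with h | h
  · refine ((minsum_real hx N t ht).2 h).trans ?_
    gcongr; linarith
  · refine ((minsum_real hx N t ht).1 h).trans ?_
    have : t⁻¹ ≤ 1 := inv_le_one_of_one_le₀ h
    calc x / (x - 1) * t⁻¹ ≤ x / (x - 1) * 1 := by gcongr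
      _ ≤ _ := by rw [mul_one]; gcongr; linarith

/-- Poisson-like bump at scale `1/a`. -/
noncomputable def th (a : ℝ) (z : E3) : ℝ := a ^ 3 * ((1 + (a * ‖z‖) ^ 2) ^ 3)⁻¹

lemma th_nonneg {a : ℝ} (ha : 0 < a) (z : E3) : 0 ≤ th a z := by unfold th; positivity

lemma th_pos {a : ℝ} (ha : 0 < a) (z : E3) : 0 < th a z := by unfold th; positivity

lemma th_cont (a : ℝ) : Continuous (th a) := by
  unfold th
  refine continuous_const.mul (Continuous.inv₀ (by fun_prop) fun z => ?_)
  positivity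

lemma lintegral_scale {a : ℝ} (ha : 0 < a) {h : E3 → ℝ≥0∞} (hm : Measurable h) :
    ∫⁻ z, ENNReal.ofReal (a ^ 3) * h (a • z) = ∫⁻ z, h z := by
  have h1 := Measure.map_addHaar_smul (volume : Measure E3) ha.ne'
  have h2 : ∫⁻ z, h (a • z) = ∫⁻ z, h z ∂(Measure.map (fun x : E3 => a • x) volume) :=
    (lintegral_map hm (measurable_const_smul a)).symm
  have h3 : Measurable fun z : E3 => h (a • z) := hm.comp (measurable_const_smul a)
  rw [lintegral_const_mul _ h3, h2, h1, lintegral_smul_measure]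
  simp only [finrank_euclideanSpace, Fintype.card_fin, smul_eq_mul]
  rw [← mul_assoc, ← ENNReal.ofReal_mul (by positivity), abs_of_pos (by positivity),
    mul_inv_cancel₀ (by positivity), ENNReal.ofReal_one, one_mul]

/-- `∫ (1+|z|²)^{-2}`. -/
noncomputable def c0 : ℝ≥0∞ := ∫⁻ z : E3, ENNReal.ofReal (((1 + ‖z‖ ^ 2) ^ 2)⁻¹)

lemma c0_lt : c0 < ⊤ := by
  have := integrable_rpow_neg_one_add_norm_sq (E := E3) (μ := volume) (r := 4) (by simp; norm_num)
  have h2 := this.2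
  rw [HasFiniteIntegral] at h2
  refine lt_of_le_of_lt (lintegral_mono fun z => ?_) h2
  rw [← ofReal_norm, Real.norm_eq_abs, abs_of_nonneg (by positivity)]
  apply le_of_eq
  congr 1
  rw [show (-4 / 2 : ℝ) = -(2 : ℕ) by norm_num, Real.rpow_neg (by positivity), Real.rpow_natCast]

lemma c0_pos : c0 ≠ 0 := by
  unfold c0
  intro h
  rw [lintegral_eq_zero_iff (by fun_prop)] at h
  have h2 : ∀ z : E3, ENNReal.ofReal (((1 + ‖z‖ ^ 2) ^ 2)⁻¹) ≠ 0 := by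
    intro z
    rw [Ne, ENNReal.ofReal_eq_zero, not_le]; positivity
  have h3 : ∀ᵐ z : E3, False := by
    filter_upwards [h] with z hz
    exact h2 z hz
  rw [ae_iff] at h3
  simp at h3

lemma lintegral_th_le {a : ℝ} (ha : 0 < a) : ∫⁻ z, ENNReal.ofReal (th a z) ≤ c0 := by
  have := lintegral_scale ha (h := fun z : E3 => ENNReal.ofReal (((1 + ‖z‖ ^ 2) ^ 3)⁻¹)) (by fun_prop)
  calc ∫⁻ z, ENNReal.ofReal (th a z) = ∫⁻ z : E3, ENNReal.ofReal (((1 + ‖z‖ ^ 2) ^ 3)⁻¹) := by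
        rw [← this]
        congr 1; ext z
        rw [← ENNReal.ofReal_mul (by positivity), norm_smul, Real.norm_eq_abs, abs_of_pos ha]; rfl
    _ ≤ _ := by
        refine lintegral_mono fun z => ENNReal.ofReal_le_ofReal ?_
        gcongr
        · nlinarith [norm_nonneg z, sq_nonneg ‖z‖]
        · norm_num

lemma th_integrable {a : ℝ} (ha : 0 < a) : Integrable (th a) := by
  refine ⟨(th_cont a).aestronglyMeasurable, ?_⟩
  rw [HasFiniteIntegral]
  refine lt_of_le_of_lt (le_of_eq ?_) ((lintegral_th_le ha).trans_lt c0_lt)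
  congr 1; ext z
  rw [← ofReal_norm, Real.norm_eq_abs, abs_of_nonneg (th_nonneg ha z)]

/-- A family of bumps at dyadic scales. -/
structure Good (A : ℝ) (φ : ℕ → E3 → ℂ) : Prop where
  diff : ∀ k, Differentiable ℝ (φ k)
  bd : ∀ k z, ‖φ k z‖ ≤ A * th (2 ^ k) z
  dbd : ∀ k z, ‖fderiv ℝ (φ k) z‖ ≤ A * 2 ^ k * th (2 ^ k) z

lemma two_pow_pos' (k : ℕ) : (0:ℝ) < 2 ^ k := by positivity

lemma Good.A_nonneg {A : ℝ} {φ : ℕ → E3 → ℂ} (h : Good A φ) : 0 ≤ A := by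
  have h1 := (norm_nonneg _).trans (h.bd 0 0)
  exact nonneg_of_mul_nonneg_left h1 (th_pos (two_pow_pos' 0) 0)

lemma Good.integrable {A : ℝ} {φ : ℕ → E3 → ℂ} (h : Good A φ) (k : ℕ) : Integrable (φ k) :=
  ((th_integrable (two_pow_pos' k)).const_mul A).mono' (h.diff k).continuous.aestronglyMeasurable
    (Eventually.of_forall fun z => h.bd k z)

lemma th_le (a : ℝ) (ha : 0 < a) (z : E3) : th a z ≤ a ^ 3 := by
  unfold th
  refine mul_le_of_le_one_right (by positivity) (inv_le_one_of_one_le₀ ?_)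
  exact one_le_pow₀ (by nlinarith [sq_nonneg (a * ‖z‖)])

lemma hor_pt {A : ℝ} {φ : ℕ → E3 → ℂ} (h : Good A φ) (k : ℕ) {R : ℝ} {x y : E3}
    (hy : ‖y‖ ≤ R) (hx : 2 * R < ‖x‖) :
    ‖φ k (x - y) - φ k x‖ ≤ A * 2 ^ k * R * th (2 ^ k) ((2:ℝ)⁻¹ • x) := by
  have hA := h.A_nonneg
  have hconv : Convex ℝ (closedBall x R) := convex_closedBall x R
  have hb : ∀ z ∈ closedBall x R, ‖fderiv ℝ (φ k) z‖ ≤ A * 2 ^ k * th (2 ^ k) ((2:ℝ)⁻¹ • x) := by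
    intro z hz
    refine (h.dbd k z).trans ?_
    gcongr
    unfold th
    have : ‖(2:ℝ)⁻¹ • x‖ ≤ ‖z‖ := by
      rw [norm_smul]
      rw [mem_closedBall, dist_eq_norm] at hz
      have h1 := norm_sub_norm_le x z
      rw [norm_sub_rev] at hz
      norm_num
      linarith
    gcongr
  have hR : 0 ≤ R := (norm_nonneg _).trans hy
  have := hconv.norm_image_sub_le_of_norm_fderiv_le (𝕜 := ℝ) (f := φ k) (fun z _ => h.diff k z) hb
    (x := x) (y := x - y) (mem_closedBall_self hR) (by simpa [dist_eq_norm] using hy)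
  refine this.trans ?_
  rw [show x - y - x = -y by abel, norm_neg]
  have := th_nonneg (two_pow_pos' k) ((2:ℝ)⁻¹ • x)
  calc _ ≤ A * 2 ^ k * th (2 ^ k) ((2:ℝ)⁻¹ • x) * R := by gcongr
    _ = _ := by ring

lemma lintegral_half {a : ℝ} (ha : 0 < a) (h : ℝ → ℝ) (hm : Measurable h) :
    ∫⁻ x : E3, ENNReal.ofReal (a ^ 3 * h (a * ‖(2:ℝ)⁻¹ • x‖)) = 8 * ∫⁻ z : E3, ENNReal.ofReal (h ‖z‖) := by
  have h1 := lintegral_scale (a := a / 2) (by positivity) (h := fun z : E3 => ENNReal.ofReal (h ‖z‖)) (by fun_prop)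
  rw [← h1, ← lintegral_const_mul]
  · congr 1; ext z
    rw [← mul_assoc, norm_smul, norm_smul, Real.norm_eq_abs, Real.norm_eq_abs, abs_of_pos (by positivity),
      abs_of_pos (by positivity), ENNReal.ofReal_mul (by positivity)]
    congr 1
    · rw [show (8:ℝ≥0∞) = ENNReal.ofReal 8 by norm_num, ← ENNReal.ofReal_mul (by norm_num)]
      congr 1; ring
    · congr 2; ring
  · fun_prop

lemma hor_one {A : ℝ} {φ : ℕ → E3 → ℂ} (h : Good A φ) (k : ℕ) {R : ℝ} (hR : 0 < R) {y : E3}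
    (hy : ‖y‖ ≤ R) :
    ∫⁻ x in {x | 2 * R < ‖x‖}, ‖φ k (x - y) - φ k x‖ₑ ≤
      ENNReal.ofReal (A * min (2 ^ k * R) ((2 ^ k * R)⁻¹)) * (8 * c0) := by
  have hA := h.A_nonneg
  have hms : MeasurableSet {x : E3 | 2 * R < ‖x‖} :=
    measurableSet_lt measurable_const measurable_norm
  have hkey : ∀ x ∈ {x : E3 | 2 * R < ‖x‖}, ‖φ k (x - y) - φ k x‖ₑ ≤
      ENNReal.ofReal (A * min (2 ^ k * R) ((2 ^ k * R)⁻¹)) *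
        ENNReal.ofReal ((2 ^ k) ^ 3 * ((fun t : ℝ => ((1 + t ^ 2) ^ 2)⁻¹) (2 ^ k * ‖(2:ℝ)⁻¹ • x‖))) := by
    intro x hx
    rw [← ofReal_norm, ← ENNReal.ofReal_mul (by positivity)]
    apply ENNReal.ofReal_le_ofReal
    refine (hor_pt h k hy hx).trans ?_
    have hx' : 2 * R < ‖x‖ := hx
    set a : ℝ := 2 ^ k with ha
    have ha0 : 0 < a := by positivity
    have hn : ‖(2:ℝ)⁻¹ • x‖ = ‖x‖ / 2 := by rw [norm_smul]; norm_num; ring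
    set t := a * ‖(2:ℝ)⁻¹ • x‖ with htdef
    have ht : a * R ≤ t := by rw [htdef, hn]; gcongr; linarith
    have h1 : a * R * ((1 + t ^ 2))⁻¹ ≤ min (a * R) ((a * R)⁻¹) := by
      have haR : 0 < a * R := by positivity
      apply le_min
      · refine mul_le_of_le_one_right haR.le (inv_le_one_of_one_le₀ ?_)
        nlinarith [sq_nonneg t]
      · rw [← div_eq_mul_inv, div_le_iff₀ (by positivity), inv_mul_eq_div, le_div_iff₀ haR]
        nlinarith
    calc A * a * R * th a ((2:ℝ)⁻¹ • x) = A * (a * R * (1 + t ^ 2)⁻¹) * (a ^ 3 * ((1 + t ^ 2) ^ 2)⁻¹) := by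
          unfold th; rw [← htdef]
          have : (1 + t ^ 2) ≠ 0 := by positivity
          field_simp
      _ ≤ _ := by gcongr
  calc _ ≤ ∫⁻ x in {x : E3 | 2 * R < ‖x‖}, ENNReal.ofReal (A * min (2 ^ k * R) ((2 ^ k * R)⁻¹)) *
        ENNReal.ofReal ((2 ^ k) ^ 3 * ((fun t : ℝ => ((1 + t ^ 2) ^ 2)⁻¹) (2 ^ k * ‖(2:ℝ)⁻¹ • x‖))) :=
        setLIntegral_mono' hms hkey
    _ ≤ ∫⁻ x : E3, ENNReal.ofReal (A * min (2 ^ k * R) ((2 ^ k * R)⁻¹)) *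
        ENNReal.ofReal ((2 ^ k) ^ 3 * ((fun t : ℝ => ((1 + t ^ 2) ^ 2)⁻¹) (2 ^ k * ‖(2:ℝ)⁻¹ • x‖))) :=
        lintegral_mono' Measure.restrict_le_self le_rfl
    _ = _ := by
        rw [lintegral_const_mul _ (by fun_prop), lintegral_half (two_pow_pos' k) (fun t : ℝ => ((1 + t ^ 2) ^ 2)⁻¹) (by fun_prop)]
        rfl

lemma hor_sum {A : ℝ} {φ : ℕ → E3 → ℂ} (h : Good A φ) (N : ℕ) {R : ℝ} (hR : 0 < R) {y : E3}
    (hy : ‖y‖ ≤ R) :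
    ∑ k ∈ Finset.range N, ∫⁻ x in {x | 2 * R < ‖x‖}, ‖φ k (x - y) - φ k x‖ₑ ≤
      ENNReal.ofReal (4 * A) * (8 * c0) := by
  have hA := h.A_nonneg
  calc _ ≤ ∑ k ∈ Finset.range N, ENNReal.ofReal (A * min (2 ^ k * R) ((2 ^ k * R)⁻¹)) * (8 * c0) :=
        Finset.sum_le_sum fun k _ => hor_one h k hR hy
    _ = ENNReal.ofReal (A * ∑ k ∈ Finset.range N, min (2 ^ k * R) ((2 ^ k * R)⁻¹)) * (8 * c0) := by
        rw [← Finset.sum_mul, Finset.mul_sum, ENNReal.ofReal_sum_of_nonneg]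
        intro k _; positivity
    _ ≤ _ := by
        refine mul_le_mul_left (ENNReal.ofReal_le_ofReal ?_) _
        have := minsum (x := 2) (by norm_num) N hR
        have h4 : (2 * 2 / (2 - 1) : ℝ) = 4 := by norm_num
        rw [h4] at this
        nlinarith

section KKsec
variable {H₁ H₂ : Type}
  [NormedAddCommGroup H₁] [NormedSpace ℂ H₁]
  [NormedAddCommGroup H₂] [NormedSpace ℂ H₂]

/-- kernel built from a family of scalar kernels -/
noncomputable def KK {N : ℕ} (φ : ℕ → E3 → ℂ) (P : Fin N → H₁ →L[ℂ] H₂) : E3 → H₁ →L[ℂ] H₂ :=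
  fun z => ∑ k : Fin N, φ k z • P k

lemma KK_NK {N : ℕ} {A : ℝ} {φ : ℕ → E3 → ℂ} (h : Good A φ) (P : Fin N → H₁ →L[ℂ] H₂) : NK (KK φ P) := by
  refine ⟨?_, ?_, ?_⟩
  · unfold KK
    refine continuous_finsetSum _ fun k _ => ?_
    have := (h.diff k).continuous
    fun_prop
  · unfold KK
    have h1 : ∀ k ∈ (Finset.univ : Finset (Fin N)), Integrable (fun z => φ k z • P k) := fun k _ =>
      Integrable.smul_const (h.integrable k) (P k)
    exact integrable_finsetSum (Finset.univ : Finset (Fin N)) (f := fun k z => φ k z • P k) h1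
  · refine ⟨∑ k : Fin N, A * (2 ^ (k:ℕ)) ^ 3 * ‖P k‖, fun z => ?_⟩
    refine (norm_sum_le _ _).trans (Finset.sum_le_sum fun k _ => ?_)
    rw [norm_smul]
    gcongr
    refine (h.bd k z).trans ?_
    have := h.A_nonneg
    gcongr
    exact th_le _ (two_pow_pos' k) z

lemma KK_hor {N : ℕ} {A : ℝ} {φ : ℕ → E3 → ℂ} (h : Good A φ) {P : Fin N → H₁ →L[ℂ] H₂}
    (hP : ∀ k, ‖P k‖ ≤ 1) : Hor (KK φ P) (ENNReal.ofReal (4 * A) * (8 * c0)) := by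
  intro R hR y hy
  refine le_trans ?_ (hor_sum h N hR hy)
  rw [← lintegral_finsetSum]
  · refine lintegral_mono fun x => ?_
    rw [KK, KK, ← Finset.sum_sub_distrib, ← Fin.sum_univ_eq_sum_range (fun k => ‖φ k (x - y) - φ k x‖ₑ)]
    refine (enorm_sum_le (ε := H₁ →L[ℂ] H₂) _ _).trans (Finset.sum_le_sum fun k _ => ?_)
    rw [← sub_smul, ← ofReal_norm, ← ofReal_norm]
    apply ENNReal.ofReal_le_ofReal
    rw [norm_smul]
    exact mul_le_of_le_one_right (norm_nonneg _) (hP k)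
  · intro k _
    have := (h.diff k).continuous
    fun_prop

end KKsec
end KP

namespace KP

open Metric Set Filter

/-- scalar convolution -/
noncomputable def cv (φ f : E3 → ℂ) (x : E3) : ℂ := ∫ y, φ (x - y) * f y

/-- reflected conjugate family -/
noncomputable def refl (φ : ℕ → E3 → ℂ) : ℕ → E3 → ℂ := fun k z => star (φ k (-z))

lemma refl_refl (φ : ℕ → E3 → ℂ) : refl (refl φ) = φ := by
  ext k z; simp [refl]

lemma Good.refl {A : ℝ} {φ : ℕ → E3 → ℂ} (h : Good A φ) : Good A (refl φ) := by
  have hd : ∀ k z, HasFDerivAt (KP.refl φ k)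
      ((Complex.conjCLE : ℂ →L[ℝ] ℂ).comp ((fderiv ℝ (φ k) (-z)).comp (-ContinuousLinearMap.id ℝ E3))) z := by
    intro k z
    have h1 : HasFDerivAt (φ k) (fderiv ℝ (φ k) (-z)) (-z) := (h.diff k (-z)).hasFDerivAt
    have h2 : HasFDerivAt (fun z : E3 => -z) (-ContinuousLinearMap.id ℝ E3) z := (hasFDerivAt_id z).neg
    exact (Complex.conjCLE : ℂ →L[ℝ] ℂ).hasFDerivAt.comp z (HasFDerivAt.comp z h1 h2)
  have hth : ∀ a z, th a (-z) = th a z := fun a z => by simp [th]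
  refine ⟨fun k z => (hd k z).differentiableAt, fun k z => ?_, fun k z => ?_⟩
  · rw [KP.refl, norm_star, ← hth]; exact h.bd k _
  · rw [(hd k z).fderiv, ← hth]
    refine le_trans ?_ (h.dbd k (-z))
    refine ContinuousLinearMap.opNorm_le_bound _ (norm_nonneg _) fun v => ?_
    simp only [ContinuousLinearMap.comp_apply, ContinuousLinearEquiv.coe_coe, Complex.conjCLE_apply]
    rw [RCLike.norm_conj]
    refine (ContinuousLinearMap.le_opNorm _ _).trans ?_
    gcongr
    simp

/-- θ family -/
noncomputable def thC (k : ℕ) (z : E3) : ℂ := (th (2 ^ k) z : ℂ)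

lemma th_hasFDerivAt (a : ℝ) (z : E3) :
    HasFDerivAt (th a) ((-(a ^ 3 * (3 * (1 + (a * ‖z‖) ^ 2) ^ 2 * (a ^ 2)) / ((1 + (a * ‖z‖) ^ 2) ^ 3) ^ 2)) •
      (2 • innerSL ℝ z)) z := by
  have h1 : HasFDerivAt (fun z : E3 => ‖z‖ ^ 2) (2 • innerSL ℝ z) z := (hasStrictFDerivAt_norm_sq z).hasFDerivAt
  have h2 : HasDerivAt (fun u : ℝ => a ^ 3 * ((1 + a ^ 2 * u) ^ 3)⁻¹)
      (-(a ^ 3 * (3 * (1 + a ^ 2 * ‖z‖ ^ 2) ^ 2 * (a ^ 2)) / ((1 + a ^ 2 * ‖z‖ ^ 2) ^ 3) ^ 2)) (‖z‖ ^ 2) := by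
    have h3 : HasDerivAt (fun u : ℝ => 1 + a ^ 2 * u) (a ^ 2) (‖z‖ ^ 2) := by
      simpa using ((hasDerivAt_id (‖z‖ ^ 2)).const_mul (a ^ 2)).const_add 1
    have h4 := ((h3.fun_pow 3).fun_inv (by positivity)).const_mul (a ^ 3)
    refine h4.congr_deriv ?_
    norm_num
    try ring
  have h5 := h2.comp_hasFDerivAt z h1
  simp only [mul_pow]
  have e : th a = (fun u => a ^ 3 * ((1 + a ^ 2 * u) ^ 3)⁻¹) ∘ fun z : E3 => ‖z‖ ^ 2 := by
    ext z; simp [th, mul_pow]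
  rw [e]
  exact h5

lemma good_th : Good 3 thC := by
  have hd : ∀ k z, HasFDerivAt (thC k) (Complex.ofRealCLM.comp (fderiv ℝ (th (2 ^ k)) z)) z := by
    intro k z
    exact Complex.ofRealCLM.hasFDerivAt.comp z (th_hasFDerivAt _ z).differentiableAt.hasFDerivAt
  refine ⟨fun k z => (hd k z).differentiableAt, fun k z => ?_, fun k z => ?_⟩
  · rw [thC, Complex.norm_real, Real.norm_eq_abs, abs_of_nonneg (th_nonneg (two_pow_pos' k) z)]
    linarith [th_nonneg (two_pow_pos' k) z]
  · rw [(hd k z).fderiv, (th_hasFDerivAt _ z).fderiv]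
    refine ContinuousLinearMap.opNorm_le_bound _ (by have := th_nonneg (two_pow_pos' k) z; positivity) fun v => ?_
    set a : ℝ := 2 ^ k with ha
    have ha0 : 0 < a := by positivity
    simp only [ContinuousLinearMap.comp_apply, Complex.ofRealCLM_apply, Complex.norm_real]
    rw [ContinuousLinearMap.smul_apply, norm_smul, norm_neg, Real.norm_eq_abs, abs_of_nonneg (by positivity)]
    have h1 : ‖(2 • innerSL ℝ z) v‖ ≤ 2 * (‖z‖ * ‖v‖) := by
      rw [ContinuousLinearMap.smul_apply, innerSL_apply_apply, nsmul_eq_mul, norm_mul]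
      norm_num
      exact abs_real_inner_le_norm z v
    set t := a * ‖z‖ with ht
    have ht0 : 0 ≤ t := by positivity
    have e : ((1 + t ^ 2) ^ 3) ^ 2 = (1 + t ^ 2) ^ 2 * (1 + t ^ 2) * (1 + t ^ 2) ^ 3 := by ring
    calc _ ≤ a ^ 3 * (3 * (1 + t ^ 2) ^ 2 * a ^ 2) / ((1 + t ^ 2) ^ 3) ^ 2 * (2 * (‖z‖ * ‖v‖)) := by
          gcongr
      _ = 3 * a * th a z * (2 * t / (1 + t ^ 2)) * ‖v‖ := by
          rw [e]; unfold th; rw [← ht]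
          field_simp
          rw [ht]
      _ ≤ 3 * a * th a z * 1 * ‖v‖ := by
          have := th_nonneg ha0 z
          gcongr
          rw [div_le_one (by positivity)]
          nlinarith [sq_nonneg (t - 1)]
      _ = _ := by ring

section KKdual
variable {H₁ H₂ : Type}
  [NormedAddCommGroup H₁] [InnerProductSpace ℂ H₁] [CompleteSpace H₁] [SecondCountableTopology H₁]
  [NormedAddCommGroup H₂] [InnerProductSpace ℂ H₂] [CompleteSpace H₂] [SecondCountableTopology H₂]

lemma KK_dual {N : ℕ} (φ : ℕ → E3 → ℂ) (P : Fin N → H₁ →L[ℂ] H₂) :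
    dual (KK φ P) = KK (refl φ) (fun k => ContinuousLinearMap.adjoint (P k)) := by
  ext z : 1
  simp only [dual, KK, map_sum, refl]
  refine Finset.sum_congr rfl fun k _ => ?_
  exact LinearIsometryEquiv.map_smulₛₗ _ _ _

/-- Hörmander constant -/
noncomputable def hB (A : ℝ) : ℝ≥0∞ := ENNReal.ofReal (4 * A) * (8 * c0)

lemma hB_ne_top (A : ℝ) : hB A ≠ ⊤ := by
  unfold hB
  have := c0_lt.ne
  finiteness

lemma KK_bd {N : ℕ} {A : ℝ} {φ : ℕ → E3 → ℂ} (h : Good A φ) {P : Fin N → H₁ →L[ℂ] H₂}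
    (hP : ∀ k, ‖P k‖ ≤ 1) {A2 : ℝ≥0∞} (hA2 : A2 ≠ ⊤) (h2 : Bd (KK φ P) 2 A2) {q : ℝ} (hq : 1 < q) :
    Bd (KK φ P) q (czC q A2 (hB A)) := by
  refine CZmain (KK_NK h P) hA2 (hB_ne_top A) (KK_hor h hP) ?_ h2 hq
  rw [KK_dual]
  refine KK_hor h.refl fun k => ?_
  rw [LinearIsometryEquiv.norm_map]; exact hP k

end KKdual

section spaces

/-- coordinate inclusion -/
noncomputable def inj {N : ℕ} (k : Fin N) : ℂ →L[ℂ] EuclideanSpace ℂ (Fin N) :=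
  ContinuousLinearMap.toSpanSingleton ℂ (EuclideanSpace.single k 1)

/-- coordinate projection -/
noncomputable def prj {N : ℕ} (k : Fin N) : EuclideanSpace ℂ (Fin N) →L[ℂ] ℂ :=
  EuclideanSpace.proj k

lemma inj_norm {N : ℕ} (k : Fin N) : ‖inj k‖ ≤ 1 := by
  rw [inj, ContinuousLinearMap.norm_toSpanSingleton]; simp

lemma prj_norm {N : ℕ} (k : Fin N) : ‖prj k‖ ≤ 1 := by
  refine ContinuousLinearMap.opNorm_le_bound _ zero_le_one fun v => ?_
  rw [one_mul]; exact PiLp.norm_apply_le v k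

lemma inj_adj {N : ℕ} (k : Fin N) : ContinuousLinearMap.adjoint (inj k) = prj k := by
  symm
  rw [ContinuousLinearMap.eq_adjoint_iff]
  intro x y
  simp [inj, prj, EuclideanSpace.inner_single_right, inner_smul_right]

lemma enorm_euc {N : ℕ} (v : EuclideanSpace ℂ (Fin N)) : ‖v‖ₑ ^ 2 = ∑ k, ‖v k‖ₑ ^ 2 := by
  have := EuclideanSpace.norm_sq_eq v
  rw [← ofReal_norm, ← ENNReal.ofReal_pow (norm_nonneg _), this, ENNReal.ofReal_sum_of_nonneg (fun _ _ => by positivity)]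
  refine Finset.sum_congr rfl fun k _ => ?_
  rw [ENNReal.ofReal_pow (norm_nonneg _), ofReal_norm]

lemma T_inj {N : ℕ} {A : ℝ} {φ : ℕ → E3 → ℂ} (h : Good A φ) {f : E3 → ℂ} (hf : Adm f) (x : E3) (k : Fin N) :
    (T (KK φ (inj (N := N))) f x) k = cv (φ k) f x := by
  have := ContinuousLinearMap.integral_comp_comm (prj k) (T_integrable (KK_NK h (inj (N := N))) hf x)
  rw [T, cv]
  refine Eq.trans this.symm ?_
  congr 1; ext y
  simp [prj, inj, KK, Finset.sum_apply, Pi.single_apply]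

lemma T_prj {N : ℕ} {φ : ℕ → E3 → ℂ} {A : ℝ} (h : Good A φ) {w : E3 → EuclideanSpace ℂ (Fin N)} (hw : Adm w) (x : E3) :
    T (KK φ (prj (N := N))) w x = ∑ k : Fin N, cv (φ k) (fun y => w y k) x := by
  simp only [T, cv]
  rw [← integral_finsetSum]
  · congr 1; ext y
    simp [prj, KK]
  · intro k _
    have := T_integrable (KK_NK h (fun i : Fin N => if i = k then prj k else 0)) hw x
    convert this using 2 with y
    simp [KK, prj]

lemma T_diag {N : ℕ} {A : ℝ} {φ : ℕ → E3 → ℂ} (h : Good A φ) {w : E3 → EuclideanSpace ℂ (Fin N)} (hw : Adm w)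
    (x : E3) (k : Fin N) :
    (T (KK φ (fun k : Fin N => (inj k).comp (prj k))) w x) k = cv (φ k) (fun y => w y k) x := by
  have := ContinuousLinearMap.integral_comp_comm (prj k) (T_integrable (KK_NK h (fun k : Fin N => (inj k).comp (prj k))) hw x)
  rw [T, cv]
  refine Eq.trans this.symm ?_
  congr 1; ext y
  simp [prj, inj, KK, Finset.sum_apply, Pi.single_apply]

end spaces
end KP

namespace KP

open Metric Set Filter
open scoped NNReal

/-- `Lᵖ` norm of extended nonnegative functions -/
noncomputable abbrev LN (q : ℝ≥0∞) (F : E3 → ℝ≥0∞) : ℝ≥0∞ := eLpNorm F q volume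

lemma LN_eq {q : ℝ≥0∞} (h0 : q ≠ 0) (ht : q ≠ ⊤) (F : E3 → ℝ≥0∞) :
    LN q F = (∫⁻ x, F x ^ q.toReal) ^ (1 / q.toReal) := by
  rw [LN, eLpNorm_eq_lintegral_rpow_enorm_toReal h0 ht]; simp only [enorm_eq_self]

lemma LN_mono {q : ℝ≥0∞} {F G : E3 → ℝ≥0∞} (h : ∀ x, F x ≤ G x) : LN q F ≤ LN q G :=
  eLpNorm_mono_enorm fun x => by simpa using h x

lemma LN_mul_le {q : ℝ≥0∞} {F G : E3 → ℝ≥0∞} (c : ℝ≥0) (h : ∀ x, F x ≤ c * G x) : LN q F ≤ c * LN q G :=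
  eLpNorm_le_mul_eLpNorm_of_ae_le_mul' (Eventually.of_forall fun x => by simpa using h x) q

lemma LN_add {q : ℝ≥0∞} (hq : 1 ≤ q) {F G : E3 → ℝ≥0∞} (hF : AEMeasurable F) (hG : AEMeasurable G) :
    LN q (fun x => F x + G x) ≤ LN q F + LN q G :=
  eLpNorm_add_le hF.aestronglyMeasurable hG.aestronglyMeasurable hq

lemma LN_of_lint {q : ℝ≥0∞} (h0 : q ≠ 0) (ht : q ≠ ⊤) {F G : E3 → ℝ≥0∞} {C : ℝ≥0∞}
    (h : ∫⁻ x, F x ^ q.toReal ≤ C * ∫⁻ x, G x ^ q.toReal) :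
    LN q F ≤ C ^ (1 / q.toReal) * LN q G := by
  rw [LN_eq h0 ht, LN_eq h0 ht, ← ENNReal.mul_rpow_of_nonneg _ _ (by positivity)]
  gcongr

lemma LN_holder {p p₁ p₂ : ℝ≥0∞} (hp : 1 ≤ p) (hp' : p ≠ ⊤) (h : 1 / p = 1 / p₁ + 1 / p₂)
    {F G : E3 → ℝ≥0∞} (hF : AEMeasurable F) (hG : AEMeasurable G) :
    LN p (fun x => F x * G x) ≤ LN p₁ F * LN p₂ G := by
  have hp0 : p ≠ 0 := by rintro rfl; simp at hp
  have top : ∀ {F G : E3 → ℝ≥0∞}, AEMeasurable G → LN p (fun x => F x * G x) ≤ LN ⊤ F * LN p G := by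
    intro F G hG
    rcases eq_or_ne (LN ⊤ F) ⊤ with h1 | h1
    · rcases eq_or_ne (LN p G) 0 with h2 | h2
      · rw [h2, mul_zero, nonpos_iff_eq_zero]
        rw [LN, eLpNorm_eq_zero_iff hG.aestronglyMeasurable hp0] at h2
        rw [LN, ← eLpNorm_zero (ε := ℝ≥0∞) (p := p) (μ := (volume : Measure E3))]
        apply eLpNorm_congr_ae
        filter_upwards [h2] with x hx
        simp [hx]
      · rw [h1, ENNReal.top_mul h2]; exact le_top
    · lift LN ⊤ F to ℝ≥0 using h1 with c hc
      refine eLpNorm_le_mul_eLpNorm_of_ae_le_mul' ?_ p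
      have : ∀ᵐ x, ‖F x‖ₑ ≤ LN ⊤ F := by
        rw [LN, eLpNorm_exponent_top]; exact enorm_ae_le_eLpNormEssSup F volume
      filter_upwards [this] with x hx
      simp only [enorm_eq_self] at hx ⊢
      rw [hc]
      gcongr
  rcases eq_or_ne p₁ ⊤ with h1 | h1
  · have : p = p₂ := by simpa [h1] using h
    rw [h1, ← this]; exact top hG
  rcases eq_or_ne p₂ ⊤ with h2 | h2
  · have : p = p₁ := by simpa [h2] using h
    rw [h2, ← this, mul_comm]
    simp_rw [mul_comm (F _)]
    exact top hF
  have h10 : p₁ ≠ 0 := by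
    rintro rfl
    simp [ENNReal.inv_eq_top, hp0] at h
  have h20 : p₂ ≠ 0 := by
    rintro rfl
    simp [ENNReal.inv_eq_top, hp0] at h
  have hr : 1 / p.toReal = 1 / p₁.toReal + 1 / p₂.toReal := by
    have := congrArg ENNReal.toReal h
    rw [ENNReal.toReal_add (by simp [h10]) (by simp [h20])] at this
    simpa using this
  rw [LN_eq hp0 hp', LN_eq h10 h1, LN_eq h20 h2]
  have a0 := ENNReal.toReal_pos hp0 hp'
  have a1 := ENNReal.toReal_pos h10 h1
  have a2 := ENNReal.toReal_pos h20 h2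
  refine ENNReal.lintegral_Lp_mul_le_Lq_mul_Lr a0 ?_ hr volume hF hG
  have : 1 / p₁.toReal < 1 / p.toReal := by
    rw [hr]; have : 0 < 1 / p₂.toReal := by positivity
    linarith
  exact (one_div_lt_one_div a1 a0).1 this

/-- square function -/
noncomputable def sq (N : ℕ) (W : ℕ → ℝ≥0∞) : ℝ≥0∞ := (∑ k ∈ Finset.range N, W k ^ 2) ^ (1 / 2 : ℝ)

lemma sq_mono {N : ℕ} {W V : ℕ → ℝ≥0∞} (h : ∀ k < N, W k ≤ V k) : sq N W ≤ sq N V := by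
  unfold sq
  gcongr with k hk
  exact h k (Finset.mem_range.1 hk)

lemma sq_meas {N : ℕ} {W : ℕ → E3 → ℝ≥0∞} (h : ∀ k, Measurable (W k)) : Measurable fun x => sq N fun k => W k x := by
  unfold sq
  exact (Finset.measurable_sum _ fun k _ => (h k).pow_const 2).pow_const _

lemma sq_sq (N : ℕ) (W : ℕ → ℝ≥0∞) : sq N W ^ 2 = ∑ k ∈ Finset.range N, W k ^ 2 := by
  unfold sq
  rw [← ENNReal.rpow_natCast, ← ENNReal.rpow_mul]; norm_num

lemma le_sq {N : ℕ} (W : ℕ → ℝ≥0∞) {k : ℕ} (hk : k < N) : W k ≤ sq N W := by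
  have h : W k ^ 2 ≤ sq N W ^ 2 := by
    rw [sq_sq]
    exact Finset.single_le_sum (f := fun k => W k ^ 2) (fun _ _ => bot_le) (Finset.mem_range.2 hk)
  exact (ENNReal.pow_le_pow_left_iff two_ne_zero).1 h

lemma sq_euc {N : ℕ} (v : EuclideanSpace ℂ (Fin N)) (W : ℕ → ℝ≥0∞) (h : ∀ k : Fin N, ‖v k‖ₑ = W k) :
    ‖v‖ₑ = sq N W := by
  have : ‖v‖ₑ ^ 2 = sq N W ^ 2 := by
    rw [sq_sq, enorm_euc, ← Fin.sum_univ_eq_sum_range (fun k => W k ^ 2)]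
    exact Finset.sum_congr rfl fun k _ => by rw [h]
  exact le_antisymm ((ENNReal.pow_le_pow_left_iff two_ne_zero).1 this.le) ((ENNReal.pow_le_pow_left_iff two_ne_zero).1 this.ge)


lemma eLp_LN {H : Type} [NormedAddCommGroup H] (f : E3 → H) (q : ℝ≥0∞) :
    eLpNorm f q volume = LN q fun x => ‖f x‖ₑ := (eLpNorm_enorm f).symm

/-- `L²` boundedness of a family -/
def L2c (A2 : ℝ≥0∞) (φ : ℕ → E3 → ℂ) : Prop :=
  ∀ N f, Adm f → ∑ k ∈ Finset.range N, ∫⁻ x, ‖cv (φ k) f x‖ₑ ^ 2 ≤ A2 * ∫⁻ x, ‖f x‖ₑ ^ 2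

section admops
variable {H H' : Type} [NormedAddCommGroup H] [NormedSpace ℂ H] [NormedAddCommGroup H'] [NormedSpace ℂ H']

lemma Adm.clm {f : E3 → H} (hf : Adm f) (L : H →L[ℂ] H') : Adm fun x => L (f x) := by
  refine ⟨L.continuous.comp_stronglyMeasurable hf.meas, L.integrable_comp hf.int, ?_⟩
  obtain ⟨M, hM⟩ := hf.bdd
  exact ⟨‖L‖ * M, fun x => (L.le_opNorm _).trans (by gcongr; exact hM x)⟩

lemma Adm.add {f g : E3 → H} (hf : Adm f) (hg : Adm g) : Adm fun x => f x + g x := by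
  refine ⟨hf.meas.add hg.meas, hf.int.add hg.int, ?_⟩
  obtain ⟨M, hM⟩ := hf.bdd
  obtain ⟨M', hM'⟩ := hg.bdd
  exact ⟨M + M', fun x => (norm_add_le _ _).trans (add_le_add (hM x) (hM' x))⟩

lemma Adm.zero : Adm fun _ : E3 => (0 : H) :=
  ⟨stronglyMeasurable_const, integrable_zero _ _ _, 0, fun x => by simp⟩

lemma Adm.sum {ι : Type} (s : Finset ι) {f : ι → E3 → H} (hf : ∀ i ∈ s, Adm (f i)) : Adm fun x => ∑ i ∈ s, f i x := by
  classical
  induction s using Finset.induction_on with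
  | empty => simpa using Adm.zero
  | insert a s ha ih =>
    simp_rw [Finset.sum_insert ha]
    exact (hf a (by simp)).add (ih fun i hi => hf i (by simp [hi]))

lemma Adm.mul {f g : E3 → ℂ} (hf : Adm f) (hg : Adm g) : Adm fun x => f x * g x := by
  obtain ⟨M, hM⟩ := hf.bdd
  obtain ⟨M', hM'⟩ := hg.bdd
  refine ⟨hf.meas.mul hg.meas, ?_, M * M', fun x => ?_⟩
  · exact hg.int.bdd_mul (c := M) hf.meas.aestronglyMeasurable (Eventually.of_forall hM)
  · rw [norm_mul]
    exact mul_le_mul (hM x) (hM' x) (norm_nonneg _) ((norm_nonneg _).trans (hM x))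

lemma Adm.nrm {f : E3 → H} (hf : Adm f) : Adm fun x => ((‖f x‖ : ℝ) : ℂ) := by
  refine ⟨Complex.continuous_ofReal.comp_stronglyMeasurable hf.meas.norm, hf.int.norm.ofReal, ?_⟩
  obtain ⟨M, hM⟩ := hf.bdd
  exact ⟨M, fun x => by simpa using hM x⟩

lemma Adm.em {f : E3 → H} (hf : Adm f) : Measurable fun x => ‖f x‖ₑ := hf.meas.enorm
end admops

/-- assembling a vector from coordinates -/
noncomputable def vec (N : ℕ) (w : ℕ → E3 → ℂ) (x : E3) : EuclideanSpace ℂ (Fin N) := ∑ k : Fin N, inj k (w k x)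

lemma vec_apply (N : ℕ) (w : ℕ → E3 → ℂ) (x : E3) (k : Fin N) : vec N w x k = w k x := by
  simp [vec, inj, Pi.single_apply]

lemma vec_adm {N : ℕ} {w : ℕ → E3 → ℂ} (hw : ∀ k, Adm (w k)) : Adm (vec N w) :=
  Adm.sum _ fun k _ => (hw k).clm (inj k)

lemma vec_enorm (N : ℕ) (w : ℕ → E3 → ℂ) (x : E3) : ‖vec N w x‖ₑ = sq N fun k => ‖w k x‖ₑ :=
  sq_euc _ _ fun k => by rw [vec_apply]

lemma toN {C : ℝ≥0∞} {q : ℝ} (hC : C ≠ ⊤) (hq : 0 ≤ q) : ((C ^ q).toNNReal : ℝ≥0∞) = C ^ q :=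
  ENNReal.coe_toNNReal (ENNReal.rpow_ne_top_of_nonneg hq hC)

lemma one_lt_toReal {q : ℝ≥0∞} (h1 : 1 < q) (ht : q < ⊤) : 1 < q.toReal := by
  rw [← ENNReal.toReal_one]
  exact (ENNReal.toReal_lt_toReal (by simp) ht.ne).2 h1

lemma bd_inj {A : ℝ} {A2 : ℝ≥0∞} {φ : ℕ → E3 → ℂ} (h : Good A φ) (h2 : L2c A2 φ) (N : ℕ) :
    Bd (KK φ (inj (N := N))) 2 A2 := by
  intro f hf
  have h3 := h2 N f hf
  rw [← lintegral_finsetSum] at h3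
  · simp only [ENNReal.rpow_two]
    convert h3 using 3 with x
    rw [enorm_euc, ← Fin.sum_univ_eq_sum_range (fun k => ‖cv (φ k) f x‖ₑ ^ 2)]
    exact Finset.sum_congr rfl fun k _ => by rw [T_inj h hf]
  · intro k _
    have h4 := (T_adm (KK_NK h (inj (N := k + 1))) hf).clm (prj (Fin.last k))
    have h5 := h4.em.pow_const 2
    have e : (fun x => ‖cv (φ k) f x‖ₑ ^ 2) = fun x => ‖prj (Fin.last k) (T (KK φ (inj (N := k + 1))) f x)‖ₑ ^ 2 := by
      ext x
      congr 2
      have := (T_inj h hf x (Fin.last k)).symm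
      rw [Fin.val_last] at this
      exact this
    rw [e]; exact h5

theorem S_bd {A : ℝ} {A2 : ℝ≥0∞} {φ : ℕ → E3 → ℂ} (h : Good A φ) (hA2 : A2 ≠ ⊤) (h2 : L2c A2 φ)
    {q : ℝ≥0∞} (h1 : 1 < q) (ht : q < ⊤) : ∃ C : ℝ≥0, ∀ N f, Adm f →
      LN q (fun x => sq N fun k => ‖cv (φ k) f x‖ₑ) ≤ C * eLpNorm f q volume := by
  have hq := one_lt_toReal h1 ht
  refine ⟨((czC q.toReal A2 (hB A)) ^ (1 / q.toReal)).toNNReal, fun N f hf => ?_⟩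
  rw [toN (czC_ne_top hA2 (hB_ne_top A) hq) (by positivity), eLp_LN]
  refine LN_of_lint (by positivity) ht.ne ?_
  have := KK_bd h (inj_norm (N := N)) hA2 (bd_inj h h2 N) hq f hf
  convert this using 4 with x
  symm
  exact sq_euc _ _ fun k => by rw [T_inj h hf]

theorem Sstar_bd {A : ℝ} {A2 : ℝ≥0∞} {φ : ℕ → E3 → ℂ} (h : Good A φ) (hA2 : A2 ≠ ⊤) (h2 : L2c A2 (refl φ))
    {q : ℝ≥0∞} (h1 : 1 < q) (ht : q < ⊤) : ∃ C : ℝ≥0, ∀ N (w : ℕ → E3 → ℂ), (∀ k, Adm (w k)) →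
      eLpNorm (fun x => ∑ k ∈ Finset.range N, cv (φ k) (w k) x) q volume
        ≤ C * LN q (fun x => sq N fun k => ‖w k x‖ₑ) := by
  have hq := one_lt_toReal h1 ht
  refine ⟨((czC q.toReal A2 (hB A)) ^ (1 / q.toReal)).toNNReal, fun N w hw => ?_⟩
  rw [toN (czC_ne_top hA2 (hB_ne_top A) hq) (by positivity), eLp_LN]
  refine LN_of_lint (by positivity) ht.ne ?_
  have e : dual (KK (refl φ) (inj (N := N))) = KK φ (prj (N := N)) := by
    rw [KK_dual, refl_refl]; congr 1; ext1 k; rw [inj_adj]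
  have hb : Bd (KK φ (prj (N := N))) 2 A2 := by
    rw [← e]; exact bd_dual2 (KK_NK h.refl _) hA2 (bd_inj h.refl h2 N)
  have := KK_bd h (prj_norm (N := N)) hA2 hb hq _ (vec_adm hw)
  simp only [vec_enorm] at this
  convert this using 4 with x
  rw [T_prj h (vec_adm hw), ← Fin.sum_univ_eq_sum_range (fun k => cv (φ k) (w k) x)]
  simp only [vec_apply]

/-- averages -/
noncomputable def Th {H : Type} [NormedAddCommGroup H] (k : ℕ) (u : E3 → H) (x : E3) : ℝ≥0∞ :=
  ∫⁻ y, ENNReal.ofReal (th (2 ^ k) (x - y)) * ‖u y‖ₑ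

lemma Th_meas {H : Type} [NormedAddCommGroup H] (k : ℕ) {u : E3 → H} (hu : StronglyMeasurable u) : Measurable (Th k u) := by
  unfold Th
  apply Measurable.lintegral_prod_right' (f := fun p : E3 × E3 => ENNReal.ofReal (th (2 ^ k) (p.1 - p.2)) * ‖u p.2‖ₑ)
  have h1 := th_cont (2 ^ k)
  have h2 : Measurable fun p : E3 × E3 => ‖u p.2‖ₑ := hu.enorm.comp measurable_snd
  have h3 : Measurable fun p : E3 × E3 => ENNReal.ofReal (th (2 ^ k) (p.1 - p.2)) := by fun_prop
  exact h3.mul h2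

lemma enorm_thC (k : ℕ) (z : E3) : ‖thC k z‖ₑ = ENNReal.ofReal (th (2 ^ k) z) := by
  rw [← ofReal_norm, thC, Complex.norm_real, Real.norm_eq_abs, abs_of_nonneg (th_nonneg (two_pow_pos' k) z)]

lemma cv_thC {H : Type} [NormedAddCommGroup H] [NormedSpace ℂ H] (k : ℕ) {u : E3 → H} (hu : Adm u) (x : E3) :
    ‖cv (thC k) (fun y => ((‖u y‖ : ℝ) : ℂ)) x‖ₑ = Th k u x := by
  unfold cv Th
  have e : ∀ y, thC k (x - y) * ((‖u y‖ : ℝ) : ℂ) = ((th (2 ^ k) (x - y) * ‖u y‖ : ℝ) : ℂ) := fun y => by simp [thC]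
  have hn : ∀ y, 0 ≤ th (2 ^ k) (x - y) * ‖u y‖ := fun y => mul_nonneg (th_nonneg (two_pow_pos' k) _) (norm_nonneg _)
  simp_rw [e]
  rw [integral_complex_ofReal, ← ofReal_norm, Complex.norm_real, Real.norm_eq_abs, abs_of_nonneg (integral_nonneg hn),
    ofReal_integral_eq_lintegral_ofReal _ (Eventually.of_forall hn)]
  · congr 1; ext y
    rw [ENNReal.ofReal_mul (th_nonneg (two_pow_pos' k) _), ofReal_norm]
  · refine hu.int.norm.bdd_mul (c := (2 ^ k) ^ 3) ?_ (Eventually.of_forall fun y => ?_)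
    · exact ((th_cont _).comp (by fun_prop)).aestronglyMeasurable
    · rw [Real.norm_eq_abs, abs_of_nonneg (th_nonneg (two_pow_pos' k) _)]; exact th_le _ (two_pow_pos' k) _

lemma cv_le {A : ℝ} {φ : ℕ → E3 → ℂ} (h : Good A φ) (k : ℕ) (u : E3 → ℂ) (x : E3) :
    ‖cv (φ k) u x‖ₑ ≤ ENNReal.ofReal A * Th k u x := by
  unfold cv Th
  refine (enorm_integral_le_lintegral_enorm _).trans ?_
  rw [← lintegral_const_mul']
  · refine lintegral_mono fun y => ?_
    rw [enorm_mul, ← mul_assoc, ← ENNReal.ofReal_mul h.A_nonneg, ← ofReal_norm (φ k (x - y))]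
    gcongr
    exact h.bd k _
  · finiteness

lemma lint_th_sub (k : ℕ) (x : E3) : ∫⁻ y, ENNReal.ofReal (th (2 ^ k) (x - y)) ≤ c0 := by
  rw [lintegral_sub_left_eq_self (fun y => ENNReal.ofReal (th (2 ^ k) y)) x]
  exact lintegral_th_le (two_pow_pos' k)

lemma lint_th_sub' (k : ℕ) (y : E3) : ∫⁻ x, ENNReal.ofReal (th (2 ^ k) (x - y)) ≤ c0 := by
  rw [lintegral_sub_right_eq_self (fun y => ENNReal.ofReal (th (2 ^ k) y)) y]
  exact lintegral_th_le (two_pow_pos' k)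

lemma Th_sq_le {H : Type} [NormedAddCommGroup H] (k : ℕ) {u : E3 → H} (hu : StronglyMeasurable u) :
    ∫⁻ x, Th k u x ^ 2 ≤ c0 ^ 2 * ∫⁻ x, ‖u x‖ₑ ^ 2 := by
  have hm1 : ∀ x, Measurable fun y => ENNReal.ofReal (th (2 ^ k) (x - y)) := fun x =>
    (((th_cont _).comp (by fun_prop : Continuous fun y : E3 => x - y)).measurable).ennreal_ofReal
  have key : ∀ x, Th k u x ^ 2 ≤ c0 * ∫⁻ y, ENNReal.ofReal (th (2 ^ k) (x - y)) * ‖u y‖ₑ ^ 2 := by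
    intro x
    set m : E3 → ℝ≥0∞ := fun y => ENNReal.ofReal (th (2 ^ k) (x - y)) with hm
    have := ENNReal.lintegral_mul_le_Lp_mul_Lq (volume : Measure E3) Real.HolderConjugate.two_two
      (f := fun y => m y ^ (1/2:ℝ)) (g := fun y => m y ^ (1/2:ℝ) * ‖u y‖ₑ)
      ((hm1 x).pow_const _).aemeasurable (((hm1 x).pow_const _).mul hu.enorm).aemeasurable
    have e1 : ∀ y, m y ^ (1/2:ℝ) * (m y ^ (1/2:ℝ) * ‖u y‖ₑ) = m y * ‖u y‖ₑ := by
      intro y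
      rw [← mul_assoc, ← ENNReal.rpow_add_of_nonneg _ _ (by norm_num) (by norm_num)]; norm_num
    have e2 : ∀ y, (m y ^ (1/2:ℝ)) ^ (2:ℝ) = m y := by
      intro y; rw [← ENNReal.rpow_mul]; norm_num
    simp only [Pi.mul_apply, e1, e2, ENNReal.mul_rpow_of_nonneg _ _ (zero_le_two : (0:ℝ) ≤ 2)] at this
    calc Th k u x ^ 2 ≤ _ := pow_le_pow_left' this 2
      _ = (∫⁻ y, m y) * ∫⁻ y, m y * ‖u y‖ₑ ^ 2 := by
        rw [mul_pow, ← ENNReal.rpow_natCast, ← ENNReal.rpow_mul, ← ENNReal.rpow_natCast, ← ENNReal.rpow_mul]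
        norm_num
      _ ≤ _ := by gcongr; exact lint_th_sub k x
  have hm2 : Measurable fun p : E3 × E3 => ENNReal.ofReal (th (2 ^ k) (p.1 - p.2)) * ‖u p.2‖ₑ ^ 2 := by
    have h1 := th_cont (2 ^ k)
    have h2 : Measurable fun p : E3 × E3 => ‖u p.2‖ₑ := hu.enorm.comp measurable_snd
    have h3 : Measurable fun p : E3 × E3 => ENNReal.ofReal (th (2 ^ k) (p.1 - p.2)) := by fun_prop
    exact h3.mul (h2.pow_const 2)
  calc ∫⁻ x, Th k u x ^ 2 ≤ ∫⁻ x, c0 * ∫⁻ y, ENNReal.ofReal (th (2 ^ k) (x - y)) * ‖u y‖ₑ ^ 2 := lintegral_mono key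
    _ = c0 * ∫⁻ y, ∫⁻ x, ENNReal.ofReal (th (2 ^ k) (x - y)) * ‖u y‖ₑ ^ 2 := by
        rw [lintegral_const_mul' _ _ c0_lt.ne, lintegral_lintegral_swap hm2.aemeasurable]
    _ ≤ c0 * ∫⁻ y, c0 * ‖u y‖ₑ ^ 2 := by
        gcongr with y
        rw [lintegral_mul_const']
        · gcongr; exact lint_th_sub' k y
        · finiteness
    _ = _ := by rw [lintegral_const_mul' _ _ c0_lt.ne, pow_two, mul_assoc]

theorem D_bd {q : ℝ≥0∞} (h1 : 1 < q) (ht : q < ⊤) : ∃ C : ℝ≥0, ∀ N (w : ℕ → E3 → ℂ), (∀ k, Adm (w k)) →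
      LN q (fun x => sq N fun k => Th k (w k) x) ≤ C * LN q (fun x => sq N fun k => ‖w k x‖ₑ) := by
  have hq := one_lt_toReal h1 ht
  have hA2 : c0 ^ 2 ≠ ⊤ := ENNReal.pow_ne_top c0_lt.ne
  refine ⟨((czC q.toReal (c0 ^ 2) (hB 3)) ^ (1 / q.toReal)).toNNReal, fun N w hw => ?_⟩
  rw [toN (czC_ne_top hA2 (hB_ne_top 3) hq) (by positivity)]
  refine LN_of_lint (by positivity) ht.ne ?_
  have hP : ∀ k : Fin N, ‖(inj k).comp (prj k)‖ ≤ 1 := fun k =>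
    (ContinuousLinearMap.opNorm_comp_le _ _).trans (mul_le_one₀ (inj_norm k) (norm_nonneg _) (prj_norm k))
  have hb : Bd (KK thC (fun k : Fin N => (inj k).comp (prj k))) 2 (c0 ^ 2) := by
    intro f hf
    simp only [ENNReal.rpow_two]
    simp only [enorm_euc]
    have hfk : ∀ k : Fin N, Adm fun y => f y k := fun k => hf.clm (prj k)
    rw [lintegral_finsetSum, lintegral_finsetSum, Finset.mul_sum]
    · refine Finset.sum_le_sum fun k _ => le_trans (lintegral_mono fun x => ?_) (Th_sq_le k (hfk k).meas)
      simp only [T_diag good_th hf]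
      refine pow_le_pow_left' ?_ 2
      unfold cv Th
      refine (enorm_integral_le_lintegral_enorm _).trans (lintegral_mono fun y => ?_)
      rw [enorm_mul, enorm_thC]
    · exact fun k _ => (hfk k).em.pow_const 2
    · intro k _
      exact ((T_adm (KK_NK good_th _) hf).clm (prj k)).em.pow_const 2
  have hv := vec_adm (N := N) fun k => (hw k).nrm
  have := KK_bd good_th hP hA2 hb hq _ hv
  simp only [vec_enorm] at this
  convert this using 4 with x x
  · symm
    refine sq_euc _ _ fun k => ?_
    rw [T_diag good_th hv]
    simp only [vec_apply]
    exact cv_thC k (hw k) x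
  · congr 2; ext1 k
    rw [← ofReal_norm, ← ofReal_norm]; simp

end KP

namespace KP

open Metric Set Filter
open scoped NNReal

/-- maximal function -/
noncomputable def MM {H : Type} [NormedAddCommGroup H] (u : E3 → H) (x : E3) : ℝ≥0∞ := ⨆ k, Th k u x

lemma Th_le_MM {H : Type} [NormedAddCommGroup H] (u : E3 → H) (k : ℕ) (x : E3) : Th k u x ≤ MM u x :=
  le_iSup (fun k => Th k u x) k

lemma MM_meas {H : Type} [NormedAddCommGroup H] {u : E3 → H} (hu : StronglyMeasurable u) : Measurable (MM u) :=
  Measurable.iSup fun k => Th_meas k hu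

/-- coordinate inclusion for the sup norm -/
noncomputable def injS {N : ℕ} (k : Fin N) : ℂ →L[ℂ] (Fin N → ℂ) :=
  ContinuousLinearMap.toSpanSingleton ℂ (Pi.single k 1)

lemma injS_norm {N : ℕ} (k : Fin N) : ‖injS k‖ ≤ 1 := by
  rw [injS, ContinuousLinearMap.norm_toSpanSingleton]
  refine (pi_norm_le_iff_of_nonneg zero_le_one).2 fun i => ?_
  by_cases h : i = k
  · subst h; simp
  · simp [h]

lemma T_injS {N : ℕ} {A : ℝ} {φ : ℕ → E3 → ℂ} (h : Good A φ) {f : E3 → ℂ} (hf : Adm f) (x : E3) (k : Fin N) :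
    (T (KK φ (injS (N := N))) f x) k = cv (φ k) f x := by
  have := ContinuousLinearMap.integral_comp_comm (ContinuousLinearMap.proj (R := ℂ) (φ := fun _ : Fin N => ℂ) k) (T_integrable (KK_NK h (injS (N := N))) hf x)
  rw [T, cv]
  refine Eq.trans this.symm ?_
  congr 1; ext y
  simp [injS, KK, Finset.sum_apply, Pi.single_apply]

lemma Th_le_of_bdd {H : Type} [NormedAddCommGroup H] (k : ℕ) {u : E3 → H} {c : ℝ≥0∞} (h : ∀ᵐ y, ‖u y‖ₑ ≤ c) (x : E3) :
    Th k u x ≤ c0 * c := by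
  unfold Th
  have hm1 : Measurable fun y => ENNReal.ofReal (th (2 ^ k) (x - y)) :=
    (((th_cont _).comp (by fun_prop : Continuous fun y : E3 => x - y)).measurable).ennreal_ofReal
  calc _ ≤ ∫⁻ y, ENNReal.ofReal (th (2 ^ k) (x - y)) * c := by
        refine lintegral_mono_ae ?_
        filter_upwards [h] with y hy
        gcongr
    _ = (∫⁻ y, ENNReal.ofReal (th (2 ^ k) (x - y))) * c := lintegral_mul_const _ hm1
    _ ≤ _ := by gcongr; exact lint_th_sub k x

theorem M_bd {q : ℝ≥0∞} (h1 : 1 < q) : ∃ C : ℝ≥0, ∀ (H : Type) [NormedAddCommGroup H] [NormedSpace ℂ H] (u : E3 → H), Adm u →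
      LN q (MM u) ≤ C * eLpNorm u q volume := by
  rcases eq_or_ne q ⊤ with rfl | ht
  · refine ⟨c0.toNNReal, fun H _ _ u hu => ?_⟩
    rw [ENNReal.coe_toNNReal c0_lt.ne]
    rw [LN, eLpNorm_exponent_top]
    refine essSup_le_of_ae_le _ (Eventually.of_forall fun x => ?_)
    simp only [enorm_eq_self]
    refine iSup_le fun k => Th_le_of_bdd k ?_ x
    rw [eLpNorm_exponent_top]
    exact enorm_ae_le_eLpNormEssSup u volume
  have ht := lt_top_iff_ne_top.2 ht
  have hq := one_lt_toReal h1 ht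
  set C1 := mC (hB 3) (q.toReal + 1) c0.toReal 0 q.toReal with hC1
  have hC1t : C1 ≠ ⊤ := mC_ne_top (hB_ne_top 3) (by simp)
  refine ⟨(C1 ^ (1 / q.toReal)).toNNReal, fun H _ _ u hu => ?_⟩
  rw [toN hC1t (by positivity), eLp_LN]
  refine LN_of_lint (by positivity) ht.ne ?_
  set v : E3 → ℂ := fun x => ((‖u x‖ : ℝ) : ℂ) with hv
  have hva : Adm v := hu.nrm
  have hev : ∀ x, ‖v x‖ₑ = ‖u x‖ₑ := fun x => by rw [← ofReal_norm, ← ofReal_norm]; simp [hv]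
  have hgr : ∀ N : ℕ, Gr (KK thC (injS (N := N))) (q.toReal + 1) c0.toReal 0 := by
    intro N g hg l hl hgl
    rw [zero_mul, nonpos_iff_eq_zero]
    convert measure_empty (μ := (volume : Measure E3))
    rw [Set.eq_empty_iff_forall_notMem]
    intro x hx
    refine not_le.2 (mem_setOf.1 hx) ?_
    refine (pi_norm_le_iff_of_nonneg (by positivity)).2 fun k => ?_
    rw [T_injS good_th hg]
    have h3 : ‖cv (thC k) g x‖ₑ ≤ c0 * ENNReal.ofReal l := by
      refine le_trans ?_ (Th_le_of_bdd k (u := g) (c := ENNReal.ofReal l) (Eventually.of_forall fun y => ?_) x)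
      · unfold cv Th
        refine (enorm_integral_le_lintegral_enorm _).trans (lintegral_mono fun y => ?_)
        rw [enorm_mul, enorm_thC]
      · rw [← ofReal_norm]; exact ENNReal.ofReal_le_ofReal (hgl y)
    have h4 := ENNReal.toReal_mono (by have := c0_lt.ne; finiteness) h3
    rwa [ENNReal.toReal_mul, ENNReal.toReal_ofReal hl.le, toReal_enorm] at h4
  have key : ∀ N : ℕ, ∫⁻ x, (⨆ k : Fin N, Th k u x) ^ q.toReal ≤ C1 * ∫⁻ x, ‖u x‖ₑ ^ q.toReal := by
    intro N
    have := strong_type (KK_NK good_th (injS (N := N))) (KK_hor good_th injS_norm) ENNReal.toReal_nonneg (hgr N) hq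
      (by linarith) hva
    simp only [hev] at this
    refine le_trans (lintegral_mono fun x => ?_) this
    gcongr
    refine iSup_le fun k => ?_
    rw [← cv_thC k hu x, ← T_injS good_th hva x k, ← ofReal_norm, ← ofReal_norm]
    exact ENNReal.ofReal_le_ofReal (norm_le_pi_norm _ k)
  have e : ∀ x, MM u x ^ q.toReal = ⨆ N : ℕ, (⨆ k : Fin N, Th k u x) ^ q.toReal := by
    intro x
    apply le_antisymm
    · have : MM u x ≤ ⨆ N : ℕ, (⨆ k : Fin N, Th k u x) :=
        iSup_le fun k => le_trans (le_iSup (fun j : Fin (k+1) => Th j u x) (Fin.last k)) (le_iSup (fun N : ℕ => (⨆ k : Fin N, Th k u x)) (k+1))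
      have h5 := (ENNReal.orderIsoRpow q.toReal (by positivity)).map_iSup (fun N : ℕ => (⨆ k : Fin N, Th k u x))
      simp only [ENNReal.orderIsoRpow_apply] at h5
      rw [← h5]
      gcongr
    · refine iSup_le fun N => ?_
      gcongr
      exact iSup_le fun k => Th_le_MM u k x
  simp_rw [e]
  rw [lintegral_iSup]
  · exact iSup_le key
  · intro N
    exact (Measurable.iSup fun k : Fin N => Th_meas k hu.meas).pow_const _
  · intro N M hNM x
    dsimp only
    gcongr
    exact iSup_le fun k => le_iSup (fun j : Fin M => Th j u x) (Fin.castLE hNM k)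

end KP

namespace KP

open Metric Set Filter
open scoped NNReal ContDiff SchwartzMap

/-- family of profiles, uniformly bounded in `C_c^∞` -/
structure Prof (R : ℝ) (b : ℕ → E3 → ℂ) : Prop where
  smooth : ∀ k, ContDiff ℝ ∞ (b k)
  supp : ∀ k ζ, R ≤ ‖ζ‖ → b k ζ = 0
  bdd : ∀ n : ℕ, ∃ C : ℝ, ∀ k ζ, ‖iteratedFDeriv ℝ n (b k) ζ‖ ≤ C

lemma cs_of {R : ℝ} {η : E3 → ℂ} (h : ∀ ζ, R ≤ ‖ζ‖ → η ζ = 0) : HasCompactSupport η :=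
  HasCompactSupport.intro (isCompact_closedBall (0:E3) R) fun x hx => h x (by
    rw [mem_closedBall, dist_zero_right, not_le] at hx; exact hx.le)

lemma iter_zero {R : ℝ} {η : E3 → ℂ} (h : ∀ ζ, R ≤ ‖ζ‖ → η ζ = 0) {ζ : E3} (hζ : R < ‖ζ‖) (n : ℕ) :
    iteratedFDeriv ℝ n η ζ = 0 := by
  have h1 : η =ᶠ[nhds ζ] fun _ => 0 := by
    have : {z : E3 | R < ‖z‖} ∈ nhds ζ := (isOpen_lt continuous_const continuous_norm).mem_nhds hζ
    filter_upwards [this] with z hz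
    exact h z (le_of_lt hz)
  have := h1.iteratedFDeriv ℝ n
  rw [this.self_of_nhds]
  simp

lemma Prof.of_joint {R : ℝ} {a : ℝ × E3 → ℂ} (ha : ContDiff ℝ ∞ a) (hR : ∀ e ζ, R ≤ ‖ζ‖ → a (e, ζ) = 0)
    {ε : ℕ → ℝ} (hε : ∀ k, ε k ∈ Icc (0:ℝ) 1) : Prof R (fun k ζ => a (ε k, ζ)) := by
  refine ⟨fun k => ha.comp (by fun_prop), fun k ζ h => hR _ _ h, fun n => ?_⟩
  have hc : Continuous (iteratedFDeriv ℝ n a) := ha.continuous_iteratedFDeriv (by exact_mod_cast le_top)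
  obtain ⟨C, hC⟩ := ((isCompact_Icc (a := (0:ℝ)) (b := 1)).prod (isCompact_closedBall (0:E3) R)).exists_bound_of_continuousOn
    hc.continuousOn
  refine ⟨max C 0, fun k ζ => ?_⟩
  rcases lt_or_ge R ‖ζ‖ with h | h
  · rw [iter_zero (fun ζ h => hR _ _ h) h]; simp
  refine le_trans ?_ (le_max_left _ _)
  have e : (fun ζ => a (ε k, ζ)) = (fun p => a ((ε k, 0) + p)) ∘ (ContinuousLinearMap.inr ℝ ℝ E3) := by
    ext z; simp
  have h2 : ContDiff ℝ ∞ (fun p => a ((ε k, 0) + p)) := ha.comp (by fun_prop)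
  rw [e, ContinuousLinearMap.iteratedFDeriv_comp_right _ h2 _ (by exact_mod_cast le_top), iteratedFDeriv_comp_add_left]
  refine (ContinuousMultilinearMap.norm_compContinuousLinearMap_le _ _).trans ?_
  have h3 := hC (ε k, ζ) ⟨hε k, by simpa using h⟩
  have h4 : ((ε k, (0:E3)) + (ContinuousLinearMap.inr ℝ ℝ E3) ζ) = (ε k, ζ) := by simp
  rw [h4]
  refine le_trans (mul_le_of_le_one_right (norm_nonneg _) ?_) h3
  exact Finset.prod_le_one (fun _ _ => norm_nonneg _) fun _ _ => ContinuousLinearMap.norm_inr_le_one ℝ ℝ E3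

lemma Prof.const {R : ℝ} {η : E3 → ℂ} (hs : ContDiff ℝ ∞ η) (h : ∀ ζ, R ≤ ‖ζ‖ → η ζ = 0) : Prof R (fun _ => η) :=
  Prof.of_joint (a := fun p => η p.2) (hs.comp contDiff_snd) (fun _ ζ hζ => h ζ hζ) (ε := fun _ => 0) (fun _ => by simp)

lemma Prof.ite {R : ℝ} {b c : ℕ → E3 → ℂ} (hb : Prof R b) (hc : Prof R c) :
    Prof R (fun k => if k = 0 then b k else c k) := by
  refine ⟨fun k => ?_, fun k ζ h => ?_, fun n => ?_⟩
  · split_ifs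
    exacts [hb.smooth k, hc.smooth k]
  · split_ifs
    exacts [hb.supp k ζ h, hc.supp k ζ h]
  · obtain ⟨C, hC⟩ := hb.bdd n
    obtain ⟨C', hC'⟩ := hc.bdd n
    refine ⟨max C C', fun k ζ => ?_⟩
    split_ifs
    exacts [(hC k ζ).trans (le_max_left _ _), (hC' k ζ).trans (le_max_right _ _)]

lemma Prof.norm_bdd {R : ℝ} {b : ℕ → E3 → ℂ} (hb : Prof R b) : ∃ C : ℝ, ∀ k ζ, ‖b k ζ‖ ≤ C := by
  obtain ⟨C, hC⟩ := hb.bdd 0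
  exact ⟨C, fun k ζ => by simpa using hC k ζ⟩

/-- profile as Schwartz function -/
noncomputable def Prof.S {R : ℝ} {b : ℕ → E3 → ℂ} (hb : Prof R b) (k : ℕ) : 𝓢(E3, ℂ) :=
  (cs_of (hb.supp k)).toSchwartzMap (hb.smooth k)

lemma Prof.S_apply {R : ℝ} {b : ℕ → E3 → ℂ} (hb : Prof R b) (k : ℕ) (ζ : E3) : hb.S k ζ = b k ζ := rfl

lemma Prof.semi {R : ℝ} {b : ℕ → E3 → ℂ} (hb : Prof R b) (m : ℕ × ℕ) :
    ∃ C : ℝ, 0 ≤ C ∧ ∀ k, schwartzSeminormFamily ℂ E3 ℂ m (hb.S k) ≤ C := by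
  obtain ⟨C, hC⟩ := hb.bdd m.2
  have hC0 : 0 ≤ C := (norm_nonneg _).trans (hC 0 0)
  refine ⟨|R| ^ m.1 * C, by positivity, fun k => ?_⟩
  refine SchwartzMap.seminorm_le_bound ℂ m.1 m.2 _ (by positivity) fun x => ?_
  have e : (⇑(hb.S k)) = b k := rfl
  rw [e]
  rcases lt_or_ge R ‖x‖ with h | h
  · rw [iter_zero (hb.supp k) h]; simp; positivity
  · gcongr
    exacts [h.trans (le_abs_self R), hC k x]

lemma Prof.semi_F {R : ℝ} {b : ℕ → E3 → ℂ} (hb : Prof R b) (m : ℕ × ℕ) :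
    ∃ C : ℝ, 0 ≤ C ∧ ∀ k, schwartzSeminormFamily ℂ E3 ℂ m (𝓕⁻ (hb.S k)) ≤ C := by
  let q : Seminorm ℂ (𝓢(E3, ℂ)) := (schwartzSeminormFamily ℂ E3 ℂ m).comp (fourierInvCLM ℂ 𝓢(E3, ℂ)).toLinearMap
  have hq : Continuous q := ((schwartz_withSeminorms ℂ E3 ℂ).continuous_seminorm m).comp (fourierInvCLM ℂ 𝓢(E3, ℂ)).continuous
  obtain ⟨s, C, -, hC⟩ := Seminorm.bound_of_continuous (schwartz_withSeminorms ℂ E3 ℂ) q hq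
  choose D hD0 hD using hb.semi
  refine ⟨C * ∑ i ∈ s, D i, mul_nonneg C.2 (Finset.sum_nonneg fun i _ => hD0 i), fun k => ?_⟩
  refine (hC (hb.S k)).trans ?_
  rw [Seminorm.smul_apply, NNReal.smul_def, smul_eq_mul]
  refine mul_le_mul_of_nonneg_left ?_ C.2
  refine Seminorm.finset_sup_apply_le (Finset.sum_nonneg fun i _ => hD0 i) fun i hi => (hD i k).trans ?_
  exact Finset.single_le_sum (fun i _ => hD0 i) hi

lemma Prof.decay {R : ℝ} {b : ℕ → E3 → ℂ} (hb : Prof R b) (M n : ℕ) :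
    ∃ C : ℝ, 0 ≤ C ∧ ∀ k x, ‖iteratedFDeriv ℝ n (𝓕⁻ (hb.S k) : 𝓢(E3, ℂ)) x‖ ≤ C * ((1 + ‖x‖ ^ 2) ^ M)⁻¹ := by
  choose D hD0 hD using hb.semi_F
  refine ⟨2 ^ (2 * M) * ∑ i ∈ Finset.Iic (2 * M, n), D i, mul_nonneg (by positivity) (Finset.sum_nonneg fun i _ => hD0 i), fun k x => ?_⟩
  have h1 := SchwartzMap.one_add_le_sup_seminorm_apply (𝕜 := ℂ) (m := (2 * M, n)) (k := 2 * M) (n := n) le_rfl le_rfl (𝓕⁻ (hb.S k) : 𝓢(E3, ℂ)) x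
  have h2 : (Finset.Iic (2 * M, n)).sup (fun m => SchwartzMap.seminorm ℂ m.1 m.2) (𝓕⁻ (hb.S k) : 𝓢(E3, ℂ)) ≤ ∑ i ∈ Finset.Iic (2 * M, n), D i := by
    refine Seminorm.finset_sup_apply_le (Finset.sum_nonneg fun i _ => hD0 i) fun i hi => (hD i k).trans ?_
    exact Finset.single_le_sum (fun i _ => hD0 i) hi
  rw [← div_eq_mul_inv, le_div_iff₀ (by positivity), mul_comm]
  refine le_trans ?_ (h1.trans ?_)
  · gcongr
    rw [pow_mul]
    gcongr
    nlinarith [norm_nonneg x]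
  · gcongr

/-- dyadic symbol -/
noncomputable def sy (b : ℕ → E3 → ℂ) (k : ℕ) (ξ : E3) : ℂ := b k (((2:ℝ) ^ k)⁻¹ • ξ)

/-- kernels -/
noncomputable def ker (b : ℕ → E3 → ℂ) (k : ℕ) : E3 → ℂ := 𝓕⁻ (sy b k)

lemma ker_eq {R : ℝ} {b : ℕ → E3 → ℂ} (hb : Prof R b) (k : ℕ) (z : E3) :
    ker b k z = ((((2:ℝ) ^ k) ^ 3 : ℝ) : ℂ) * (𝓕⁻ (hb.S k) : 𝓢(E3, ℂ)) ((2:ℝ) ^ k • z) := by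
  rw [SchwartzMap.fourierInv_coe, ker, Real.fourierInv_eq, Real.fourierInv_eq]
  have := Measure.integral_comp_inv_smul (volume : Measure E3) (fun v => Real.fourierChar (inner ℝ v ((2:ℝ) ^ k • z)) • b k v) ((2:ℝ) ^ k)
  simp only [finrank_euclideanSpace, Fintype.card_fin] at this
  rw [abs_of_pos (by positivity), Complex.real_smul] at this
  refine Eq.trans ?_ this
  congr 1; ext v
  rw [sy, inner_smul_left, inner_smul_right]
  congr 3
  simp

lemma ker_bd {R : ℝ} {b : ℕ → E3 → ℂ} (hb : Prof R b) (M : ℕ) :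
    ∃ C : ℝ, 0 ≤ C ∧ ∀ k z, ‖ker b k z‖ ≤ C * (((2:ℝ) ^ k) ^ 3 * ((1 + ((2:ℝ) ^ k * ‖z‖) ^ 2) ^ M)⁻¹) := by
  obtain ⟨C, hC0, hC⟩ := hb.decay M 0
  refine ⟨C, hC0, fun k z => ?_⟩
  rw [ker_eq hb, norm_mul, Complex.norm_real, Real.norm_eq_abs, abs_of_pos (by positivity)]
  have := hC k ((2:ℝ) ^ k • z)
  rw [norm_iteratedFDeriv_zero, norm_smul, Real.norm_eq_abs, abs_of_pos (by positivity)] at this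
  calc _ ≤ ((2:ℝ) ^ k) ^ 3 * _ := mul_le_mul_of_nonneg_left this (by positivity)
    _ = _ := by ring

lemma ker_good {R : ℝ} {b : ℕ → E3 → ℂ} (hb : Prof R b) : ∃ A : ℝ, Good A (ker b) := by
  obtain ⟨C, hC0, hC⟩ := ker_bd hb 3
  obtain ⟨C', hC0', hC'⟩ := hb.decay 3 1
  have e : ∀ k, ker b k = fun z => ((((2:ℝ) ^ k) ^ 3 : ℝ) : ℂ) * (𝓕⁻ (hb.S k) : 𝓢(E3, ℂ)) ((2:ℝ) ^ k • z) := fun k => by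
    ext z; exact ker_eq hb k z
  have hd : ∀ k z, HasFDerivAt (ker b k) (((((2:ℝ) ^ k) ^ 3 : ℝ) : ℂ) • ((fderiv ℝ (𝓕⁻ (hb.S k) : 𝓢(E3, ℂ)) ((2:ℝ) ^ k • z)).comp ((2:ℝ) ^ k • ContinuousLinearMap.id ℝ E3))) z := by
    intro k z
    rw [e]
    have h1 : HasFDerivAt (fun z : E3 => (2:ℝ) ^ k • z) ((2:ℝ) ^ k • ContinuousLinearMap.id ℝ E3) z :=
      (hasFDerivAt_id z).const_smul ((2:ℝ) ^ k)
    have h2 := (𝓕⁻ (hb.S k) : 𝓢(E3, ℂ)).differentiableAt (x := (2:ℝ) ^ k • z)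
    exact (h2.hasFDerivAt.comp z h1).const_mul _
  refine ⟨max C C', fun k z => (hd k z).differentiableAt, fun k z => ?_, fun k z => ?_⟩
  · refine (hC k z).trans ?_
    unfold th
    gcongr
    exact le_max_left _ _
  · rw [(hd k z).fderiv, norm_smul, Complex.norm_real, Real.norm_eq_abs, abs_of_pos (by positivity)]
    have := hC' k ((2:ℝ) ^ k • z)
    rw [norm_iteratedFDeriv_one, norm_smul, Real.norm_eq_abs, abs_of_pos (by positivity)] at this
    have h3 : ‖(fderiv ℝ (𝓕⁻ (hb.S k) : 𝓢(E3, ℂ)) ((2:ℝ) ^ k • z)).comp ((2:ℝ) ^ k • ContinuousLinearMap.id ℝ E3)‖ ≤ C' * ((1 + (2 ^ k * ‖z‖) ^ 2) ^ 3)⁻¹ * 2 ^ k := by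
      refine (ContinuousLinearMap.opNorm_comp_le _ _).trans ?_
      gcongr
      rw [norm_smul, Real.norm_eq_abs, abs_of_pos (by positivity)]
      exact mul_le_of_le_one_right (by positivity) ContinuousLinearMap.norm_id_le
    calc _ ≤ ((2:ℝ) ^ k) ^ 3 * _ := mul_le_mul_of_nonneg_left h3 (by positivity)
      _ = C' * 2 ^ k * th (2 ^ k) z := by unfold th; ring
      _ ≤ _ := by
        have := th_nonneg (two_pow_pos' k) z
        gcongr
        exact le_max_right _ _

end KP

namespace KP

open Metric Set Filter
open scoped NNReal ContDiff SchwartzMap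

/-- Fourier multiplier operator on Schwartz functions -/
noncomputable def op (m : E3 → ℂ) : 𝓢(E3, ℂ) →L[ℂ] 𝓢(E3, ℂ) := SchwartzMap.fourierMultiplierCLM ℂ m

lemma op_apply (m : E3 → ℂ) (u : 𝓢(E3, ℂ)) : op m u = 𝓕⁻ (SchwartzMap.smulLeftCLM ℂ m (𝓕 u)) := rfl

lemma F_op {m : E3 → ℂ} (hm : m.HasTemperateGrowth) (u : 𝓢(E3, ℂ)) (ξ : E3) :
    𝓕 (op m u) ξ = m ξ * 𝓕 u ξ := by
  rw [op_apply, fourier_fourierInv_eq, SchwartzMap.smulLeftCLM_apply_apply hm, smul_eq_mul]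

lemma adm_S (u : 𝓢(E3, ℂ)) : Adm (u : E3 → ℂ) :=
  ⟨u.continuous.stronglyMeasurable, u.integrable, ⟨SchwartzMap.seminorm ℂ 0 0 u, fun x => u.norm_le_seminorm ℂ x⟩⟩

lemma sy_smooth {R : ℝ} {b : ℕ → E3 → ℂ} (hb : Prof R b) (k : ℕ) : ContDiff ℝ ∞ (sy b k) :=
  (hb.smooth k).comp (contDiff_const_smul _)

lemma sy_supp {R : ℝ} {b : ℕ → E3 → ℂ} (hb : Prof R b) (k : ℕ) (ξ : E3) (h : 2 ^ k * R ≤ ‖ξ‖) : sy b k ξ = 0 := by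
  apply hb.supp
  rw [norm_smul, norm_inv, Real.norm_eq_abs, abs_of_pos (by positivity), inv_mul_eq_div, le_div_iff₀ (by positivity), mul_comm]
  exact h

lemma sy_temp {R : ℝ} {b : ℕ → E3 → ℂ} (hb : Prof R b) (k : ℕ) : (sy b k).HasTemperateGrowth :=
  (cs_of (sy_supp hb k)).hasTemperateGrowth (sy_smooth hb k)

/-- kernel as a Schwartz function -/
noncomputable def kerS {R : ℝ} {b : ℕ → E3 → ℂ} (hb : Prof R b) (k : ℕ) : 𝓢(E3, ℂ) :=
  𝓕⁻ ((cs_of (sy_supp hb k)).toSchwartzMap (sy_smooth hb k))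

lemma kerS_coe {R : ℝ} {b : ℕ → E3 → ℂ} (hb : Prof R b) (k : ℕ) : (kerS hb k : E3 → ℂ) = ker b k := by
  rw [kerS, SchwartzMap.fourierInv_coe]; rfl

lemma op_cv {R : ℝ} {b : ℕ → E3 → ℂ} (hb : Prof R b) (k : ℕ) (u : 𝓢(E3, ℂ)) (x : E3) :
    op (sy b k) u x = cv (ker b k) u x := by
  have h : op (sy b k) u = SchwartzMap.convolution (ContinuousLinearMap.mul ℂ ℂ) (kerS hb k) u := by
    have : 𝓕 (op (sy b k) u) = 𝓕 (SchwartzMap.convolution (ContinuousLinearMap.mul ℂ ℂ) (kerS hb k) u) := by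
      ext ξ
      rw [F_op (sy_temp hb k), SchwartzMap.fourier_convolution, kerS, fourier_fourierInv_eq]
      rfl
    have := congrArg (fun w : 𝓢(E3, ℂ) => (𝓕⁻ w : 𝓢(E3, ℂ))) this
    simpa only [fourierInv_fourier_eq] using this
  rw [h, SchwartzMap.convolution_apply, cv]
  have := convolution_eq_swap (ContinuousLinearMap.mul ℂ ℂ) (f := (kerS hb k : E3 → ℂ)) (g := (u : E3 → ℂ)) (x := x) (μ := volume)
  rw [this, kerS_coe]
  rfl

lemma planch (u : 𝓢(E3, ℂ)) : ∫⁻ ξ, ‖𝓕 u ξ‖ₑ ^ 2 = ∫⁻ x, ‖u x‖ₑ ^ 2 := by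
  have h : ∀ v : 𝓢(E3, ℂ), ∫⁻ ξ, ‖v ξ‖ₑ ^ 2 = ENNReal.ofReal (∫ ξ, ‖v ξ‖ ^ 2) := by
    intro v
    have h2 : Integrable (fun ξ => ‖v ξ‖ ^ 2) := (memLp_two_iff_integrable_sq_norm v.continuous.aestronglyMeasurable).1 (v.memLp 2)
    rw [ofReal_integral_eq_lintegral_ofReal h2 (Eventually.of_forall fun _ => by positivity)]
    congr 1; ext ξ
    rw [ENNReal.ofReal_pow (norm_nonneg _), ofReal_norm]
  rw [h, h, SchwartzMap.integral_norm_sq_fourier]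

lemma L2_S {R : ℝ} {b : ℕ → E3 → ℂ} (hb : Prof R b) {A2 : ℝ≥0∞} (h : ∀ N ξ, ∑ k ∈ Finset.range N, ‖sy b k ξ‖ₑ ^ 2 ≤ A2)
    (N : ℕ) (u : 𝓢(E3, ℂ)) : ∑ k ∈ Finset.range N, ∫⁻ x, ‖cv (ker b k) u x‖ₑ ^ 2 ≤ A2 * ∫⁻ x, ‖u x‖ₑ ^ 2 := by
  have h1 : ∀ k, ∫⁻ x, ‖cv (ker b k) u x‖ₑ ^ 2 = ∫⁻ ξ, ‖sy b k ξ‖ₑ ^ 2 * ‖𝓕 u ξ‖ₑ ^ 2 := by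
    intro k
    simp_rw [← op_cv hb, ← planch (op (sy b k) u), F_op (sy_temp hb k), enorm_mul, mul_pow]
  simp_rw [h1]
  have hm : ∀ k, Measurable fun ξ => ‖sy b k ξ‖ₑ ^ 2 * ‖𝓕 u ξ‖ₑ ^ 2 := by
    intro k
    have := (sy_smooth hb k).continuous
    have := (𝓕 u).continuous
    fun_prop
  rw [← lintegral_finsetSum _ fun k _ => hm k, ← planch u, ← lintegral_const_mul _ ((𝓕 u).continuous.enorm.measurable.pow_const 2)]
  refine lintegral_mono fun ξ => ?_
  simp only
  rw [← Finset.sum_mul]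
  gcongr
  exact h N ξ


lemma Adm.memLp2 {f : E3 → ℂ} (hf : Adm f) : MemLp f 2 := by
  obtain ⟨M, hM⟩ := hf.bdd
  rw [memLp_two_iff_integrable_sq_norm hf.meas.aestronglyMeasurable]
  simp_rw [pow_two]
  exact hf.int.norm.bdd_mul (c := M) hf.meas.norm.aestronglyMeasurable (Eventually.of_forall fun x => by simpa using hM x)

lemma lint_two (f : E3 → ℂ) : ∫⁻ x, ‖f x‖ₑ ^ 2 = eLpNorm f 2 volume ^ 2 := by
  rw [eLpNorm_eq_lintegral_rpow_enorm_toReal (by norm_num) (by norm_num), ← ENNReal.rpow_natCast, ← ENNReal.rpow_mul]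
  norm_num

lemma S_L2_fin (v : 𝓢(E3, ℂ)) : eLpNorm v 2 volume ≠ ⊤ := by
  have h : MemLp v 2 volume := v.memLp 2
  exact h.2.ne

lemma cv_L2 (v : 𝓢(E3, ℂ)) {f : E3 → ℂ} (hf : StronglyMeasurable f) (x : E3) :
    ‖cv v f x‖ₑ ≤ eLpNorm v 2 volume * eLpNorm f 2 volume := by
  refine (enorm_integral_le_lintegral_enorm _).trans ?_
  have h := eLpNorm_smul_le_mul_eLpNorm (p := 2) (q := 2) (r := 1) (μ := (volume : Measure E3)) hf.aestronglyMeasurable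
    (φ := fun y => v (x - y)) (v.continuous.comp (continuous_const.sub continuous_id)).aestronglyMeasurable
  rw [eLpNorm_one_eq_lintegral_enorm] at h
  refine h.trans ?_
  gcongr
  have := eLpNorm_comp_measurePreserving (p := 2) (f := fun y : E3 => x - y) (μ := volume) (ν := volume) v.continuous.aestronglyMeasurable (Measure.measurePreserving_sub_left volume x)
  exact this.le

lemma cv_meas {A : ℝ} {φ : ℕ → E3 → ℂ} (h : Good A φ) (k : ℕ) {f : E3 → ℂ} (hf : StronglyMeasurable f) :
    StronglyMeasurable (cv (φ k) f) := by
  have h1 : StronglyMeasurable (fun p : E3 × E3 => φ k (p.1 - p.2) * f p.2) := by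
    refine StronglyMeasurable.mul ?_ (hf.comp_measurable measurable_snd)
    have : Continuous (φ k) := continuous_iff_continuousAt.2 fun z => (h.diff k z).continuousAt
    exact (this.comp (continuous_fst.sub continuous_snd)).stronglyMeasurable
  exact h1.integral_prod_right

lemma cv_sub {A : ℝ} {φ : ℕ → E3 → ℂ} (h : Good A φ) (k : ℕ) {f g : E3 → ℂ} (hf : Adm f) (hg : Adm g) (x : E3) :
    cv (φ k) (fun y => f y - g y) x = cv (φ k) f x - cv (φ k) g x := by
  have hi : ∀ {f}, Adm f → Integrable (fun y => φ k (x - y) * f y) := by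
    intro f hf
    obtain ⟨M, hM⟩ := hf.bdd
    exact Integrable.mul_bdd (c := M) ((h.integrable k).comp_sub_left x) hf.meas.aestronglyMeasurable (Eventually.of_forall hM)
  unfold cv
  rw [← integral_sub (hi hf) (hi hg)]
  congr 1; ext y; ring

theorem L2c_of {R : ℝ} {b : ℕ → E3 → ℂ} (hb : Prof R b) {A2 : ℝ≥0∞} (hA2 : A2 ≠ ⊤)
    (h : ∀ N ξ, ∑ k ∈ Finset.range N, ‖sy b k ξ‖ₑ ^ 2 ≤ A2) : L2c A2 (ker b) := by
  intro N f hf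
  obtain ⟨A, hA⟩ := ker_good hb
  have hm := hf.memLp2
  have hex : ∀ n : ℕ, ∃ u : 𝓢(E3, ℂ), eLpNorm (f - ⇑u) 2 volume ≤ ENNReal.ofReal ((1:ℝ) / (n + 1)) := by
    intro n
    obtain ⟨g, hg₁, hg₂, hg₃⟩ := MemLp.exist_eLpNorm_sub_le (by norm_num) (by norm_num) hm (ε := 1 / (n + 1)) (by positivity)
    exact ⟨hg₁.toSchwartzMap hg₂, hg₃⟩
  choose u hu using hex
  replace hu : ∀ n, eLpNorm (f - ⇑(u n)) 2 volume ≤ (fun n : ℕ => ENNReal.ofReal ((1:ℝ) / (n + 1))) n := hu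
  have hlim : Tendsto (fun n : ℕ => ENNReal.ofReal ((1:ℝ) / (n + 1))) atTop (nhds 0) := by
    have := ENNReal.tendsto_ofReal (tendsto_one_div_add_atTop_nhds_zero_nat (𝕜 := ℝ))
    simpa using this
  generalize (fun n : ℕ => ENNReal.ofReal ((1:ℝ) / (n + 1))) = d at hlim hu
  have hpt : ∀ k x, Tendsto (fun n => ‖cv (ker b k) (u n) x‖ₑ ^ 2) atTop (nhds (‖cv (ker b k) f x‖ₑ ^ 2)) := by
    intro k x
    refine ((ENNReal.continuous_pow 2).tendsto _).comp (Tendsto.enorm ?_)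
    rw [tendsto_iff_edist_tendsto_0]
    have h0 : Tendsto (fun n : ℕ => eLpNorm (kerS hb k) 2 volume * d n) atTop (nhds 0) := by
      have hfin : eLpNorm (kerS hb k) 2 volume ≠ ⊤ := S_L2_fin _
      generalize eLpNorm (kerS hb k) 2 volume = c at hfin
      have := ENNReal.Tendsto.const_mul hlim (a := c) (Or.inr hfin)
      simpa using this
    refine tendsto_of_tendsto_of_tendsto_of_le_of_le tendsto_const_nhds h0 (fun _ => bot_le) fun n => ?_
    simp only
    rw [edist_comm, edist_eq_enorm_sub, ← cv_sub hA k hf (adm_S (u n))]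
    have := cv_L2 (kerS hb k) (hf.meas.sub (adm_S (u n)).meas) x
    rw [kerS_coe] at this
    refine this.trans ?_
    rw [kerS_coe]
    gcongr
    exact hu n
  have hmeas : ∀ k (f : E3 → ℂ), StronglyMeasurable f → Measurable fun x => ‖cv (ker b k) f x‖ₑ ^ 2 := fun k f hf =>
    (cv_meas hA k hf).enorm.pow_const 2
  rw [← lintegral_finsetSum _ fun k _ => hmeas k f hf.meas]
  have h1 : ∀ x, ∑ k ∈ Finset.range N, ‖cv (ker b k) f x‖ₑ ^ 2 = liminf (fun n => ∑ k ∈ Finset.range N, ‖cv (ker b k) (u n) x‖ₑ ^ 2) atTop :=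
    fun x => (tendsto_finsetSum _ fun k _ => hpt k x).liminf_eq.symm
  simp_rw [h1]
  refine (lintegral_liminf_le fun n => Finset.measurable_fun_sum _ fun k _ => hmeas k _ (adm_S (u n)).meas).trans ?_
  have h2 : Tendsto (fun n : ℕ => A2 * (eLpNorm f 2 volume + d n) ^ 2) atTop (nhds (A2 * (eLpNorm f 2 volume + 0) ^ 2)) := by
    refine ENNReal.Tendsto.const_mul ?_ (Or.inr hA2)
    exact ((ENNReal.continuous_pow 2).tendsto _).comp (hlim.const_add _)
  rw [add_zero, ← lint_two] at h2
  rw [← h2.liminf_eq]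
  refine liminf_le_liminf (Eventually.of_forall fun n => ?_)
  rw [lintegral_finsetSum _ fun k _ => hmeas k _ (adm_S (u n)).meas]
  refine (L2_S hb h N (u n)).trans ?_
  rw [lint_two]
  gcongr
  have e : (u n : E3 → ℂ) = f - (f - ⇑(u n)) := by simp
  rw [e]
  refine (eLpNorm_sub_le hf.meas.aestronglyMeasurable (hf.meas.sub (adm_S (u n)).meas).aestronglyMeasurable (by norm_num)).trans ?_
  gcongr
  exact hu n

lemma L2c.refl {A2 : ℝ≥0∞} {φ : ℕ → E3 → ℂ} (h : L2c A2 φ) : L2c A2 (refl φ) := by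
  intro N f hf
  have hf' : Adm fun y => star (f (-y)) := by
    obtain ⟨M, hM⟩ := hf.bdd
    refine ⟨(hf.meas.comp_measurable measurable_neg).star, ?_, M, fun x => by simpa using hM (-x)⟩
    have := hf.int.comp_neg
    exact (Complex.conjCLE : ℂ →L[ℝ] ℂ).integrable_comp this
  have hst : ∀ z : ℂ, ‖star z‖ₑ = ‖z‖ₑ := fun z => by rw [← ofReal_norm, norm_star, ofReal_norm]
  have e : ∀ k x, cv (KP.refl φ k) f x = star (cv (φ k) (fun y => star (f (-y))) (-x)) := by
    intro k x
    unfold cv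
    rw [← integral_neg_eq_self]
    have := integral_conj (μ := (volume : Measure E3)) (f := fun y => φ k (-x - y) * star (f (-y)))
    refine Eq.trans ?_ this
    congr 1; ext y
    simp only [KP.refl, map_mul, starRingEnd_apply, star_star]
    congr 3
    abel
  have h1 : ∀ k, ∫⁻ x, ‖cv (KP.refl φ k) f x‖ₑ ^ 2 = ∫⁻ x, ‖cv (φ k) (fun y => star (f (-y))) x‖ₑ ^ 2 := by
    intro k
    simp_rw [e, hst]
    exact lintegral_neg_eq_self (fun x => ‖cv (φ k) (fun y => star (f (-y))) x‖ₑ ^ 2)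
  have h2 : ∫⁻ x, ‖star (f (-x))‖ₑ ^ 2 = ∫⁻ x, ‖f x‖ₑ ^ 2 := by
    simp_rw [hst]
    exact lintegral_neg_eq_self (fun x => ‖f x‖ₑ ^ 2)
  simp_rw [h1, ← h2]
  exact h N _ hf'

lemma sy_sq {R : ℝ} {b : ℕ → E3 → ℂ} (hb : Prof R b) {C : ℝ} (h : ∀ k, k ≠ 0 → ∀ ζ, ‖b k ζ‖ ≤ C * ‖ζ‖) :
    ∃ A2 : ℝ≥0∞, A2 ≠ ⊤ ∧ ∀ N ξ, ∑ k ∈ Finset.range N, ‖sy b k ξ‖ₑ ^ 2 ≤ A2 := by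
  obtain ⟨D, hD⟩ := hb.norm_bdd
  have hD0 : 0 ≤ D := (norm_nonneg _).trans (hD 0 0)
  set E : ℝ := max C (D * |R|) with hE
  have hE0 : 0 ≤ E := le_max_of_le_right (by positivity)
  have hR1 : ∀ k ζ, ‖b k ζ‖ * ‖ζ‖ ≤ E := by
    intro k ζ
    rcases le_or_gt R ‖ζ‖ with h1 | h1
    · rw [hb.supp k ζ h1]; simpa using hE0
    · refine le_trans ?_ (le_max_right _ _)
      gcongr
      exacts [hD k ζ, h1.le.trans (le_abs_self R)]
  have hpt : ∀ k, k ≠ 0 → ∀ ζ, ζ ≠ 0 → ‖b k ζ‖ ^ 2 ≤ E ^ 2 * min (‖ζ‖ ^ 2)⁻¹ (((‖ζ‖ ^ 2)⁻¹)⁻¹) := by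
    intro k hk ζ hζ
    have hp : 0 < ‖ζ‖ := norm_pos_iff.2 hζ
    rw [inv_inv, mul_min_of_nonneg _ _ (by positivity)]
    refine le_min ?_ ?_
    · rw [← div_eq_mul_inv, le_div_iff₀ (by positivity), ← mul_pow]
      gcongr; exact hR1 k ζ
    · rw [← mul_pow]
      gcongr
      refine (h k hk ζ).trans ?_
      gcongr; exact le_max_left _ _
  refine ⟨ENNReal.ofReal (D ^ 2 + E ^ 2 * (2 * 4 / (4 - 1))), ENNReal.ofReal_ne_top, fun N ξ => ?_⟩
  have hr : ∀ k, ‖sy b k ξ‖ₑ ^ 2 = ENNReal.ofReal (‖sy b k ξ‖ ^ 2) := fun k => by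
    rw [ENNReal.ofReal_pow (norm_nonneg _), ofReal_norm]
  simp_rw [hr]
  rw [← ENNReal.ofReal_sum_of_nonneg fun _ _ => by positivity]
  refine ENNReal.ofReal_le_ofReal ?_
  rcases eq_or_ne ξ 0 with rfl | hξ
  · have h0 : ∀ k ∈ Finset.range N, ‖sy b k 0‖ ^ 2 ≤ if k = 0 then D ^ 2 else 0 := by
      intro k _
      split_ifs with hk
      · gcongr; exact hD k _
      · have := h k hk 0
        simp only [norm_zero, mul_zero] at this
        have h3 : ‖sy b k 0‖ = 0 := le_antisymm (by simpa [sy] using this) (norm_nonneg _)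
        simp [h3]
    refine (Finset.sum_le_sum h0).trans ?_
    rw [Finset.sum_ite_eq']
    split_ifs <;> nlinarith [sq_nonneg D, sq_nonneg E]
  · have hp : 0 < ‖ξ‖ := norm_pos_iff.2 hξ
    have h0 : ∀ k ∈ Finset.range N, ‖sy b k ξ‖ ^ 2 ≤ (if k = 0 then D ^ 2 else 0) + E ^ 2 * min (4 ^ k * (‖ξ‖ ^ 2)⁻¹) ((4 ^ k * (‖ξ‖ ^ 2)⁻¹)⁻¹) := by
      intro k _
      split_ifs with hk
      · have : ‖sy b k ξ‖ ^ 2 ≤ D ^ 2 := by gcongr; exact hD k _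
        have : 0 ≤ E ^ 2 * min (4 ^ k * (‖ξ‖ ^ 2)⁻¹) ((4 ^ k * (‖ξ‖ ^ 2)⁻¹)⁻¹) := by positivity
        linarith
      · rw [zero_add]
        refine (hpt k hk _ (smul_ne_zero (by positivity) hξ)).trans ?_
        have e : (‖((2:ℝ) ^ k)⁻¹ • ξ‖ ^ 2)⁻¹ = 4 ^ k * (‖ξ‖ ^ 2)⁻¹ := by
          rw [norm_smul, norm_inv, Real.norm_eq_abs, abs_of_pos (by positivity), mul_pow, mul_inv, inv_pow, inv_inv, ← pow_mul, mul_comm k 2, pow_mul]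
          norm_num
        rw [e]
    refine (Finset.sum_le_sum h0).trans ?_
    rw [Finset.sum_add_distrib, ← Finset.mul_sum, Finset.sum_ite_eq']
    have := minsum (x := 4) (by norm_num) N (t := (‖ξ‖ ^ 2)⁻¹) (by positivity)
    gcongr
    split_ifs <;> nlinarith [sq_nonneg D]

theorem fam_S {R : ℝ} {b : ℕ → E3 → ℂ} (hb : Prof R b) {C : ℝ} (h : ∀ k, k ≠ 0 → ∀ ζ, ‖b k ζ‖ ≤ C * ‖ζ‖)
    {q : ℝ≥0∞} (h1 : 1 < q) (ht : q < ⊤) :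
    ∃ C : ℝ≥0, ∀ N (f : E3 → ℂ), Adm f → LN q (fun x => sq N fun k => ‖cv (ker b k) f x‖ₑ) ≤ C * eLpNorm f q volume := by
  obtain ⟨A, hA⟩ := ker_good hb
  obtain ⟨A2, hA2, h2⟩ := sy_sq hb h
  exact S_bd hA hA2 (L2c_of hb hA2 h2) h1 ht

theorem fam_Sstar {R : ℝ} {b : ℕ → E3 → ℂ} (hb : Prof R b) {C : ℝ} (h : ∀ k, k ≠ 0 → ∀ ζ, ‖b k ζ‖ ≤ C * ‖ζ‖)
    {q : ℝ≥0∞} (h1 : 1 < q) (ht : q < ⊤) :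
    ∃ C : ℝ≥0, ∀ N (w : ℕ → E3 → ℂ), (∀ k, Adm (w k)) →
      eLpNorm (fun x => ∑ k ∈ Finset.range N, cv (ker b k) (w k) x) q volume ≤ C * LN q (fun x => sq N fun k => ‖w k x‖ₑ) := by
  obtain ⟨A, hA⟩ := ker_good hb
  obtain ⟨A2, hA2, h2⟩ := sy_sq hb h
  exact Sstar_bd hA hA2 (L2c_of hb hA2 h2).refl h1 ht

end KP

namespace KP

open Metric Set Filter
open scoped NNReal ContDiff SchwartzMap

/-- bump function -/
noncomputable def bmp : ContDiffBump (0 : E3) := ⟨1, 2, by norm_num, by norm_num⟩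

/-- low frequency cutoff -/
noncomputable def chi (ζ : E3) : ℂ := ((bmp ζ : ℝ) : ℂ)

lemma chi_smooth : ContDiff ℝ ∞ chi := Complex.ofRealCLM.contDiff.comp bmp.contDiff

lemma chi_one {ζ : E3} (h : ‖ζ‖ ≤ 1) : chi ζ = 1 := by
  rw [chi, bmp.one_of_mem_closedBall (by rw [mem_closedBall, dist_zero_right]; exact h)]; simp

lemma chi_zero {ζ : E3} (h : 2 ≤ ‖ζ‖) : chi ζ = 0 := by
  rw [chi, bmp.zero_of_le_dist (by rw [dist_zero_right]; exact h)]; simp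

lemma chi_norm (ζ : E3) : ‖chi ζ‖ ≤ 1 := by
  rw [chi, Complex.norm_real, Real.norm_eq_abs, abs_of_nonneg bmp.nonneg]; exact bmp.le_one

/-- rescaled cutoff -/
noncomputable def chiR (c : ℝ) (ζ : E3) : ℂ := chi (c • ζ)

lemma chiR_smooth (c : ℝ) : ContDiff ℝ ∞ (chiR c) := chi_smooth.comp (contDiff_const_smul c)

lemma chiR_one {c : ℝ} (hc : 0 < c) {ζ : E3} (h : c * ‖ζ‖ ≤ 1) : chiR c ζ = 1 :=
  chi_one (by rwa [norm_smul, Real.norm_eq_abs, abs_of_pos hc])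

lemma chiR_zero {c : ℝ} (hc : 0 < c) {ζ : E3} (h : 2 ≤ c * ‖ζ‖) : chiR c ζ = 0 :=
  chi_zero (by rwa [norm_smul, Real.norm_eq_abs, abs_of_pos hc])

/-- annular cutoff -/
noncomputable def psi (ζ : E3) : ℂ := chi ζ - chiR 2 ζ

lemma psi_smooth : ContDiff ℝ ∞ psi := chi_smooth.sub (chiR_smooth 2)

lemma psi_zero_in {ζ : E3} (h : ‖ζ‖ ≤ 1 / 2) : psi ζ = 0 := by
  rw [psi, chi_one (by linarith), chiR_one (by norm_num) (by linarith), sub_self]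

lemma psi_zero_out {ζ : E3} (h : 2 ≤ ‖ζ‖) : psi ζ = 0 := by
  rw [psi, chi_zero h, chiR_zero (by norm_num) (by linarith), sub_self]

/-- fat annular cutoff -/
noncomputable def fat (ζ : E3) : ℂ := chiR (1 / 32) ζ - chi ζ

lemma fat_smooth : ContDiff ℝ ∞ fat := (chiR_smooth _).sub chi_smooth

lemma fat_zero_in {ζ : E3} (h : ‖ζ‖ ≤ 1) : fat ζ = 0 := by
  rw [fat, chi_one h, chiR_one (by norm_num) (by linarith), sub_self]

lemma fat_zero_out {ζ : E3} (h : 64 ≤ ‖ζ‖) : fat ζ = 0 := by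
  rw [fat, chi_zero (by linarith), chiR_zero (by norm_num) (by linarith), sub_self]

lemma fat_one {ζ : E3} (h : 2 ≤ ‖ζ‖) (h' : ‖ζ‖ ≤ 32) : fat ζ = 1 := by
  rw [fat, chi_zero h, chiR_one (by norm_num) (by linarith), sub_zero]

/-- weight times annular cutoff -/
noncomputable def wt (t : ℝ) (η : E3 → ℂ) (p : ℝ × E3) : ℂ := (((p.1 ^ 2 + ‖p.2‖ ^ 2) ^ (t / 2) : ℝ) : ℂ) * η p.2

lemma wt_smooth (t : ℝ) {η : E3 → ℂ} (hη : ContDiff ℝ ∞ η) {r : ℝ} (hr : 0 < r) (h : ∀ ζ, ‖ζ‖ ≤ r → η ζ = 0) :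
    ContDiff ℝ ∞ (wt t η) := by
  rw [contDiff_iff_contDiffAt]
  intro p
  rcases lt_or_ge ‖p.2‖ r with hp | hp
  · have : wt t η =ᶠ[nhds p] fun _ => 0 := by
      have : {q : ℝ × E3 | ‖q.2‖ < r} ∈ nhds p := (isOpen_lt (by fun_prop) continuous_const).mem_nhds hp
      filter_upwards [this] with q hq
      rw [wt, h _ (le_of_lt hq), mul_zero]
    exact contDiffAt_const.congr_of_eventuallyEq this
  · refine ContDiffAt.mul ?_ (hη.contDiffAt.comp p contDiffAt_snd)
    refine Complex.ofRealCLM.contDiff.contDiffAt.comp p ?_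
    refine ContDiffAt.rpow_const_of_ne ?_ ?_
    · exact (contDiffAt_fst.pow 2).add (contDiffAt_snd.norm_sq ℝ)
    · have : 0 < ‖p.2‖ := hr.trans_le hp
      positivity

lemma eps_mem (k : ℕ) : ((2:ℝ) ^ k)⁻¹ ∈ Icc (0:ℝ) 1 := ⟨by positivity, inv_le_one_of_one_le₀ (one_le_pow₀ (by norm_num))⟩

/-- Littlewood-Paley profiles -/
noncomputable def pf (k : ℕ) (ζ : E3) : ℂ := if k = 0 then chi ζ else psi ζ

/-- weighted Littlewood-Paley profiles -/
noncomputable def Wp (t : ℝ) (k : ℕ) (ζ : E3) : ℂ := ((((((2:ℝ) ^ k)⁻¹) ^ 2 + ‖ζ‖ ^ 2) ^ (t / 2) : ℝ) : ℂ) * pf k ζ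

lemma bessel_smooth (t : ℝ) : ContDiff ℝ ∞ (fun ζ : E3 => (((1 + ‖ζ‖ ^ 2) ^ (t / 2) : ℝ) : ℂ)) := by
  refine Complex.ofRealCLM.contDiff.comp ?_
  refine ContDiff.rpow_const_of_ne (contDiff_const.add (contDiff_norm_sq ℝ)) fun x => by positivity

lemma Wp_prof (t : ℝ) : Prof 2 (Wp t) := by
  have h0 : Prof 2 (fun _ : ℕ => fun ζ : E3 => (((1 + ‖ζ‖ ^ 2) ^ (t / 2) : ℝ) : ℂ) * chi ζ) :=
    Prof.const ((bessel_smooth t).mul chi_smooth) fun ζ h => by rw [chi_zero h, mul_zero]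
  have h1 : Prof 2 (fun k ζ => wt t psi (((2:ℝ) ^ k)⁻¹, ζ)) :=
    Prof.of_joint (wt_smooth t psi_smooth (r := 1 / 2) (by norm_num) fun ζ h => psi_zero_in h)
      (fun e ζ h => by rw [wt, psi_zero_out h, mul_zero]) eps_mem
  have := h0.ite h1
  convert this using 2 with k
  ext ζ
  rw [Wp, pf]
  split_ifs with h
  · subst h; simp
  · rfl

lemma sy_Wp (t : ℝ) (k : ℕ) (ξ : E3) :
    sy (Wp t) k ξ = ((((2:ℝ) ^ k) ^ (-t) : ℝ) : ℂ) * (((1 + ‖ξ‖ ^ 2) ^ (t / 2) : ℝ) : ℂ) * sy pf k ξ := by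
  rw [sy, Wp, sy, ← Complex.ofReal_mul]
  congr 3
  rw [norm_smul, norm_inv, Real.norm_eq_abs, abs_of_pos (by positivity), mul_pow]
  have : ((2:ℝ) ^ k)⁻¹ ^ 2 + ((2:ℝ) ^ k)⁻¹ ^ 2 * ‖ξ‖ ^ 2 = ((2:ℝ) ^ k)⁻¹ ^ 2 * (1 + ‖ξ‖ ^ 2) := by ring
  rw [this, Real.mul_rpow (by positivity) (by positivity), ← Real.rpow_natCast, ← Real.rpow_mul (by positivity)]
  congr 1
  rw [Real.inv_rpow (by positivity), Real.rpow_neg (by positivity)]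
  congr 2
  push_cast; ring

lemma Wp_zero : Wp 0 = pf := by
  ext k ζ; simp [Wp]

lemma pf_prof : Prof 2 pf := Wp_zero ▸ Wp_prof 0

lemma Prof.lin {R : ℝ} {b : ℕ → E3 → ℂ} (hb : Prof R b) {r : ℝ} (hr : 0 < r) (h : ∀ k, k ≠ 0 → ∀ ζ, ‖ζ‖ ≤ r → b k ζ = 0) :
    ∃ C : ℝ, ∀ k, k ≠ 0 → ∀ ζ, ‖b k ζ‖ ≤ C * ‖ζ‖ := by
  obtain ⟨D, hD⟩ := hb.norm_bdd
  have hD0 : 0 ≤ D := (norm_nonneg _).trans (hD 0 0)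
  refine ⟨D / r, fun k hk ζ => ?_⟩
  rcases le_or_gt ‖ζ‖ r with h1 | h1
  · rw [h k hk ζ h1, norm_zero]; positivity
  · refine (hD k ζ).trans ?_
    rw [div_mul_eq_mul_div, le_div_iff₀ hr]
    gcongr

lemma Wp_lin (t : ℝ) : ∃ C : ℝ, ∀ k, k ≠ 0 → ∀ ζ, ‖Wp t k ζ‖ ≤ C * ‖ζ‖ :=
  (Wp_prof t).lin (r := 1 / 2) (by norm_num) fun k hk ζ h => by rw [Wp, pf, if_neg hk, psi_zero_in h, mul_zero]

/-- fat family -/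
noncomputable def ft (_ : ℕ) : E3 → ℂ := fat

lemma ft_prof : Prof 64 ft := Prof.const fat_smooth fun _ h => fat_zero_out h

lemma ft_lin : ∃ C : ℝ, ∀ k, k ≠ 0 → ∀ ζ, ‖ft k ζ‖ ≤ C * ‖ζ‖ :=
  ft_prof.lin (r := 1) (by norm_num) fun _ _ _ h => fat_zero_in h

/-- weighted fat family -/
noncomputable def Zp (t : ℝ) (k : ℕ) (ζ : E3) : ℂ := wt t fat (((2:ℝ) ^ k)⁻¹, ζ)

lemma Zp_prof (t : ℝ) : Prof 64 (Zp t) :=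
  Prof.of_joint (wt_smooth t fat_smooth (r := 1) (by norm_num) fun ζ h => fat_zero_in h)
    (fun e ζ h => by rw [wt, fat_zero_out h, mul_zero]) eps_mem

lemma sy_Zp (t : ℝ) (k : ℕ) (ξ : E3) :
    sy (Zp t) k ξ = ((((2:ℝ) ^ k) ^ (-t) : ℝ) : ℂ) * (((1 + ‖ξ‖ ^ 2) ^ (t / 2) : ℝ) : ℂ) * sy ft k ξ := by
  rw [sy, Zp, wt, sy, ft, ← Complex.ofReal_mul]
  congr 3
  simp only
  rw [norm_smul, norm_inv, Real.norm_eq_abs, abs_of_pos (by positivity), mul_pow]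
  have : ((2:ℝ) ^ k)⁻¹ ^ 2 + ((2:ℝ) ^ k)⁻¹ ^ 2 * ‖ξ‖ ^ 2 = ((2:ℝ) ^ k)⁻¹ ^ 2 * (1 + ‖ξ‖ ^ 2) := by ring
  rw [this, Real.mul_rpow (by positivity) (by positivity), ← Real.rpow_natCast, ← Real.rpow_mul (by positivity)]
  congr 1
  rw [Real.inv_rpow (by positivity), Real.rpow_neg (by positivity)]
  congr 2
  push_cast; ring

/-- low-pass family -/
noncomputable def lo (_ : ℕ) : E3 → ℂ := chi

lemma lo_prof : Prof 2 lo := Prof.const chi_smooth fun _ h => chi_zero h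

/-- derivative inverse family -/
noncomputable def Xp (l : Fin 3) (_ : ℕ) (ζ : E3) : ℂ := (2 * Real.pi * Complex.I)⁻¹ * ((ζ l : ℝ) : ℂ) * wt (-2) psi (0, ζ)

lemma coord_smooth (l : Fin 3) : ContDiff ℝ ∞ (fun ζ : E3 => ((ζ l : ℝ) : ℂ)) :=
  Complex.ofRealCLM.contDiff.comp (EuclideanSpace.proj l : E3 →L[ℝ] ℝ).contDiff

lemma Xp_prof (l : Fin 3) : Prof 2 (Xp l) := by
  refine Prof.const (η := fun ζ : E3 => (2 * Real.pi * Complex.I)⁻¹ * ((ζ l : ℝ) : ℂ) * wt (-2) psi (0, ζ)) ?_ ?_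
  · refine (contDiff_const.mul (coord_smooth l)).mul ?_
    exact (wt_smooth (-2) psi_smooth (r := 1 / 2) (by norm_num) fun ζ h => psi_zero_in h).comp (by fun_prop)
  · intro ζ h
    rw [wt, psi_zero_out h, mul_zero, mul_zero]

lemma Xp_lin (l : Fin 3) : ∃ C : ℝ, ∀ k, k ≠ 0 → ∀ ζ, ‖Xp l k ζ‖ ≤ C * ‖ζ‖ :=
  (Xp_prof l).lin (r := 1 / 2) (by norm_num) fun _ _ ζ h => by rw [Xp, wt, psi_zero_in h, mul_zero, mul_zero]

lemma sum_Xp (k : ℕ) (hk : k ≠ 0) (ξ : E3) :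
    ∑ l, sy (Xp l) k ξ * ((2 * Real.pi * Complex.I) * ((ξ l : ℝ) : ℂ)) = (2:ℂ) ^ k * sy pf k ξ := by
  set ζ : E3 := ((2:ℝ) ^ k)⁻¹ • ξ with hζ
  have hξ : ∀ l, ξ l = 2 ^ k * ζ l := fun l => by simp [hζ]
  have h0 : (2 * Real.pi * Complex.I : ℂ) ≠ 0 := by simp [Real.pi_ne_zero]
  have e : ∀ l, sy (Xp l) k ξ * ((2 * Real.pi * Complex.I) * ((ξ l : ℝ) : ℂ)) = 2 ^ k * wt (-2) psi (0, ζ) * (((ζ l) ^ 2 : ℝ) : ℂ) := by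
    intro l
    rw [sy, ← hζ, Xp, hξ]
    push_cast
    field_simp
  simp_rw [e, ← Finset.mul_sum, ← Complex.ofReal_sum]
  have h2 : ∑ i, ζ i ^ 2 = ‖ζ‖ ^ 2 := by rw [EuclideanSpace.norm_sq_eq]; simp
  rw [h2, mul_assoc]
  congr 1
  rw [sy, ← hζ, pf, if_neg hk, wt]
  rcases le_or_gt ‖ζ‖ (1 / 2) with h | h
  · rw [psi_zero_in h]; simp
  · have : ‖ζ‖ ≠ 0 := by linarith
    have h3 : (((0:ℝ) ^ 2 + ‖ζ‖ ^ 2) ^ ((-2:ℝ) / 2)) * ‖ζ‖ ^ 2 = 1 := by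
      norm_num
      rw [Real.rpow_neg_one]
      field_simp
    simp only
    rw [mul_right_comm, ← Complex.ofReal_mul, h3]; simp

/-- derivative family -/
noncomputable def Yp (l : Fin 3) (_ : ℕ) (ζ : E3) : ℂ := (2 * Real.pi * Complex.I) * ((ζ l : ℝ) : ℂ) * chiR (1 / 2) ζ

lemma Yp_prof (l : Fin 3) : Prof 4 (Yp l) :=
  Prof.const ((contDiff_const.mul (coord_smooth l)).mul (chiR_smooth _)) fun ζ h => by
    rw [chiR_zero (by norm_num) (by linarith), mul_zero]

lemma Yp_lin (l : Fin 3) : ∃ C : ℝ, ∀ k, k ≠ 0 → ∀ ζ, ‖Yp l k ζ‖ ≤ C * ‖ζ‖ := by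
  refine ⟨2 * Real.pi, fun k _ ζ => ?_⟩
  rw [Yp, norm_mul, norm_mul]
  have h1 : ‖(2 * Real.pi * Complex.I : ℂ)‖ = 2 * Real.pi := by
    simp [abs_of_pos Real.pi_pos]
  have h2 : ‖((ζ l : ℝ) : ℂ)‖ ≤ ‖ζ‖ := by
    rw [Complex.norm_real]; exact PiLp.norm_apply_le ζ l
  rw [h1]
  have := Real.pi_pos
  calc _ ≤ 2 * Real.pi * ‖ζ‖ * 1 := by gcongr; exact chi_norm _
    _ = _ := mul_one _

/-- summing up -/
lemma sum_pf (N : ℕ) (ξ : E3) : ∑ k ∈ Finset.range (N + 1), sy pf k ξ = sy lo N ξ := by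
  induction N with
  | zero => simp [sy, pf, lo]
  | succ n ih =>
    rw [Finset.sum_range_succ, ih]
    simp only [sy, pf, lo, psi, chiR]
    rw [if_neg (by omega), smul_smul]
    have : (2:ℝ) * ((2:ℝ) ^ (n + 1))⁻¹ = ((2:ℝ) ^ n)⁻¹ := by rw [pow_succ]; field_simp
    rw [this]; ring

end KP

namespace KP

open Metric Set Filter
open scoped NNReal ContDiff SchwartzMap LineDeriv

lemma S_ext {u v : 𝓢(E3, ℂ)} (h : ∀ ξ, 𝓕 u ξ = 𝓕 v ξ) : u = v := by
  have : 𝓕 u = 𝓕 v := by ext ξ; exact h ξ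
  have := congrArg (fun w : 𝓢(E3, ℂ) => (𝓕⁻ w : 𝓢(E3, ℂ))) this
  simpa only [fourierInv_fourier_eq] using this

/-- Bessel symbol -/
noncomputable def J (s : ℝ) (ξ : E3) : ℂ := (((1 + ‖ξ‖ ^ 2) ^ (s / 2) : ℝ) : ℂ)

lemma J_temp (s : ℝ) : (J s).HasTemperateGrowth :=
  Function.HasTemperateGrowth.comp Complex.ofRealCLM.hasTemperateGrowth (Function.hasTemperateGrowth_one_add_norm_sq_rpow E3 (s / 2))

lemma J_add (s t : ℝ) (ξ : E3) : J (s + t) ξ = J s ξ * J t ξ := by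
  rw [J, J, J, ← Complex.ofReal_mul, ← Real.rpow_add (by positivity), add_div]

lemma J_zero (ξ : E3) : J 0 ξ = 1 := by simp [J]

/-- Bessel operator -/
noncomputable def Lm (s : ℝ) : 𝓢(E3, ℂ) →L[ℂ] 𝓢(E3, ℂ) := op (J s)

lemma F_Lm (s : ℝ) (u : 𝓢(E3, ℂ)) (ξ : E3) : 𝓕 (Lm s u) ξ = J s ξ * 𝓕 u ξ := F_op (J_temp s) u ξ

lemma Lam_eq (s : ℝ) (u : 𝓢(E3, ℂ)) : Lam s u = Lm s u := by
  rw [Lm, op_apply, SchwartzMap.fourierInv_coe, Lam]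
  congr 1; ext ξ
  rw [SchwartzMap.smulLeftCLM_apply_apply (J_temp s), smul_eq_mul]
  rfl

lemma Lm_zero (u : 𝓢(E3, ℂ)) : Lm 0 u = u := S_ext fun ξ => by rw [F_Lm, J_zero, one_mul]

/-- product of Schwartz functions -/
noncomputable def mulS (u v : 𝓢(E3, ℂ)) : 𝓢(E3, ℂ) := SchwartzMap.pairing (ContinuousLinearMap.mul ℂ ℂ) u v

lemma mulS_apply (u v : 𝓢(E3, ℂ)) (x : E3) : mulS u v x = u x * v x := rfl

lemma mulS_coe (u v : 𝓢(E3, ℂ)) : (mulS u v : E3 → ℂ) = fun x => u x * v x := rfl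

lemma mulS_comm (u v : 𝓢(E3, ℂ)) : mulS u v = mulS v u := by
  ext x; simp [mulS_apply, mul_comm]

lemma F_mul (u v : 𝓢(E3, ℂ)) (ξ : E3) : 𝓕 (mulS u v) ξ = ∫ η, 𝓕 u (ξ - η) * 𝓕 v η := by
  set w : 𝓢(E3, ℂ) := SchwartzMap.convolution (ContinuousLinearMap.mul ℂ ℂ) (𝓕 u) (𝓕 v) with hw
  have hinv : ∀ (u : 𝓢(E3, ℂ)) x, (𝓕⁻ u : 𝓢(E3, ℂ)) x = (𝓕 u : 𝓢(E3, ℂ)) (-x) := by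
    intro u x
    rw [SchwartzMap.fourierInv_coe, SchwartzMap.fourier_coe, Real.fourierInv_eq_fourier_neg]
  have h1 : 𝓕⁻ w = mulS u v := by
    ext x
    rw [hinv, hw, SchwartzMap.fourier_convolution, SchwartzMap.pairing_apply_apply, ← hinv, ← hinv, fourierInv_fourier_eq, fourierInv_fourier_eq]
    rfl
  rw [← h1, fourier_fourierInv_eq, hw, SchwartzMap.convolution_apply]
  rw [convolution_eq_swap]
  rfl

lemma F_mul_ne {u v : 𝓢(E3, ℂ)} {ξ : E3} (h : 𝓕 (mulS u v) ξ ≠ 0) : ∃ η, 𝓕 u (ξ - η) ≠ 0 ∧ 𝓕 v η ≠ 0 := by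
  by_contra! hc
  apply h
  rw [F_mul]
  have : ∀ η, 𝓕 u (ξ - η) * 𝓕 v η = 0 := fun η => by
    by_cases h1 : 𝓕 u (ξ - η) = 0
    · simp [h1]
    · simp [hc η h1]
  simp [this]

lemma F_dl (m : E3) (u : 𝓢(E3, ℂ)) (ξ : E3) : 𝓕 (∂_{m} u) ξ = (2 * Real.pi * Complex.I) * ((inner ℝ ξ m : ℝ) : ℂ) * 𝓕 u ξ := by
  rw [SchwartzMap.fourier_lineDerivOp_eq]
  have : (fun ξ : E3 => (inner ℝ ξ m : ℝ)).HasTemperateGrowth := ((innerSL ℝ).flip m).hasTemperateGrowth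
  rw [SchwartzMap.smul_apply, SchwartzMap.smulLeftCLM_apply_apply this, Complex.real_smul, smul_eq_mul]
  ring

lemma dl_apply (m : E3) (u : 𝓢(E3, ℂ)) (x : E3) : (∂_{m} u) x = fderiv ℝ u x m := rfl

lemma F_add (u v : 𝓢(E3, ℂ)) (ξ : E3) : 𝓕 (u + v) ξ = 𝓕 u ξ + 𝓕 v ξ := by
  rw [FourierTransform.fourier_add]; rfl

lemma F_smul (c : ℂ) (u : 𝓢(E3, ℂ)) (ξ : E3) : 𝓕 (c • u) ξ = c * 𝓕 u ξ := by
  rw [FourierTransform.fourier_smul]; rfl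

lemma F_sum {ι : Type} (t : Finset ι) (u : ι → 𝓢(E3, ℂ)) (ξ : E3) : 𝓕 (∑ i ∈ t, u i) ξ = ∑ i ∈ t, 𝓕 (u i) ξ := by
  have h : 𝓕 (∑ i ∈ t, u i) = ∑ i ∈ t, 𝓕 (u i) := map_sum (fourierCLM ℂ 𝓢(E3, ℂ)) u t
  rw [h, SchwartzMap.sum_apply]

/-- Littlewood-Paley pieces -/
noncomputable def Pk (k : ℕ) : 𝓢(E3, ℂ) →L[ℂ] 𝓢(E3, ℂ) := op (sy pf k)

/-- low-pass pieces -/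
noncomputable def Lo (k : ℕ) : 𝓢(E3, ℂ) →L[ℂ] 𝓢(E3, ℂ) := op (sy lo k)

lemma F_Pk (k : ℕ) (u : 𝓢(E3, ℂ)) (ξ : E3) : 𝓕 (Pk k u) ξ = sy pf k ξ * 𝓕 u ξ := F_op (sy_temp pf_prof k) u ξ

lemma F_Lo (k : ℕ) (u : 𝓢(E3, ℂ)) (ξ : E3) : 𝓕 (Lo k u) ξ = sy lo k ξ * 𝓕 u ξ := F_op (sy_temp lo_prof k) u ξ

lemma Lo_sum (k : ℕ) (u : 𝓢(E3, ℂ)) : Lo k u = ∑ j ∈ Finset.range (k + 1), Pk j u := S_ext fun ξ => by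
  rw [F_Lo, F_sum]
  simp_rw [F_Pk]
  rw [← Finset.sum_mul, sum_pf]

lemma Lo_succ (k : ℕ) (u : 𝓢(E3, ℂ)) : Lo (k + 1) u = Lo k u + Pk (k + 1) u := by
  rw [Lo_sum, Finset.sum_range_succ, ← Lo_sum]

lemma Lo_zero (u : 𝓢(E3, ℂ)) : Lo 0 u = Pk 0 u := by
  rw [Lo_sum, Finset.sum_range_one]

lemma piece_S (a t : ℝ) (k : ℕ) (u : 𝓢(E3, ℂ)) :
    Lm a (Pk k u) = ((((2:ℝ) ^ k) ^ t : ℝ) : ℂ) • op (sy (Wp t) k) (Lm (a - t) u) := S_ext fun ξ => by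
  rw [F_smul, F_op (sy_temp (Wp_prof t) k), F_Lm, F_Lm, F_Pk, sy_Wp]
  have h1 : J a ξ = J t ξ * J (a - t) ξ := by rw [← J_add]; congr 1; ring
  have h2 : ((((2:ℝ) ^ k) ^ t : ℝ) : ℂ) * ((((2:ℝ) ^ k) ^ (-t) : ℝ) : ℂ) = 1 := by
    rw [← Complex.ofReal_mul, ← Real.rpow_add (by positivity)]; simp
  rw [h1]
  calc _ = 1 * (J t ξ * sy pf k ξ * (J (a - t) ξ * 𝓕 u ξ)) := by ring
    _ = _ := by rw [← h2]; simp only [J]; ring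

lemma piece (a t : ℝ) (k : ℕ) (u : 𝓢(E3, ℂ)) (x : E3) :
    Lm a (Pk k u) x = ((((2:ℝ) ^ k) ^ t : ℝ) : ℂ) * cv (ker (Wp t) k) (Lm (a - t) u) x := by
  rw [piece_S a t, SchwartzMap.smul_apply, op_cv (Wp_prof t), smul_eq_mul]

lemma piece0 (t : ℝ) (k : ℕ) (u : 𝓢(E3, ℂ)) (x : E3) :
    Pk k u x = ((((2:ℝ) ^ k) ^ t : ℝ) : ℂ) * cv (ker (Wp t) k) (Lm (- t) u) x := by
  have := piece 0 t k u x
  rwa [Lm_zero, zero_sub] at this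

/-- coordinate vectors -/
noncomputable def ev (l : Fin 3) : E3 := EuclideanSpace.single l 1

lemma inner_ev (ξ : E3) (l : Fin 3) : (inner ℝ ξ (ev l) : ℝ) = ξ l := by
  simp [ev, EuclideanSpace.inner_single_right]

lemma piece_X (k : ℕ) (hk : k ≠ 0) (u : 𝓢(E3, ℂ)) (x : E3) :
    (2:ℂ) ^ k * Pk k u x = ∑ l, cv (ker (Xp l) k) (⇑(∂_{ev l} u : 𝓢(E3, ℂ))) x := by
  have h : (2:ℂ) ^ k • Pk k u = ∑ l, op (sy (Xp l) k) (∂_{ev l} u) := S_ext fun ξ => by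
    rw [F_smul, F_sum, F_Pk, ← mul_assoc, ← sum_Xp k hk, Finset.sum_mul]
    refine Finset.sum_congr rfl fun l _ => ?_
    rw [F_op (sy_temp (Xp_prof l) k), F_dl, inner_ev, mul_assoc]
  have := congrArg (fun w : 𝓢(E3, ℂ) => w x) h
  simp only [SchwartzMap.sum_apply] at this
  rw [SchwartzMap.smul_apply, smul_eq_mul] at this
  rw [this]
  exact Finset.sum_congr rfl fun l _ => op_cv (Xp_prof l) k _ x

lemma dl_Pk (l : Fin 3) (k : ℕ) (u : 𝓢(E3, ℂ)) : ∂_{ev l} (Pk k u) = op (sy (Yp l) k) ((2:ℂ) ^ k • Pk k u) := S_ext fun ξ => by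
  rw [F_dl, F_op (sy_temp (Yp_prof l) k), F_smul, inner_ev, F_Pk]
  by_cases h : 2 ^ k * 2 ≤ ‖ξ‖
  · rw [sy_supp pf_prof k ξ h]; ring
  · rw [not_le] at h
    have h1 : sy (Yp l) k ξ = (2 * Real.pi * Complex.I) * (((((2:ℝ) ^ k)⁻¹ * ξ l) : ℝ) : ℂ) := by
      rw [sy, Yp, chiR_one (by norm_num), mul_one]
      · simp
      · rw [norm_smul, norm_inv, Real.norm_eq_abs, abs_of_pos (by positivity)]
        have : ((2:ℝ) ^ k)⁻¹ * ‖ξ‖ ≤ 2 := by rw [inv_mul_le_iff₀ (by positivity)]; exact h.le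
        linarith
    rw [h1]
    push_cast
    field_simp

lemma dl_Lo (m : E3) (k : ℕ) (u : 𝓢(E3, ℂ)) : ∂_{m} (Lo k u) = Lo k (∂_{m} u) := S_ext fun ξ => by
  rw [F_dl, F_Lo, F_Lo, F_dl]; ring

lemma Lm_Lo (s : ℝ) (k : ℕ) (u : 𝓢(E3, ℂ)) : Lm s (Lo k u) = ∑ j ∈ Finset.range (k + 1), Lm s (Pk j u) := by
  rw [Lo_sum, map_sum]

lemma Lo_cv (k : ℕ) (u : 𝓢(E3, ℂ)) (x : E3) : Lo k u x = cv (ker lo k) u x := op_cv lo_prof k u x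

/-- frequency support in balls -/
def FSb (k : ℕ) (u : 𝓢(E3, ℂ)) : Prop := ∀ ξ, 𝓕 u ξ ≠ 0 → ‖ξ‖ ≤ 2 ^ k * 2

/-- frequency support in annuli -/
def FSa (k : ℕ) (u : 𝓢(E3, ℂ)) : Prop := ∀ ξ, 𝓕 u ξ ≠ 0 → 2 ^ k * 4 ≤ ‖ξ‖ ∧ ‖ξ‖ ≤ 2 ^ k * 16

lemma FSb_Lo (k : ℕ) (u : 𝓢(E3, ℂ)) : FSb k (Lo k u) := by
  intro ξ h
  by_contra hc
  exact h (by rw [F_Lo, sy_supp lo_prof k ξ (not_le.1 hc).le, zero_mul])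

lemma FSb_Pk (k : ℕ) (u : 𝓢(E3, ℂ)) : FSb k (Pk k u) := by
  intro ξ h
  by_contra hc
  exact h (by rw [F_Pk, sy_supp pf_prof k ξ (not_le.1 hc).le, zero_mul])

lemma FSb_Lm {k : ℕ} {u : 𝓢(E3, ℂ)} (h : FSb k u) (s : ℝ) : FSb k (Lm s u) := fun ξ hξ =>
  h ξ fun h0 => hξ (by rw [F_Lm, h0, mul_zero])

lemma FSa_Pk (k : ℕ) (u : 𝓢(E3, ℂ)) : FSa k (Pk (k + 3) u) := by
  intro ξ h
  constructor
  · by_contra hc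
    rw [not_le] at hc
    apply h
    rw [F_Pk, sy, pf, if_neg (by omega), psi_zero_in, zero_mul]
    rw [norm_smul, norm_inv, Real.norm_eq_abs, abs_of_pos (by positivity), inv_mul_le_iff₀ (by positivity), pow_add]
    linarith
  · have := FSb_Pk (k + 3) u ξ h
    rw [pow_add] at this
    linarith

lemma ft_one {k : ℕ} {ξ : E3} (h : 2 ^ k * 2 ≤ ‖ξ‖) (h' : ‖ξ‖ ≤ 2 ^ k * 32) : sy ft k ξ = 1 := by
  rw [sy, ft]
  have e : ‖((2:ℝ) ^ k)⁻¹ • ξ‖ = ((2:ℝ) ^ k)⁻¹ * ‖ξ‖ := by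
    rw [norm_smul, norm_inv, Real.norm_eq_abs, abs_of_pos (by positivity)]
  refine fat_one ?_ ?_
  · rw [e, inv_mul_eq_div, le_div_iff₀ (by positivity)]; linarith
  · rw [e, inv_mul_le_iff₀ (by positivity)]; exact h'

def FSf (k : ℕ) (w : 𝓢(E3, ℂ)) : Prop := ∀ ξ, 𝓕 w ξ ≠ 0 → sy ft k ξ = 1

lemma FSa.fat {k : ℕ} {u : 𝓢(E3, ℂ)} (h : FSa k u) : FSf k u := fun ξ hξ => by
  have := h ξ hξ
  have h2 : (0:ℝ) < 2 ^ k := by positivity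
  exact ft_one (by linarith) (by linarith)

lemma FSf_mul {k : ℕ} {u h : 𝓢(E3, ℂ)} (hu : FSb k u) (hh : FSa k h) : FSf k (mulS u h) := by
  intro ξ hξ
  obtain ⟨η, h1, h2⟩ := F_mul_ne hξ
  have h1 := hu _ h1
  have h2 := hh _ h2
  have h3 : (0:ℝ) < 2 ^ k := by positivity
  have h4 : ‖η‖ ≤ ‖ξ‖ + ‖ξ - η‖ := by
    have := norm_sub_le ξ (ξ - η)
    rwa [sub_sub_cancel] at this
  have h5 : ‖ξ‖ ≤ ‖ξ - η‖ + ‖η‖ := by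
    have := norm_add_le (ξ - η) η
    rwa [sub_add_cancel] at this
  exact ft_one (by linarith) (by linarith)

lemma FSf.fix {k : ℕ} {w : 𝓢(E3, ℂ)} (h : FSf k w) (x : E3) : cv (ker ft k) w x = w x := by
  rw [← op_cv ft_prof]
  congr 1
  refine S_ext fun ξ => ?_
  rw [F_op (sy_temp ft_prof k)]
  by_cases h0 : 𝓕 w ξ = 0
  · simp [h0]
  · rw [h ξ h0, one_mul]

lemma FSf.Lm {k : ℕ} {w : 𝓢(E3, ℂ)} (h : FSf k w) (s : ℝ) : FSf k (Lm s w) := fun ξ hξ =>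
  h ξ fun h0 => hξ (by rw [F_Lm, h0, mul_zero])

lemma FSf.sub {k : ℕ} {w v : 𝓢(E3, ℂ)} (h : FSf k w) (h' : FSf k v) : FSf k (w - v) := fun ξ hξ => by
  by_cases h0 : 𝓕 w ξ = 0
  · by_cases h1 : 𝓕 v ξ = 0
    · exfalso; apply hξ
      have : w - v = w + (-1:ℂ) • v := by simp [sub_eq_add_neg]
      rw [this, F_add, F_smul, h0, h1]; simp
    · exact h' ξ h1
  · exact h ξ h0

lemma FSf.Z {k : ℕ} {w : 𝓢(E3, ℂ)} (h : FSf k w) (s : ℝ) (x : E3) :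
    KP.Lm s w x = ((((2:ℝ) ^ k) ^ s : ℝ) : ℂ) * cv (ker (Zp s) k) w x := by
  have : KP.Lm s w = ((((2:ℝ) ^ k) ^ s : ℝ) : ℂ) • op (sy (Zp s) k) w := S_ext fun ξ => by
    rw [F_smul, F_op (sy_temp (Zp_prof s) k), F_Lm, sy_Zp]
    by_cases h0 : 𝓕 w ξ = 0
    · simp [h0]
    · rw [h ξ h0]
      have h2 : ((((2:ℝ) ^ k) ^ s : ℝ) : ℂ) * ((((2:ℝ) ^ k) ^ (-s) : ℝ) : ℂ) = 1 := by
        rw [← Complex.ofReal_mul, ← Real.rpow_add (by positivity)]; simp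
      calc _ = 1 * (J s ξ * 𝓕 w ξ) := by ring
        _ = (((((2:ℝ) ^ k) ^ s : ℝ) : ℂ) * ((((2:ℝ) ^ k) ^ (-s) : ℝ) : ℂ)) * (J s ξ * 𝓕 w ξ) := by rw [h2]
        _ = _ := by simp only [J]; ring
  rw [this, SchwartzMap.smul_apply, op_cv (Zp_prof s), smul_eq_mul]

/-- products of a piece with a low-pass part -/
lemma Lo_fix (j : ℕ) (f g : 𝓢(E3, ℂ)) : Lo (j + 4) (mulS (Pk j f) (Lo (j + 2) g)) = mulS (Pk j f) (Lo (j + 2) g) := by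
  refine S_ext fun ξ => ?_
  rw [F_Lo]
  by_cases h0 : 𝓕 (mulS (Pk j f) (Lo (j + 2) g)) ξ = 0
  · simp [h0]
  · obtain ⟨η, h1, h2⟩ := F_mul_ne h0
    have h1 := FSb_Pk _ _ _ h1
    have h2 := FSb_Lo _ _ _ h2
    have h5 : ‖ξ‖ ≤ ‖ξ - η‖ + ‖η‖ := by
      have := norm_add_le (ξ - η) η
      rwa [sub_add_cancel] at this
    have : sy lo (j + 4) ξ = 1 := by
      refine chi_one ?_
      rw [norm_smul, norm_inv, Real.norm_eq_abs, abs_of_pos (by positivity), inv_mul_le_iff₀ (by positivity)]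
      rw [pow_add] at h2 ⊢
      have h3 : (0:ℝ) < 2 ^ j := by positivity
      linarith
    rw [this, one_mul]

/-- the commutator -/
noncomputable def LL (s : ℝ) (f g : 𝓢(E3, ℂ)) : 𝓢(E3, ℂ) := Lm s (mulS f g) - mulS f (Lm s g)

lemma LL_add_left (s : ℝ) (f f' g : 𝓢(E3, ℂ)) : LL s (f + f') g = LL s f g + LL s f' g := by
  simp only [LL, mulS, map_add, ContinuousLinearMap.add_apply, LinearMap.add_apply]; abel

lemma LL_add_right (s : ℝ) (f g g' : 𝓢(E3, ℂ)) : LL s f (g + g') = LL s f g + LL s f g' := by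
  simp only [LL, mulS, map_add]; abel

lemma decomp (s : ℝ) (f g : 𝓢(E3, ℂ)) (N : ℕ) : LL s (Lo N f) (Lo (N + 2) g) =
    ∑ k ∈ Finset.range N, LL s (Lo k f) (Pk (k + 3) g) + ∑ j ∈ Finset.range (N + 1), LL s (Pk j f) (Lo (j + 2) g) := by
  induction N with
  | zero => simp [Lo_zero]
  | succ n ih =>
    have e : Lo (n + 1 + 2) g = Lo (n + 2) g + Pk (n + 3) g := Lo_succ (n + 2) g
    rw [Lo_succ n f, LL_add_left, Finset.sum_range_succ, Finset.sum_range_succ _ (n + 1)]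
    nth_rewrite 1 [e]
    rw [LL_add_right, ih]
    abel

end KP

namespace KP

open Metric Set Filter Topology
open scoped NNReal ContDiff SchwartzMap LineDeriv

lemma rep (u : 𝓢(E3, ℂ)) (x : E3) : u x = ∫ ξ, Real.fourierChar (inner ℝ ξ x) • 𝓕 u ξ := by
  have h : u x = (𝓕⁻ (𝓕 u) : 𝓢(E3, ℂ)) x := by rw [fourierInv_fourier_eq]
  rw [h, SchwartzMap.fourierInv_coe, Real.fourierInv_eq]

lemma lim1 {U : ℕ → 𝓢(E3, ℂ)} {u : 𝓢(E3, ℂ)} {B : E3 → ℝ} (hB : Integrable B) (hb : ∀ N ξ, ‖𝓕 (U N) ξ‖ ≤ B ξ)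
    (h : ∀ ξ, Tendsto (fun N => 𝓕 (U N) ξ) atTop (𝓝 (𝓕 u ξ))) (x : E3) : Tendsto (fun N => U N x) atTop (𝓝 (u x)) := by
  simp_rw [rep _ x]
  refine tendsto_integral_of_dominated_convergence B ?_ hB ?_ ?_
  · intro N
    have h1 : Continuous fun ξ : E3 => Real.fourierChar (inner ℝ ξ x) := by
      refine Real.continuous_fourierChar.comp ?_
      fun_prop
    exact (Continuous.smul h1 (𝓕 (U N)).continuous).aestronglyMeasurable
  · intro N
    filter_upwards with ξ
    rw [Circle.norm_smul]; exact hb N ξ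
  · filter_upwards with ξ
    exact (h ξ).const_smul _

lemma lo_norm (N : ℕ) (ξ : E3) : ‖sy lo N ξ‖ ≤ 1 := chi_norm _

lemma lo_lim (ξ : E3) : ∀ᶠ N in atTop, sy lo N ξ = 1 := by
  have : Tendsto (fun N : ℕ => (2:ℝ) ^ N) atTop atTop := tendsto_pow_atTop_atTop_of_one_lt (by norm_num)
  filter_upwards [this.eventually_ge_atTop ‖ξ‖] with N hN
  refine chi_one ?_
  rw [norm_smul, norm_inv, Real.norm_eq_abs, abs_of_pos (by positivity), inv_mul_le_iff₀ (by positivity)]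
  linarith

lemma Lo_lim (u : 𝓢(E3, ℂ)) (x : E3) : Tendsto (fun N => Lo N u x) atTop (𝓝 (u x)) := by
  refine lim1 (adm_S (𝓕 u)).int.norm (fun N ξ => ?_) (fun ξ => ?_) x
  · rw [F_Lo, norm_mul]
    have := lo_norm N ξ
    exact mul_le_of_le_one_left (norm_nonneg _) this
  · refine tendsto_const_nhds.congr' ?_
    filter_upwards [lo_lim ξ] with N hN
    rw [F_Lo, hN, one_mul]

lemma Lm_Lo_comm (s : ℝ) (k : ℕ) (u : 𝓢(E3, ℂ)) : Lm s (Lo k u) = Lo k (Lm s u) := S_ext fun ξ => by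
  rw [F_Lo, F_Lm, F_Lm, F_Lo]; ring

lemma J_norm (s : ℝ) (ξ : E3) : ‖J s ξ‖ = (1 + ‖ξ‖ ^ 2) ^ (s / 2) := by
  rw [J, Complex.norm_real, Real.norm_of_nonneg (by positivity)]

lemma peetre {s : ℝ} (hs : 0 < s) (ξ η : E3) : ‖J s ξ‖ ≤ 2 ^ (s / 2) * (‖J s (ξ - η)‖ * ‖J s η‖) := by
  rw [J_norm, J_norm, J_norm, ← Real.mul_rpow (by positivity) (by positivity), ← Real.mul_rpow (by positivity) (by positivity)]
  refine Real.rpow_le_rpow (by positivity) ?_ (by positivity)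
  have h5 : ‖ξ‖ ≤ ‖ξ - η‖ + ‖η‖ := by
    have := norm_add_le (ξ - η) η
    rwa [sub_add_cancel] at this
  have := norm_nonneg ξ
  have : ‖ξ‖ ^ 2 ≤ (‖ξ - η‖ + ‖η‖) ^ 2 := by gcongr
  nlinarith [sq_nonneg (‖ξ - η‖ - ‖η‖), mul_nonneg (sq_nonneg ‖ξ - η‖) (sq_nonneg ‖η‖)]

lemma prod_int (u v : 𝓢(E3, ℂ)) (ξ : E3) : Integrable fun η => ‖u (ξ - η)‖ * ‖v η‖ := by
  obtain ⟨M, hM⟩ := (adm_S u).bdd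
  refine Integrable.bdd_mul (c := M) (adm_S v).int.norm ?_ ?_
  · have := u.continuous
    exact (by fun_prop : Continuous fun η => ‖u (ξ - η)‖).aestronglyMeasurable
  · filter_upwards with η
    rw [norm_norm]; exact hM _

lemma LL_lim {s : ℝ} (hs : 0 < s) (f g : 𝓢(E3, ℂ)) (x : E3) :
    Tendsto (fun N => LL s (Lo N f) (Lo (N + 2) g) x) atTop (𝓝 (LL s f g x)) := by
  have e : ∀ f g : 𝓢(E3, ℂ), LL s f g x = Lm s (mulS f g) x - f x * Lm s g x := fun f g => rfl
  simp_rw [e]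
  refine Tendsto.sub ?_ (Tendsto.mul (Lo_lim f x) ?_)
  · have hc : Integrable (fun ξ => ∫ η, ‖𝓕 (Lm s f) (ξ - η)‖ * ‖𝓕 (Lm s g) η‖) := by
      have := ((adm_S (𝓕 (Lm s g))).int.norm.integrable_convolution (ContinuousLinearMap.mul ℝ ℝ) (adm_S (𝓕 (Lm s f))).int.norm (μ := volume))
      refine this.congr ?_
      filter_upwards with ξ
      rw [convolution_def]
      refine integral_congr_ae ?_
      filter_upwards with η
      simp [mul_comm]
    have h1 : ∀ (N : ℕ) (ξ η : E3), ‖𝓕 (Lo N f) (ξ - η) * 𝓕 (Lo (N + 2) g) η‖ ≤ ‖𝓕 f (ξ - η)‖ * ‖𝓕 g η‖ := by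
      intro N ξ η
      rw [norm_mul, F_Lo, F_Lo, norm_mul, norm_mul]
      have h1 := mul_le_of_le_one_left (norm_nonneg (𝓕 f (ξ - η))) (lo_norm N (ξ - η))
      have h2 := mul_le_of_le_one_left (norm_nonneg (𝓕 g η)) (lo_norm (N + 2) η)
      gcongr
    refine lim1 (hc.const_mul (2 ^ (s / 2))) (fun N ξ => ?_) (fun ξ => ?_) x
    · rw [F_Lm, F_mul, norm_mul, ← integral_const_mul]
      calc _ ≤ ‖J s ξ‖ * ∫ η, ‖𝓕 f (ξ - η)‖ * ‖𝓕 g η‖ := by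
            gcongr
            exact norm_integral_le_of_norm_le (prod_int _ _ ξ) (by filter_upwards with η; exact h1 N ξ η)
        _ = ∫ η, ‖J s ξ‖ * (‖𝓕 f (ξ - η)‖ * ‖𝓕 g η‖) := by rw [integral_const_mul]
        _ ≤ _ := by
            refine integral_mono ((prod_int _ _ ξ).const_mul _) ((prod_int _ _ ξ).const_mul _) fun η => ?_
            simp only [F_Lm, norm_mul]
            have := mul_le_mul_of_nonneg_right (peetre hs ξ η) (by positivity : 0 ≤ ‖𝓕 f (ξ - η)‖ * ‖𝓕 g η‖)
            refine this.trans (le_of_eq ?_)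
            ring
    · simp_rw [F_Lm, F_mul]
      refine Tendsto.const_mul _ ?_
      refine tendsto_integral_of_dominated_convergence _ ?_ (prod_int _ _ ξ) (fun N => by filter_upwards with η; exact h1 N ξ η) ?_
      · intro N
        have h1 := (𝓕 (Lo N f)).continuous
        have h2 := (𝓕 (Lo (N + 2) g)).continuous
        exact (by fun_prop : Continuous fun η => 𝓕 (Lo N f) (ξ - η) * 𝓕 (Lo (N + 2) g) η).aestronglyMeasurable
      · filter_upwards with η
        refine tendsto_const_nhds.congr' ?_
        filter_upwards [lo_lim (ξ - η), (tendsto_add_atTop_nat 2).eventually (lo_lim η)] with N hN h2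
        rw [F_Lo, F_Lo, hN, h2, one_mul, one_mul]
  · simp_rw [Lm_Lo_comm]
    exact (Lo_lim _ x).comp (tendsto_add_atTop_nat 2)

/-- reduction to frequency-truncated functions -/
lemma reduce {s : ℝ} (hs : 0 < s) {p B : ℝ≥0∞} (f g : 𝓢(E3, ℂ))
    (h : ∀ N, eLpNorm (LL s (Lo N f) (Lo (N + 2) g)) p volume ≤ B) : eLpNorm (LL s f g) p volume ≤ B := by
  refine (Lp.eLpNorm_lim_le_liminf_eLpNorm (fun N => (adm_S (LL s (Lo N f) (Lo (N + 2) g))).meas.aestronglyMeasurable) _ ?_).trans ?_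
  · filter_upwards with x
    exact LL_lim hs f g x
  · refine (liminf_le_liminf (Eventually.of_forall h)).trans ?_
    simp

end KP

namespace KP

open Metric Set Filter Topology
open scoped NNReal ContDiff SchwartzMap LineDeriv

/-- gradient -/
noncomputable def Gd (f : 𝓢(E3, ℂ)) (x : E3) : E3 →L[ℝ] ℂ := fderiv ℝ f x

lemma Gd_adm (f : 𝓢(E3, ℂ)) : Adm (Gd f) := by
  have e : Gd f = (SchwartzMap.fderivCLM ℂ E3 ℂ f : 𝓢(E3, E3 →L[ℝ] ℂ)) := by
    ext x; simp [Gd]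
  rw [e]
  set u : 𝓢(E3, E3 →L[ℝ] ℂ) := SchwartzMap.fderivCLM ℂ E3 ℂ f
  exact ⟨u.continuous.stronglyMeasurable, u.integrable, ⟨SchwartzMap.seminorm ℂ 0 0 u, fun x => u.norm_le_seminorm ℂ x⟩⟩

lemma MM_lt {H : Type} [NormedAddCommGroup H] {u : E3 → H} (hu : Adm u) (x : E3) : MM u x ≠ ⊤ := by
  obtain ⟨M, hM⟩ := hu.bdd
  refine ne_top_of_le_ne_top (b := c0 * ENNReal.ofReal M) (ENNReal.mul_ne_top c0_lt.ne ENNReal.ofReal_ne_top) ?_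
  refine iSup_le fun k => Th_le_of_bdd k (Eventually.of_forall fun y => ?_) x
  rw [← ofReal_norm]; exact ENNReal.ofReal_le_ofReal (hM y)

lemma sq_cmul (N : ℕ) (c : ℝ≥0∞) (W : ℕ → ℝ≥0∞) : sq N (fun k => c * W k) = c * sq N W := by
  unfold sq
  simp_rw [mul_pow]
  rw [← Finset.mul_sum, ENNReal.mul_rpow_of_nonneg _ _ (by norm_num), ← ENNReal.rpow_natCast, ← ENNReal.rpow_mul]
  norm_num

lemma sq_shift (N d : ℕ) (W : ℕ → ℝ≥0∞) : sq N (fun k => W (k + d)) ≤ sq (N + d) W := by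
  unfold sq
  gcongr
  rw [Finset.range_eq_Ico, Finset.sum_Ico_add' (fun k => W k ^ 2) 0 N d]
  refine Finset.sum_le_sum_of_subset fun k hk => ?_
  simp only [Finset.mem_Ico, Finset.mem_range] at hk ⊢
  omega

/-- powers of the dyadic scale -/
noncomputable def P (t : ℝ) (k : ℕ) : ℝ≥0∞ := ENNReal.ofReal (((2:ℝ) ^ k) ^ t)

lemma P_add (s t : ℝ) (k : ℕ) : P (s + t) k = P s k * P t k := by
  rw [P, P, P, ← ENNReal.ofReal_mul (by positivity), Real.rpow_add (by positivity)]

lemma P_shift (t : ℝ) (k d : ℕ) : P t (k + d) = P t k * P t d := by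
  rw [P, P, P, ← ENNReal.ofReal_mul (by positivity), ← Real.mul_rpow (by positivity) (by positivity), pow_add]

lemma P_zero (k : ℕ) : P 0 k = 1 := by simp [P]

lemma P_ne_top (t : ℝ) (k : ℕ) : P t k ≠ ⊤ := ENNReal.ofReal_ne_top

lemma P_one (k : ℕ) : P 1 k = 2 ^ k := by
  rw [P, Real.rpow_one, ENNReal.ofReal_pow (by norm_num)]; simp

lemma P_inv (t : ℝ) (k : ℕ) : P t k * P (-t) k = 1 := by rw [← P_add, add_neg_cancel, P_zero]

lemma P_inv' (t : ℝ) (k : ℕ) : P (-t) k * P t k = 1 := by rw [← P_add, neg_add_cancel, P_zero]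

lemma P_enorm (t : ℝ) (k : ℕ) : ‖((((2:ℝ) ^ k) ^ t : ℝ) : ℂ)‖ₑ = P t k := by
  rw [← ofReal_norm, Complex.norm_real, Real.norm_of_nonneg (by positivity), P]

/-- weighted pieces -/
noncomputable def W (t : ℝ) (k : ℕ) (u : 𝓢(E3, ℂ)) : 𝓢(E3, ℂ) := op (sy (Wp t) k) u

lemma W_cv (t : ℝ) (k : ℕ) (u : 𝓢(E3, ℂ)) (x : E3) : W t k u x = cv (ker (Wp t) k) u x := op_cv (Wp_prof t) k u x

lemma W_MM (t : ℝ) : ∃ A : ℝ≥0, ∀ k u x, ‖W t k u x‖ₑ ≤ A * MM u x := by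
  obtain ⟨A, hA⟩ := ker_good (Wp_prof t)
  refine ⟨A.toNNReal, fun k u x => ?_⟩
  rw [W_cv]
  exact (cv_le hA k _ x).trans (by gcongr; exact le_rfl; exact Th_le_MM _ k x)

lemma Lo_MM : ∃ A : ℝ≥0, ∀ k u x, ‖Lo k u x‖ₑ ≤ A * MM u x := by
  obtain ⟨A, hA⟩ := ker_good lo_prof
  refine ⟨A.toNNReal, fun k u x => ?_⟩
  rw [Lo_cv]
  exact (cv_le hA k _ x).trans (by gcongr; exact le_rfl; exact Th_le_MM _ k x)

lemma W_S (t : ℝ) {q : ℝ≥0∞} (h1 : 1 < q) (ht : q < ⊤) : ∃ C : ℝ≥0, ∀ d N (v : 𝓢(E3, ℂ)),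
    LN q (fun x => sq N fun k => ‖W t (k + d) v x‖ₑ) ≤ C * eLpNorm v q volume := by
  obtain ⟨_, h⟩ := Wp_lin t
  obtain ⟨C, hC⟩ := fam_S (Wp_prof t) h h1 ht
  refine ⟨C, fun d N v => ?_⟩
  refine le_trans (LN_mono fun x => ?_) (hC (N + d) v (adm_S v))
  simp_rw [← W_cv]
  exact sq_shift N d fun k => ‖W t k v x‖ₑ

lemma pieceE (a t : ℝ) (k : ℕ) (u : 𝓢(E3, ℂ)) (x : E3) : ‖Lm a (Pk k u) x‖ₑ = P t k * ‖W t k (Lm (a - t) u) x‖ₑ := by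
  rw [piece a t, enorm_mul, P_enorm, W_cv]

lemma piece0E (t : ℝ) (k : ℕ) (u : 𝓢(E3, ℂ)) (x : E3) : ‖Pk k u x‖ₑ = P t k * ‖W t k (Lm (- t) u) x‖ₑ := by
  rw [piece0 t, enorm_mul, P_enorm, W_cv]

lemma th_shift {a : ℝ} (ha : 0 < a) (x w y : E3) : th a (w - y) ≤ 8 * (1 + (a * ‖x - w‖) ^ 2) ^ 3 * th a (x - y) := by
  unfold th
  have h : ‖x - y‖ ≤ ‖x - w‖ + ‖w - y‖ := by
    have := norm_add_le (x - w) (w - y)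
    rwa [sub_add_sub_cancel] at this
  set p := ‖x - y‖
  set q := ‖x - w‖
  set r := ‖w - y‖
  have hp : 0 ≤ p := norm_nonneg _
  have hq : 0 ≤ q := norm_nonneg _
  have hr : 0 ≤ r := norm_nonneg _
  have h1 : 1 + (a * p) ^ 2 ≤ 2 * (1 + (a * q) ^ 2) * (1 + (a * r) ^ 2) := by
    have : (a * p) ^ 2 ≤ (a * q + a * r) ^ 2 := by
      have : a * p ≤ a * q + a * r := by nlinarith
      gcongr
    nlinarith [sq_nonneg (a * q - a * r), mul_nonneg (sq_nonneg (a * q)) (sq_nonneg (a * r))]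
  have h2 : (1 + (a * p) ^ 2) ^ 3 ≤ 8 * (1 + (a * q) ^ 2) ^ 3 * (1 + (a * r) ^ 2) ^ 3 := by
    calc _ ≤ (2 * (1 + (a * q) ^ 2) * (1 + (a * r) ^ 2)) ^ 3 := by gcongr
      _ = _ := by ring
  have h3 : 0 < (1 + (a * p) ^ 2) ^ 3 := by positivity
  have h4 : 0 < (1 + (a * r) ^ 2) ^ 3 := by positivity
  rw [← div_eq_mul_inv, ← div_eq_mul_inv, ← mul_div_assoc, div_le_div_iff₀ h4 h3]
  have := mul_le_mul_of_nonneg_left h2 (by positivity : 0 ≤ a ^ 3)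
  linarith

lemma Th_shift {H : Type} [NormedAddCommGroup H] (k : ℕ) (u : E3 → H) (x w : E3) :
    Th k u w ≤ ENNReal.ofReal (8 * (1 + (2 ^ k * ‖x - w‖) ^ 2) ^ 3) * Th k u x := by
  unfold Th
  rw [← lintegral_const_mul' _ _ ENNReal.ofReal_ne_top]
  refine lintegral_mono fun y => ?_
  rw [← mul_assoc, ← ENNReal.ofReal_mul (by positivity)]
  gcongr
  exact th_shift (two_pow_pos' k) x w y

lemma grad_Lo : ∃ A : ℝ, 0 ≤ A ∧ ∀ k f w, ‖fderiv ℝ (Lo k f) w‖ₑ ≤ ENNReal.ofReal A * Th k (Gd f) w := by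
  obtain ⟨A, hA⟩ := ker_good lo_prof
  refine ⟨A, hA.A_nonneg, fun k f w => ?_⟩
  have hT : Th k (Gd f) w ≠ ⊤ := ne_top_of_le_ne_top (MM_lt (Gd_adm f) w) (Th_le_MM _ k w)
  rw [← ENNReal.ofReal_toReal hT, ← ENNReal.ofReal_mul hA.A_nonneg, ← ofReal_norm]
  refine ENNReal.ofReal_le_ofReal ?_
  have h0 := hA.A_nonneg
  refine ContinuousLinearMap.opNorm_le_bound _ (by positivity) fun m => ?_
  rw [← dl_apply, dl_Lo, Lo_cv]
  have h1 := cv_le hA k (∂_{m} f : 𝓢(E3, ℂ)) w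
  have h2 : Th k (∂_{m} f : 𝓢(E3, ℂ)) w ≤ Th k (Gd f) w * ‖m‖ₑ := by
    unfold Th
    rw [← lintegral_mul_const' _ _ enorm_ne_top]
    refine lintegral_mono fun y => ?_
    rw [mul_assoc]
    gcongr
    rw [dl_apply]
    exact ContinuousLinearMap.le_opENorm _ _
  have h3 := h1.trans (mul_le_mul_right h2 _)
  rw [← ENNReal.ofReal_toReal hT, ← ofReal_norm, ← ofReal_norm, ← ENNReal.ofReal_mul (by positivity), ← ENNReal.ofReal_mul h0] at h3
  rw [ENNReal.ofReal_le_ofReal_iff (by positivity)] at h3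
  linarith

lemma cv_int {A : ℝ} {φ : ℕ → E3 → ℂ} (h : Good A φ) (k : ℕ) {v : E3 → ℂ} (hv : Adm v) (x : E3) :
    Integrable fun y => φ k (x - y) * v y := by
  refine Integrable.bdd_mul (c := A * (2 ^ k) ^ 3) hv.int ?_ ?_
  · have := (h.diff k).continuous
    exact (by fun_prop : Continuous fun y => φ k (x - y)).aestronglyMeasurable
  · filter_upwards with y
    refine (h.bd k _).trans ?_
    have := h.A_nonneg
    gcongr
    exact th_le _ (two_pow_pos' k) _

lemma LL_pt (s : ℝ) : ∃ C : ℝ≥0, ∀ k f h, FSa k h → ∀ x,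
    ‖LL s (Lo k f) h x‖ₑ ≤ C * P (s - 1) k * (MM (Gd f) x * Th k h x) := by
  obtain ⟨A, hA0, hA⟩ := grad_Lo
  obtain ⟨B, hB⟩ := ker_good (Zp_prof s)
  obtain ⟨C, hC0, hC⟩ := ker_bd (Zp_prof s) 7
  refine ⟨(8 * A * C).toNNReal, fun k f h hh x => ?_⟩
  set u := Lo k f with hu
  have hM := MM_lt (Gd_adm f) x
  set m := (MM (Gd f) x).toReal with hm
  have hm0 : 0 ≤ m := ENNReal.toReal_nonneg
  set a : ℝ := 2 ^ k with ha
  have ha0 : 0 < a := two_pow_pos' k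
  have h1 : ∀ y, ‖u y - u x‖ ≤ 8 * A * (1 + (a * ‖x - y‖) ^ 2) ^ 3 * m * ‖y - x‖ := by
    intro y
    refine Convex.norm_image_sub_le_of_norm_fderiv_le (𝕜 := ℝ) (s := segment ℝ x y) (fun w _ => u.differentiableAt) (fun w hw => ?_)
      (convex_segment x y) (left_mem_segment ℝ x y) (right_mem_segment ℝ x y)
    have h2 : ‖x - w‖ ≤ ‖x - y‖ := by
      have := segment_subset_closedBall_left x y hw
      rw [mem_closedBall, dist_comm, dist_eq_norm, dist_eq_norm] at this
      exact this
    have h3 : ‖fderiv ℝ u w‖ₑ ≤ ENNReal.ofReal A * (ENNReal.ofReal (8 * (1 + (a * ‖x - w‖) ^ 2) ^ 3) * MM (Gd f) x) :=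
      (hA k f w).trans (by gcongr; exact (Th_shift k _ x w).trans (by gcongr; exact Th_le_MM _ k x))
    rw [← ENNReal.ofReal_toReal hM, ← ENNReal.ofReal_mul (by positivity), ← ENNReal.ofReal_mul hA0, ← ofReal_norm,
      ENNReal.ofReal_le_ofReal_iff (by positivity)] at h3
    refine h3.trans ?_
    calc A * (8 * (1 + (a * ‖x - w‖) ^ 2) ^ 3 * m) ≤ A * (8 * (1 + (a * ‖x - y‖) ^ 2) ^ 3 * m) := by gcongr
      _ = _ := by ring
  have h2 : LL s u h x = ((((2:ℝ) ^ k) ^ s : ℝ) : ℂ) * ∫ y, ker (Zp s) k (x - y) * ((u y - u x) * h y) := by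
    have e : LL s u h x = Lm s (mulS u h) x - u x * Lm s h x := rfl
    rw [e, (FSf_mul (FSb_Lo k f) hh).Z, hh.fat.Z, mul_left_comm, ← mul_sub]
    congr 1
    unfold cv
    rw [← integral_const_mul, ← integral_sub (cv_int hB k (adm_S _) x) ((cv_int hB k (adm_S _) x).const_mul _)]
    refine integral_congr_ae (Eventually.of_forall fun y => ?_)
    simp only [mulS_apply]; ring
  rw [h2, enorm_mul, P_enorm]
  have h3 : ∀ y, ‖ker (Zp s) k (x - y) * ((u y - u x) * h y)‖ₑ ≤ ENNReal.ofReal (8 * A * C * a⁻¹ * m) * (ENNReal.ofReal (th (2 ^ k) (x - y)) * ‖h y‖ₑ) := by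
    intro y
    rw [← mul_assoc, enorm_mul, ← mul_assoc, ← ENNReal.ofReal_mul (by positivity)]
    gcongr
    rw [← ofReal_norm]
    refine ENNReal.ofReal_le_ofReal ?_
    rw [norm_mul]
    have hk := hC k (x - y)
    have hy := h1 y
    rw [norm_sub_rev y x] at hy
    set r := ‖x - y‖ with hr
    have hr0 : 0 ≤ r := norm_nonneg _
    calc _ ≤ C * (((2:ℝ) ^ k) ^ 3 * ((1 + ((2:ℝ) ^ k * r) ^ 2) ^ 7)⁻¹) * (8 * A * (1 + (a * r) ^ 2) ^ 3 * m * r) := by gcongr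
      _ ≤ 8 * A * C * a⁻¹ * m * th (2 ^ k) (x - y) := by
        rw [th, ← ha, ← hr]
        have h5 : a * r ≤ 1 + (a * r) ^ 2 := by nlinarith [sq_nonneg (a * r - 1)]
        have h6 : r ≤ a⁻¹ * (1 + (a * r) ^ 2) := by rw [le_inv_mul_iff₀ ha0]; exact h5
        have h7 : 1 ≤ 1 + (a * r) ^ 2 := by nlinarith [sq_nonneg (a * r)]
        set b := 1 + (a * r) ^ 2
        have hb : 0 < b := by linarith
        have h8 : (b ^ 7)⁻¹ * b ^ 3 * b ≤ (b ^ 3)⁻¹ := by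
          have : (b ^ 7)⁻¹ * b ^ 3 * b = (b ^ 3)⁻¹ := by field_simp
          exact this.le
        calc C * (a ^ 3 * (b ^ 7)⁻¹) * (8 * A * b ^ 3 * m * r) ≤ C * (a ^ 3 * (b ^ 7)⁻¹) * (8 * A * b ^ 3 * m * (a⁻¹ * b)) := by gcongr
          _ = 8 * A * C * a⁻¹ * m * (a ^ 3 * ((b ^ 7)⁻¹ * b ^ 3 * b)) := by ring
          _ ≤ _ := by gcongr
  calc P s k * ‖∫ y, ker (Zp s) k (x - y) * ((u y - u x) * h y)‖ₑ
      ≤ P s k * (ENNReal.ofReal (8 * A * C * a⁻¹ * m) * Th k h x) := by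
        gcongr
        refine (enorm_integral_le_lintegral_enorm _).trans ((lintegral_mono h3).trans ?_)
        rw [lintegral_const_mul' _ _ ENNReal.ofReal_ne_top, Th]
    _ = _ := by
        rw [ENNReal.ofReal_mul (by positivity), ENNReal.ofReal_mul (by positivity), hm, ENNReal.ofReal_toReal hM, sub_eq_add_neg, P_add]
        have : P (-1) k = ENNReal.ofReal a⁻¹ := by rw [P, Real.rpow_neg_one]
        rw [this]
        change _ = ENNReal.ofReal (8 * A * C) * _ * _
        ring

lemma Th_smul (k : ℕ) (c : ℂ) (u : 𝓢(E3, ℂ)) (x : E3) : Th k (c • u : 𝓢(E3, ℂ)) x = ‖c‖ₑ * Th k u x := by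
  unfold Th
  rw [← lintegral_const_mul' _ _ enorm_ne_top]
  congr 1; ext y
  rw [SchwartzMap.smul_apply, smul_eq_mul, enorm_mul]; ring

lemma gt1 {p p₁ p₂ : ℝ≥0∞} (hp : 1 < p) (h : 1 / p = 1 / p₁ + 1 / p₂) : 1 < p₁ := by
  have : 1 / p₁ < 1 := by
    calc 1 / p₁ ≤ 1 / p := by rw [h]; exact le_self_add
      _ < 1 := by rw [one_div]; exact ENNReal.inv_lt_one.2 hp
  rw [one_div] at this
  exact ENNReal.inv_lt_one.1 this

/-- the low-high part -/
theorem partA (s : ℝ) {p p₁ p₂ : ℝ≥0∞} (hp : 1 < p) (hp' : p < ⊤) (hp₂ : 1 < p₂) (hp₂' : p₂ < ⊤) (h : 1 / p = 1 / p₁ + 1 / p₂) :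
    ∃ C : ℝ≥0, ∀ N f g, eLpNorm (fun x => ∑ k ∈ Finset.range N, LL s (Lo k f) (Pk (k + 3) g) x) p volume
      ≤ C * (eLpNorm (Gd f) p₁ volume * eLpNorm (Lm (s - 1) g) p₂ volume) := by
  obtain ⟨_, hl⟩ := ft_lin
  obtain ⟨C1, hC1⟩ := fam_Sstar ft_prof hl hp hp'
  obtain ⟨C2, hC2⟩ := LL_pt s
  obtain ⟨C3, hC3⟩ := M_bd (gt1 hp h)
  obtain ⟨C4, hC4⟩ := D_bd hp₂ hp₂'
  obtain ⟨C5, hC5⟩ := W_S (1 - s) hp₂ hp₂'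
  set c : ℝ≥0 := (P (1 - s) 3).toNNReal
  have hc : (c : ℝ≥0∞) = P (1 - s) 3 := ENNReal.coe_toNNReal (P_ne_top _ _)
  refine ⟨C1 * (C2 * c * (C3 * (C4 * C5))), fun N f g => ?_⟩
  set w : ℕ → 𝓢(E3, ℂ) := fun k => W (1 - s) (k + 3) (Lm (s - 1) g) with hw
  have hpk : ∀ k, Pk (k + 3) g = ((((2:ℝ) ^ (k + 3)) ^ (1 - s) : ℝ) : ℂ) • w k := fun k => by
    have := piece_S 0 (1 - s) (k + 3) g
    rw [Lm_zero] at this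
    rw [this, hw]
    congr 3; ring_nf
  have h1 : ∀ k x, LL s (Lo k f) (Pk (k + 3) g) x = cv (ker ft k) (LL s (Lo k f) (Pk (k + 3) g)) x := by
    intro k x
    refine (FSf.fix ?_ x).symm
    refine ((FSf_mul (FSb_Lo k f) (FSa_Pk k g)).Lm s).sub (FSf_mul (FSb_Lo k f) ?_)
    intro ξ hξ
    exact FSa_Pk k g ξ fun h0 => hξ (by rw [F_Lm, h0, mul_zero])
  simp_rw [fun k x => h1 k x]
  refine (hC1 N _ fun k => adm_S _).trans ?_
  have h2 : ∀ x, (sq N fun k => ‖LL s (Lo k f) (Pk (k + 3) g) x‖ₑ) ≤ ((C2 * c : ℝ≥0) : ℝ≥0∞) * (MM (Gd f) x * sq N fun k => Th k (w k) x) := by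
    intro x
    rw [← sq_cmul, ← sq_cmul]
    refine sq_mono fun k _ => (hC2 k f _ (FSa_Pk k g) x).trans (le_of_eq ?_)
    rw [hpk, Th_smul, P_enorm, P_shift, ENNReal.coe_mul, hc]
    have : P (s - 1) k * P (1 - s) k = 1 := by rw [← P_add, sub_add_sub_cancel, sub_self, P_zero]
    calc _ = (P (s - 1) k * P (1 - s) k) * (C2 * P (1 - s) 3 * (MM (Gd f) x * Th k (w k) x)) := by ring
      _ = _ := by rw [this, one_mul]
  have h3 : LN p (fun x => MM (Gd f) x * sq N fun k => Th k (w k) x) ≤ LN p₁ (MM (Gd f)) * LN p₂ (fun x => sq N fun k => Th k (w k) x) :=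
    LN_holder hp.le hp'.ne h (MM_meas (Gd_adm f).meas).aemeasurable (sq_meas fun k => Th_meas k (adm_S _).meas).aemeasurable
  have h4 := hC3 _ (Gd f) (Gd_adm f)
  have h5 := (hC4 N (fun k => w k) (fun k => adm_S _)).trans (mul_le_mul_right (hC5 3 N (Lm (s - 1) g)) _)
  calc _ ≤ (C1 : ℝ≥0∞) * (((C2 * c : ℝ≥0) : ℝ≥0∞) * ((C3 * eLpNorm (Gd f) p₁ volume) * (C4 * (C5 * eLpNorm (Lm (s - 1) g) p₂ volume)))) := by
        gcongr
        refine (LN_mul_le _ h2).trans ?_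
        gcongr
        exact h3.trans (by gcongr)
    _ = _ := by push_cast; ring

end KP

namespace KP

open Metric Set Filter Topology
open scoped NNReal ContDiff SchwartzMap LineDeriv

lemma cs (N : ℕ) (a b : ℕ → ℝ≥0∞) : ∑ k ∈ Finset.range N, a k * b k ≤ sq N a * sq N b := by
  have := ENNReal.inner_le_Lp_mul_Lq (Finset.range N) a b (p := 2) (q := 2) Real.HolderConjugate.two_two
  simpa [sq] using this

lemma schur {I N : ℕ} {a : ℕ → ℕ → ℝ≥0∞} {K : ℝ≥0∞} (hrow : ∀ i, ∑ j ∈ Finset.range N, a i j ≤ K)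
    (hcol : ∀ j, ∑ i ∈ Finset.range I, a i j ≤ K) (φ : ℕ → ℝ≥0∞) :
    sq I (fun i => ∑ j ∈ Finset.range N, a i j * φ j) ≤ K * sq N φ := by
  have hh : ∀ t : ℝ≥0∞, (t ^ (1 / 2 : ℝ)) ^ 2 = t := fun t => by
    rw [← ENNReal.rpow_natCast, ← ENNReal.rpow_mul]; norm_num
  have h1 : ∀ i, (∑ j ∈ Finset.range N, a i j * φ j) ^ 2 ≤ K * ∑ j ∈ Finset.range N, a i j * φ j ^ 2 := by
    intro i
    have h2 := cs N (fun j => a i j ^ (1 / 2 : ℝ)) (fun j => a i j ^ (1 / 2 : ℝ) * φ j)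
    have e : ∀ j, a i j ^ (1 / 2 : ℝ) * (a i j ^ (1 / 2 : ℝ) * φ j) = a i j * φ j := fun j => by
      rw [← mul_assoc, ← pow_two, hh]
    simp_rw [e] at h2
    calc _ ≤ (sq N (fun j => a i j ^ (1 / 2 : ℝ)) * sq N (fun j => a i j ^ (1 / 2 : ℝ) * φ j)) ^ 2 := by gcongr
      _ = (∑ j ∈ Finset.range N, a i j) * ∑ j ∈ Finset.range N, a i j * φ j ^ 2 := by
        rw [mul_pow, sq_sq, sq_sq]
        simp_rw [mul_pow, hh]
      _ ≤ _ := by gcongr; exact hrow i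
  have h2 : sq I (fun i => ∑ j ∈ Finset.range N, a i j * φ j) ^ 2 ≤ (K * sq N φ) ^ 2 := by
    rw [sq_sq, mul_pow, sq_sq]
    calc _ ≤ ∑ i ∈ Finset.range I, K * ∑ j ∈ Finset.range N, a i j * φ j ^ 2 := Finset.sum_le_sum fun i _ => h1 i
      _ = K * ∑ j ∈ Finset.range N, (∑ i ∈ Finset.range I, a i j) * φ j ^ 2 := by
        rw [← Finset.mul_sum, Finset.sum_comm]
        simp_rw [Finset.sum_mul]
      _ ≤ K * ∑ j ∈ Finset.range N, K * φ j ^ 2 := by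
        gcongr with j _; exact hcol j
      _ = _ := by rw [← Finset.mul_sum]; ring
  exact (ENNReal.pow_le_pow_left_iff two_ne_zero).1 h2

lemma geo (r : ℝ≥0∞) (F : Finset ℕ) (e : ℕ → ℕ) (he : Set.InjOn e F) : ∑ j ∈ F, r ^ e j ≤ (1 - r)⁻¹ := by
  rw [← Finset.sum_image (f := fun n => r ^ n) he, ← ENNReal.tsum_geometric]
  exact ENNReal.sum_le_tsum _

lemma P_pow (t : ℝ) (m : ℕ) : P t m = P t 1 ^ m := by
  induction m with
  | zero => simp [P]
  | succ n ih => rw [P_shift, ih, pow_succ]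

lemma P_lt {s : ℝ} (hs : 0 < s) : P (-s) 1 < 1 := by
  rw [P, ENNReal.ofReal_lt_one, pow_one]
  exact Real.rpow_lt_one_of_one_lt_of_neg (by norm_num) (by linarith)

lemma K_ne {s : ℝ} (hs : 0 < s) : (1 - P (-s) 1)⁻¹ ≠ ⊤ := by
  rw [ENNReal.inv_ne_top]
  exact (tsub_pos_of_lt (P_lt hs)).ne'

lemma P_geo (s : ℝ) (j : ℕ) : ∑ i ∈ Finset.range (j + 1), P s i ≤ (1 - P (-s) 1)⁻¹ * P s j := by
  have : ∀ i ∈ Finset.range (j + 1), P s i = P (-s) 1 ^ (j - i) * P s j := by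
    intro i hi
    rw [Finset.mem_range] at hi
    have e : P s j = P s i * P s (j - i) := by rw [← P_shift]; congr 1; omega
    rw [e, ← P_pow, mul_left_comm, P_inv', mul_one]
  rw [Finset.sum_congr rfl this, ← Finset.sum_mul]
  gcongr
  refine geo _ _ _ fun a ha b hb hab => ?_
  simp only [Finset.coe_range, Set.mem_Iio] at ha hb hab
  omega

/-- low-pass parts of derivatives -/
lemma LmLo_MM {s : ℝ} (hs : 0 < s) : ∃ C : ℝ≥0, ∀ j (g : 𝓢(E3, ℂ)) x, ‖Lm s (Lo j g) x‖ₑ ≤ C * P s j * MM g x := by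
  obtain ⟨A, hA⟩ := W_MM s
  have hK := ENNReal.coe_toNNReal (K_ne hs)
  refine ⟨((1 - P (-s) 1)⁻¹).toNNReal * A, fun j g x => ?_⟩
  rw [Lm_Lo, SchwartzMap.sum_apply]
  refine (enorm_sum_le _ _).trans ?_
  calc _ ≤ ∑ i ∈ Finset.range (j + 1), P s i * (A * MM g x) := by
        refine Finset.sum_le_sum fun i _ => ?_
        rw [pieceE s s, sub_self, Lm_zero]
        gcongr
        exact hA i g x
    _ ≤ ((1 - P (-s) 1)⁻¹ * P s j) * (A * MM g x) := by rw [← Finset.sum_mul]; gcongr; exact P_geo s j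
    _ = _ := by rw [ENNReal.coe_mul, hK]; ring

lemma PkE (s : ℝ) (k : ℕ) (f : 𝓢(E3, ℂ)) (x : E3) : ‖Pk k f x‖ₑ = P (-s) k * ‖W (-s) k (Lm s f) x‖ₑ := by
  rw [piece0E (-s), neg_neg]

lemma W_meas (t : ℝ) (k : ℕ) (u : 𝓢(E3, ℂ)) : Measurable fun x => ‖W t k u x‖ₑ := (adm_S _).em

/-- basic Hölder step for the second pair of exponents -/
lemma hold34 (s : ℝ) {p p₃ p₄ : ℝ≥0∞} (hp : 1 < p) (hp' : p < ⊤) (hp₃ : 1 < p₃) (hp₃' : p₃ < ⊤) (h : 1 / p = 1 / p₃ + 1 / p₄) :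
    ∃ C : ℝ≥0, ∀ d N f (g : 𝓢(E3, ℂ)), LN p (fun x => (sq N fun k => ‖W (-s) (k + d) (Lm s f) x‖ₑ) * MM g x)
      ≤ C * (eLpNorm (Lm s f) p₃ volume * eLpNorm g p₄ volume) := by
  obtain ⟨C3, hC3⟩ := M_bd (gt1 hp (h.trans (add_comm _ _)))
  obtain ⟨C5, hC5⟩ := W_S (-s) hp₃ hp₃'
  refine ⟨C5 * C3, fun d N f g => ?_⟩
  refine (LN_holder hp.le hp'.ne h (sq_meas fun k => W_meas _ _ _).aemeasurable (MM_meas (adm_S g).meas).aemeasurable).trans ?_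
  calc _ ≤ (C5 * eLpNorm (Lm s f) p₃ volume) * (C3 * eLpNorm g p₄ volume) := by
        gcongr
        · exact hC5 d N _
        · exact hC3 _ _ (adm_S g)
    _ = _ := by push_cast; ring

/-- high-low part, first half -/
theorem partB1 {s : ℝ} (hs : 0 < s) {p p₃ p₄ : ℝ≥0∞} (hp : 1 < p) (hp' : p < ⊤) (hp₃ : 1 < p₃) (hp₃' : p₃ < ⊤) (h : 1 / p = 1 / p₃ + 1 / p₄) :
    ∃ C : ℝ≥0, ∀ N f (g : 𝓢(E3, ℂ)), eLpNorm (fun x => ∑ j ∈ Finset.range N, Lm s (mulS (Pk j f) (Lo (j + 2) g)) x) p volume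
      ≤ C * (eLpNorm (Lm s f) p₃ volume * eLpNorm g p₄ volume) := by
  obtain ⟨_, hl⟩ := Wp_lin s
  obtain ⟨C1, hC1⟩ := fam_Sstar (Wp_prof s) hl hp hp'
  obtain ⟨C2, hC2⟩ := hold34 s hp hp' hp₃ hp₃' h
  obtain ⟨A, hA⟩ := Lo_MM
  set K : ℝ≥0∞ := (1 - P (-s) 1)⁻¹ with hKd
  have hK : ((K.toNNReal : ℝ≥0) : ℝ≥0∞) = K := ENNReal.coe_toNNReal (K_ne hs)
  set c : ℝ≥0 := (P s 4).toNNReal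
  have hc : (c : ℝ≥0∞) = P s 4 := ENNReal.coe_toNNReal (P_ne_top _ _)
  refine ⟨C1 * (c * A * K.toNNReal * C2), fun N f g => ?_⟩
  set H : ℕ → 𝓢(E3, ℂ) := fun j => mulS (Pk j f) (Lo (j + 2) g) with hH
  set co : ℕ → ℂ := fun i => ((((2:ℝ) ^ i) ^ s : ℝ) : ℂ) with hco
  set w : ℕ → 𝓢(E3, ℂ) := fun i => co i • ∑ j ∈ Finset.range N with i ≤ j + 4, H j with hw
  have h1 : ∑ j ∈ Finset.range N, Lm s (H j) = ∑ i ∈ Finset.range (N + 4), op (sy (Wp s) i) (w i) := by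
    have e1 : ∀ j, Lm s (H j) = ∑ i ∈ Finset.range (j + 4 + 1), co i • op (sy (Wp s) i) (H j) := by
      intro j
      have : H j = Lo (j + 4) (H j) := (Lo_fix j f g).symm
      rw [this, Lm_Lo, ← this]
      refine Finset.sum_congr rfl fun i _ => ?_
      rw [piece_S s s, sub_self, Lm_zero]
    simp_rw [e1, hw, map_smul, map_sum, Finset.smul_sum]
    refine Finset.sum_comm' fun j i => ?_
    simp only [Finset.mem_range, Finset.mem_filter]
    omega
  have h2 : (fun x => ∑ j ∈ Finset.range N, Lm s (H j) x) = fun x => ∑ i ∈ Finset.range (N + 4), cv (ker (Wp s) i) (w i) x := by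
    ext x
    have := congrArg (fun u : 𝓢(E3, ℂ) => u x) h1
    simp only [SchwartzMap.sum_apply] at this
    rw [this]
    exact Finset.sum_congr rfl fun i _ => op_cv (Wp_prof s) i _ x
  rw [h2]
  refine (hC1 (N + 4) _ fun k => adm_S _).trans ?_
  set φ : E3 → ℕ → ℝ≥0∞ := fun x j => ‖W (-s) j (Lm s f) x‖ₑ with hφ
  set a : ℕ → ℕ → ℝ≥0∞ := fun i j => if i ≤ j + 4 then P (-s) 1 ^ (j + 4 - i) else 0 with ha
  have h3 : ∀ x, (sq (N + 4) fun i => ‖w i x‖ₑ) ≤ ((c * A * K.toNNReal : ℝ≥0) : ℝ≥0∞) * (sq N (φ x) * MM g x) := by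
    intro x
    have h4 : ∀ i, ‖w i x‖ₑ ≤ (c * A * MM g x) * ∑ j ∈ Finset.range N, a i j * φ x j := by
      intro i
      rw [hw, SchwartzMap.smul_apply, SchwartzMap.sum_apply, smul_eq_mul, enorm_mul, hco, P_enorm]
      calc _ ≤ P s i * ∑ j ∈ Finset.range N with i ≤ j + 4, ‖H j x‖ₑ := by gcongr; exact enorm_sum_le _ _
        _ ≤ P s i * ∑ j ∈ Finset.range N with i ≤ j + 4, P (-s) j * φ x j * (A * MM g x) := by
            gcongr with j _
            rw [hH, mulS_apply, enorm_mul, PkE s]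
            gcongr
            exact hA _ _ _
        _ = ∑ j ∈ Finset.range N with i ≤ j + 4, (c * A * MM g x) * (a i j * φ x j) := by
            rw [Finset.mul_sum]
            refine Finset.sum_congr rfl fun j hj => ?_
            have hj := (Finset.mem_filter.1 hj).2
            rw [ha]
            simp only [if_pos hj]
            rw [← P_pow, hc]
            have e1 : P (-s) (j + 4) = P (-s) i * P (-s) (j + 4 - i) := by rw [← P_shift]; congr 1; omega
            have e2 : P s i * P (-s) j = P s 4 * P (-s) (j + 4 - i) := by
              calc P s i * P (-s) j = P s i * (P (-s) j * P (-s) 4) * P s 4 := by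
                    rw [mul_assoc, mul_assoc, P_inv', mul_one]
                _ = (P s i * P (-s) i) * (P (-s) (j + 4 - i) * P s 4) := by rw [← P_shift, e1]; ring
                _ = _ := by rw [P_inv, one_mul, mul_comm]
            calc _ = (P s i * P (-s) j) * (φ x j * (A * MM g x)) := by ring
              _ = _ := by rw [e2]; ring
        _ = _ := by
            rw [Finset.mul_sum, Finset.sum_filter]
            refine Finset.sum_congr rfl fun j _ => ?_
            by_cases hj : i ≤ j + 4
            · rw [if_pos hj]
            · rw [if_neg hj, ha]; simp only [if_neg hj]; simp
    have hrow : ∀ i, ∑ j ∈ Finset.range N, a i j ≤ K := by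
      intro i
      rw [ha]
      simp only
      rw [← Finset.sum_filter]
      refine geo _ _ (fun j => j + 4 - i) fun j hj j' hj' hab => ?_
      simp only [Finset.coe_filter, Set.mem_setOf_eq] at hj hj' hab
      omega
    have hcol : ∀ j, ∑ i ∈ Finset.range (N + 4), a i j ≤ K := by
      intro j
      rw [ha]
      simp only
      rw [← Finset.sum_filter]
      refine geo _ _ (fun i => j + 4 - i) fun j hj j' hj' hab => ?_
      simp only [Finset.coe_filter, Set.mem_setOf_eq] at hj hj' hab
      omega
    calc _ ≤ sq (N + 4) (fun i => (c * A * MM g x) * ∑ j ∈ Finset.range N, a i j * φ x j) := sq_mono fun i _ => h4 i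
      _ ≤ (c * A * MM g x) * (K * sq N (φ x)) := by rw [sq_cmul]; gcongr; exact schur hrow hcol _
      _ = _ := by rw [ENNReal.coe_mul, ENNReal.coe_mul, hK]; ring
  have h5 := hC2 0 N f g
  calc _ ≤ (C1 : ℝ≥0∞) * (((c * A * K.toNNReal : ℝ≥0) : ℝ≥0∞) * (C2 * (eLpNorm (Lm s f) p₃ volume * eLpNorm g p₄ volume))) := by
        gcongr
        exact (LN_mul_le _ h3).trans (by gcongr; exact h5)
    _ = _ := by push_cast; ring

/-- high-low part, second half, main piece -/
theorem partB2 {s : ℝ} (hs : 0 < s) {p p₃ p₄ : ℝ≥0∞} (hp : 1 < p) (hp' : p < ⊤) (hp₃ : 1 < p₃) (hp₃' : p₃ < ⊤) (h : 1 / p = 1 / p₃ + 1 / p₄) :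
    ∃ C : ℝ≥0, ∀ N f (g : 𝓢(E3, ℂ)), eLpNorm (fun x => ∑ j ∈ Finset.range N, mulS (Pk (j + 3) f) (Lm s (Lo j g)) x) p volume
      ≤ C * (eLpNorm (Lm s f) p₃ volume * eLpNorm g p₄ volume) := by
  obtain ⟨_, hl⟩ := ft_lin
  obtain ⟨C1, hC1⟩ := fam_Sstar ft_prof hl hp hp'
  obtain ⟨C2, hC2⟩ := hold34 s hp hp' hp₃ hp₃' h
  obtain ⟨A, hA⟩ := LmLo_MM hs
  set c : ℝ≥0 := (P (-s) 3).toNNReal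
  have hc : (c : ℝ≥0∞) = P (-s) 3 := ENNReal.coe_toNNReal (P_ne_top _ _)
  refine ⟨C1 * (c * A * C2), fun N f g => ?_⟩
  have h1 : ∀ j x, mulS (Pk (j + 3) f) (Lm s (Lo j g)) x = cv (ker ft j) (mulS (Pk (j + 3) f) (Lm s (Lo j g))) x := by
    intro j x
    refine (FSf.fix ?_ x).symm
    rw [mulS_comm]
    exact FSf_mul (FSb_Lm (FSb_Lo j g) s) (FSa_Pk j f)
  simp_rw [fun k x => h1 k x]
  refine (hC1 N _ fun k => adm_S _).trans ?_
  have h3 : ∀ x, (sq N fun j => ‖mulS (Pk (j + 3) f) (Lm s (Lo j g)) x‖ₑ) ≤ ((c * A : ℝ≥0) : ℝ≥0∞) * ((sq N fun k => ‖W (-s) (k + 3) (Lm s f) x‖ₑ) * MM g x) := by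
    intro x
    rw [mul_comm (sq N _), ← mul_assoc, ← sq_cmul]
    refine sq_mono fun j _ => ?_
    rw [mulS_apply, enorm_mul, PkE s, P_shift, ENNReal.coe_mul, hc]
    calc _ ≤ P (-s) j * P (-s) 3 * ‖W (-s) (j + 3) (Lm s f) x‖ₑ * (A * P s j * MM g x) := by gcongr; exact hA _ _ _
      _ = (P (-s) j * P s j) * (P (-s) 3 * A * MM g x * ‖W (-s) (j + 3) (Lm s f) x‖ₑ) := by ring
      _ = _ := by rw [P_inv', one_mul]
  have h5 := hC2 3 N f g
  calc _ ≤ (C1 : ℝ≥0∞) * (((c * A : ℝ≥0) : ℝ≥0∞) * (C2 * (eLpNorm (Lm s f) p₃ volume * eLpNorm g p₄ volume))) := by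
        gcongr
        exact (LN_mul_le _ h3).trans (by gcongr)
    _ = _ := by push_cast; ring

/-- high-low part, second half, low frequencies -/
theorem partB3 {s : ℝ} (hs : 0 < s) {p p₃ p₄ : ℝ≥0∞} (hp : 1 < p) (hp' : p < ⊤) (hp₃ : 1 < p₃) (hp₃' : p₃ < ⊤) (h : 1 / p = 1 / p₃ + 1 / p₄) (j : ℕ) :
    ∃ C : ℝ≥0, ∀ f (g : 𝓢(E3, ℂ)), eLpNorm (mulS (Pk j f) (Lm s (Lo (j + 2) g))) p volume
      ≤ C * (eLpNorm (Lm s f) p₃ volume * eLpNorm g p₄ volume) := by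
  obtain ⟨C2, hC2⟩ := hold34 s hp hp' hp₃ hp₃' h
  obtain ⟨A, hA⟩ := LmLo_MM hs
  set c : ℝ≥0 := (P s 2).toNNReal
  have hc : (c : ℝ≥0∞) = P s 2 := ENNReal.coe_toNNReal (P_ne_top _ _)
  refine ⟨c * A * C2, fun f g => ?_⟩
  rw [eLp_LN]
  have h3 : ∀ x, ‖mulS (Pk j f) (Lm s (Lo (j + 2) g)) x‖ₑ ≤ ((c * A : ℝ≥0) : ℝ≥0∞) * ((sq (j + 1) fun k => ‖W (-s) (k + 0) (Lm s f) x‖ₑ) * MM g x) := by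
    intro x
    rw [mulS_apply, enorm_mul, PkE s, ENNReal.coe_mul, hc]
    have h4 := le_sq (N := j + 1) (fun k => ‖W (-s) (k + 0) (Lm s f) x‖ₑ) (k := j) (by omega)
    calc _ ≤ P (-s) j * (sq (j + 1) fun k => ‖W (-s) (k + 0) (Lm s f) x‖ₑ) * (A * P s (j + 2) * MM g x) := by gcongr; exact h4; exact hA _ _ _
      _ = (P (-s) j * P s j) * (P s 2 * A * ((sq (j + 1) fun k => ‖W (-s) (k + 0) (Lm s f) x‖ₑ) * MM g x)) := by rw [P_shift s]; ring
      _ = _ := by rw [P_inv', one_mul]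
  have h5 := hC2 0 (j + 1) f g
  calc _ ≤ (((c * A : ℝ≥0) : ℝ≥0∞) * (C2 * (eLpNorm (Lm s f) p₃ volume * eLpNorm g p₄ volume))) :=
        (LN_mul_le _ h3).trans (by gcongr)
    _ = _ := by push_cast; ring

end KP

namespace KP

open Metric Set Filter Topology
open scoped NNReal ContDiff SchwartzMap LineDeriv

lemma minsum2 {x : ℝ} (hx : 1 < x) (N : ℕ) {X Y : ℝ} (hX : 0 ≤ X) (hY : 0 ≤ Y) {T : ℕ → ℝ}
    (h1 : ∀ j, T j ≤ x ^ j * X) (h2 : ∀ j, T j ≤ (x ^ j)⁻¹ * Y) :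
    ∑ j ∈ Finset.range N, T j ≤ 2 * x / (x - 1) * √(X * Y) := by
  have hx1 : 0 < x - 1 := by linarith
  have hxp : 0 < x := by linarith
  rcases hX.eq_or_lt with h0 | hX0
  · refine (Finset.sum_nonpos fun j _ => ?_).trans (by positivity)
    have := h1 j
    rwa [← h0, mul_zero] at this
  rcases hY.eq_or_lt with h0 | hY0
  · refine (Finset.sum_nonpos fun j _ => ?_).trans (by positivity)
    have := h2 j
    rwa [← h0, mul_zero] at this
  have hsX : 0 < √X := Real.sqrt_pos.2 hX0
  have hsY : 0 < √Y := Real.sqrt_pos.2 hY0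
  have eX : √X * √X = X := Real.mul_self_sqrt hX
  have eY : √Y * √Y = Y := Real.mul_self_sqrt hY
  have := minsum hx N (t := √X / √Y) (by positivity)
  calc _ ≤ ∑ j ∈ Finset.range N, √(X * Y) * min (x ^ j * (√X / √Y)) ((x ^ j * (√X / √Y))⁻¹) := by
        refine Finset.sum_le_sum fun j _ => ?_
        rw [mul_min_of_nonneg _ _ (by positivity), Real.sqrt_mul hX]
        refine le_min ((h1 j).trans (le_of_eq ?_)) ((h2 j).trans (le_of_eq ?_))
        · field_simp; nlinarith [eX]
        · field_simp; nlinarith [eY]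
    _ ≤ _ := by rw [← Finset.mul_sum, mul_comm]; gcongr

lemma minsumE {x : ℝ} (hx : 1 < x) (N : ℕ) {X Y : ℝ≥0∞} (hX : X ≠ ⊤) (hY : Y ≠ ⊤) {T : ℕ → ℝ≥0∞}
    (h1 : ∀ j, T j ≤ ENNReal.ofReal (x ^ j) * X) (h2 : ∀ j, T j ≤ ENNReal.ofReal ((x ^ j)⁻¹) * Y) {U V : ℝ≥0∞} (hU : U ≠ ⊤) (hV : V ≠ ⊤)
    (hUV : X * Y = U * V) :
    ∑ j ∈ Finset.range N, T j ≤ ENNReal.ofReal (2 * x / (x - 1)) * (U + V) := by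
  have hx1 : 0 < x - 1 := by linarith
  have hxp : 0 < x := by linarith
  have hT : ∀ j, T j ≠ ⊤ := fun j => ne_top_of_le_ne_top (ENNReal.mul_ne_top ENNReal.ofReal_ne_top hX) (h1 j)
  have := minsum2 hx N (X := X.toReal) (Y := Y.toReal) (T := fun j => (T j).toReal) ENNReal.toReal_nonneg ENNReal.toReal_nonneg
    (fun j => by
      have := ENNReal.toReal_mono (ENNReal.mul_ne_top ENNReal.ofReal_ne_top hX) (h1 j)
      rwa [ENNReal.toReal_mul, ENNReal.toReal_ofReal (by positivity)] at this)
    (fun j => by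
      have := ENNReal.toReal_mono (ENNReal.mul_ne_top ENNReal.ofReal_ne_top hY) (h2 j)
      rwa [ENNReal.toReal_mul, ENNReal.toReal_ofReal (by positivity)] at this)
  have hs : √(X.toReal * Y.toReal) ≤ U.toReal + V.toReal := by
    rw [← ENNReal.toReal_mul, hUV, ENNReal.toReal_mul]
    have hu : 0 ≤ U.toReal := ENNReal.toReal_nonneg
    have hv : 0 ≤ V.toReal := ENNReal.toReal_nonneg
    rw [Real.sqrt_le_left (by positivity)]
    nlinarith [mul_nonneg hu hv, sq_nonneg U.toReal, sq_nonneg V.toReal]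
  rw [← ENNReal.ofReal_toReal (ENNReal.sum_ne_top.2 fun j _ => hT j), ENNReal.toReal_sum fun j _ => hT j]
  calc _ ≤ ENNReal.ofReal (2 * x / (x - 1) * (U.toReal + V.toReal)) := ENNReal.ofReal_le_ofReal (this.trans (by gcongr))
    _ = _ := by rw [ENNReal.ofReal_mul (by positivity), ← ENNReal.toReal_add hU hV, ENNReal.ofReal_toReal (by simp [hU, hV])]

lemma P_rp (t : ℝ) (j : ℕ) : P t j = ENNReal.ofReal (((2:ℝ) ^ t) ^ j) := by
  rw [P, ← Real.rpow_natCast, ← Real.rpow_natCast, ← Real.rpow_mul (by norm_num), ← Real.rpow_mul (by norm_num), mul_comm]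

lemma P_rp' (t : ℝ) (j : ℕ) : P (-t) j = ENNReal.ofReal ((((2:ℝ) ^ t) ^ j)⁻¹) := by
  rw [P_rp, Real.rpow_neg (by norm_num), inv_pow]

/-- interpolation between two geometric bounds -/
lemma two_geo {t : ℝ} (ht : t ≠ 0) : ∃ C : ℝ≥0, ∀ (N : ℕ) (X Y U V : ℝ≥0∞) (T : ℕ → ℝ≥0∞), X ≠ ⊤ → Y ≠ ⊤ → U ≠ ⊤ → V ≠ ⊤ →
    X * Y = U * V → (∀ j, T j ≤ P t j * X) → (∀ j, T j ≤ P (-t) j * Y) → ∑ j ∈ Finset.range N, T j ≤ C * (U + V) := by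
  rcases lt_or_gt_of_ne ht with h | h
  · refine ⟨(2 * (2:ℝ) ^ (-t) / ((2:ℝ) ^ (-t) - 1)).toNNReal, fun N X Y U V T hX hY hU hV e h1 h2 => ?_⟩
    refine minsumE (x := (2:ℝ) ^ (-t)) (Real.one_lt_rpow (by norm_num) (by linarith)) N hY hX (fun j => ?_) (fun j => ?_) hU hV (by rw [mul_comm, e])
    · rw [← P_rp]; exact h2 j
    · rw [← P_rp', neg_neg]; exact h1 j
  · refine ⟨(2 * (2:ℝ) ^ t / ((2:ℝ) ^ t - 1)).toNNReal, fun N X Y U V T hX hY hU hV e h1 h2 => ?_⟩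
    refine minsumE (x := (2:ℝ) ^ t) (Real.one_lt_rpow (by norm_num) h) N hX hY (fun j => ?_) (fun j => ?_) hU hV e
    · rw [← P_rp]; exact h1 j
    · rw [← P_rp']; exact h2 j

lemma ev_norm (l : Fin 3) : ‖ev l‖ = 1 := by simp [ev]

lemma dl_le (l : Fin 3) (f : 𝓢(E3, ℂ)) (x : E3) : ‖(∂_{ev l} f : 𝓢(E3, ℂ)) x‖ₑ ≤ ‖Gd f x‖ₑ := by
  rw [dl_apply]
  refine (ContinuousLinearMap.le_opENorm _ _).trans ?_
  rw [← ofReal_norm (ev l), ev_norm]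
  simp [Gd]

lemma dl_MM (l : Fin 3) (f : 𝓢(E3, ℂ)) (x : E3) : MM (∂_{ev l} f : 𝓢(E3, ℂ)) x ≤ MM (Gd f) x := by
  refine iSup_mono fun k => lintegral_mono fun y => ?_
  gcongr
  exact dl_le l f y

lemma Pk_X (k : ℕ) (f : 𝓢(E3, ℂ)) (x : E3) :
    P 1 (k + 1) * ‖Pk (k + 1) f x‖ₑ ≤ ∑ l, ‖cv (ker (Xp l) (k + 1)) (⇑(∂_{ev l} f : 𝓢(E3, ℂ))) x‖ₑ := by
  refine le_trans (le_of_eq ?_) (enorm_sum_le _ _)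
  rw [← piece_X (k + 1) (by omega), enorm_mul, P_one, enorm_pow]
  congr 2
  rw [← ofReal_norm]; simp

lemma Pk_Gd : ∃ A : ℝ≥0, ∀ k f x, ‖Pk (k + 1) f x‖ₑ ≤ A * P (-1) (k + 1) * MM (Gd f) x := by
  choose A hA using fun l => ker_good (Xp_prof l)
  refine ⟨∑ l, (A l).toNNReal, fun k f x => ?_⟩
  have h1 : P 1 (k + 1) * ‖Pk (k + 1) f x‖ₑ ≤ ((∑ l, (A l).toNNReal : ℝ≥0) : ℝ≥0∞) * MM (Gd f) x := by
    refine (Pk_X k f x).trans ?_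
    rw [ENNReal.coe_finsetSum, Finset.sum_mul]
    refine Finset.sum_le_sum fun l _ => (cv_le (hA l) _ _ x).trans ?_
    change _ ≤ ENNReal.ofReal (A l) * _
    gcongr
    exact (Th_le_MM _ _ _).trans (dl_MM l f x)
  calc _ = P (-1) (k + 1) * (P 1 (k + 1) * ‖Pk (k + 1) f x‖ₑ) := by rw [← mul_assoc, P_inv', one_mul]
    _ ≤ P (-1) (k + 1) * (((∑ l, (A l).toNNReal : ℝ≥0) : ℝ≥0∞) * MM (Gd f) x) := by gcongr
    _ = _ := by ring

/-- diagonal terms -/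
noncomputable def Qd (s : ℝ) (d N : ℕ) (f g : 𝓢(E3, ℂ)) (x : E3) : ℝ≥0∞ :=
  ∑ j ∈ Finset.range N, ‖Pk (j + 3) f x‖ₑ * ‖Lm s (Pk (j + d) g) x‖ₑ

lemma Qd_meas (s : ℝ) (d N : ℕ) (f g : 𝓢(E3, ℂ)) : Measurable (Qd s d N f g) := by
  unfold Qd
  exact Finset.measurable_sum _ fun j _ => (adm_S _).em.mul (adm_S _).em

lemma Qd_pt {s : ℝ} (hs : s ≠ 1) (d : ℕ) : ∃ C : ℝ≥0, ∀ N f g x,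
    Qd s d N f g x ≤ C * (MM (Gd f) x * MM (Lm (s - 1) g) x + MM (Lm s f) x * MM g x) := by
  obtain ⟨A1, hA1⟩ := Pk_Gd
  obtain ⟨A2, hA2⟩ := W_MM (-s)
  obtain ⟨A3, hA3⟩ := W_MM s
  obtain ⟨A4, hA4⟩ := W_MM 1
  obtain ⟨C, hC⟩ := two_geo (sub_ne_zero.2 hs)
  set c1 : ℝ≥0∞ := A1 * P (-1) 3 * (P s d * A3) with hc1
  set c2 : ℝ≥0∞ := P (-s) 3 * A2 * (P 1 d * A4) with hc2
  have hc1t : c1 ≠ ⊤ := by simp [hc1, ENNReal.mul_eq_top, P_ne_top]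
  have hc2t : c2 ≠ ⊤ := by simp [hc2, ENNReal.mul_eq_top, P_ne_top]
  set c : ℝ≥0∞ := c1 + c2 with hc
  have hct : c ≠ ⊤ := by simp [hc, hc1t, hc2t]
  have hcc : (c.toNNReal : ℝ≥0∞) = c := ENNReal.coe_toNNReal hct
  refine ⟨C * c.toNNReal, fun N f g x => ?_⟩
  have m1 := MM_lt (Gd_adm f) x
  have m2 := MM_lt (adm_S (Lm (s - 1) g)) x
  have m3 := MM_lt (adm_S (Lm s f)) x
  have m4 := MM_lt (adm_S g) x
  have := hC N (c * (MM (Gd f) x * MM g x)) (c * (MM (Lm s f) x * MM (Lm (s - 1) g) x))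
    (c * (MM (Gd f) x * MM (Lm (s - 1) g) x)) (c * (MM (Lm s f) x * MM g x))
    (fun j => ‖Pk (j + 3) f x‖ₑ * ‖Lm s (Pk (j + d) g) x‖ₑ)
    (ENNReal.mul_ne_top hct (ENNReal.mul_ne_top m1 m4)) (ENNReal.mul_ne_top hct (ENNReal.mul_ne_top m3 m2))
    (ENNReal.mul_ne_top hct (ENNReal.mul_ne_top m1 m2)) (ENNReal.mul_ne_top hct (ENNReal.mul_ne_top m3 m4)) (by ring)
    (fun j => by
      have h1 := hA1 (j + 2) f x
      have h2 : ‖Lm s (Pk (j + d) g) x‖ₑ ≤ P s (j + d) * (A3 * MM g x) := by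
        rw [pieceE s s, sub_self, Lm_zero]; gcongr; exact hA3 _ _ _
      calc _ ≤ (A1 * P (-1) (j + 3) * MM (Gd f) x) * (P s (j + d) * (A3 * MM g x)) := by gcongr
        _ = P (s - 1) j * (c1 * (MM (Gd f) x * MM g x)) := by
          rw [P_shift, P_shift, sub_eq_add_neg, P_add, hc1]; ring
        _ ≤ _ := by gcongr; rw [hc]; exact le_self_add)
    (fun j => by
      have h1 : ‖Pk (j + 3) f x‖ₑ ≤ P (-s) (j + 3) * (A2 * MM (Lm s f) x) := by
        rw [PkE s]; gcongr; exact hA2 _ _ _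
      have h2 : ‖Lm s (Pk (j + d) g) x‖ₑ ≤ P 1 (j + d) * (A4 * MM (Lm (s - 1) g) x) := by
        rw [pieceE s 1]; gcongr; exact hA4 _ _ _
      calc _ ≤ (P (-s) (j + 3) * (A2 * MM (Lm s f) x)) * (P 1 (j + d) * (A4 * MM (Lm (s - 1) g) x)) := by gcongr
        _ = P (-(s - 1)) j * (c2 * (MM (Lm s f) x * MM (Lm (s - 1) g) x)) := by
          have e : P (-(s - 1)) j = P (-s) j * P 1 j := by rw [← P_add]; congr 1; ring
          rw [P_shift, P_shift, e, hc2]; ring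
        _ ≤ _ := by gcongr; rw [hc]; exact le_add_self)
  refine this.trans (le_of_eq ?_)
  rw [ENNReal.coe_mul, hcc]; ring

theorem partC_ne {s : ℝ} (hs : s ≠ 1) {p p₁ p₂ p₃ p₄ : ℝ≥0∞} (hp : 1 < p) (hp' : p < ⊤)
    (h : 1 / p = 1 / p₁ + 1 / p₂) (h' : 1 / p = 1 / p₃ + 1 / p₄) (d : ℕ) :
    ∃ C : ℝ≥0, ∀ N f (g : 𝓢(E3, ℂ)), LN p (Qd s d N f g) ≤
      C * (eLpNorm (Gd f) p₁ volume * eLpNorm (Lm (s - 1) g) p₂ volume + eLpNorm (Lm s f) p₃ volume * eLpNorm g p₄ volume) := by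
  obtain ⟨C, hC⟩ := Qd_pt hs d
  obtain ⟨C1, hC1⟩ := M_bd (gt1 hp h)
  obtain ⟨C2, hC2⟩ := M_bd (gt1 hp (h.trans (add_comm _ _)))
  obtain ⟨C3, hC3⟩ := M_bd (gt1 hp h')
  obtain ⟨C4, hC4⟩ := M_bd (gt1 hp (h'.trans (add_comm _ _)))
  refine ⟨C * (C1 * C2 + C3 * C4), fun N f g => ?_⟩
  have m1 := MM_meas (Gd_adm f).meas
  have m2 := MM_meas (adm_S (Lm (s - 1) g)).meas
  have m3 := MM_meas (adm_S (Lm s f)).meas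
  have m4 := MM_meas (adm_S g).meas
  refine (LN_mul_le C fun x => hC N f g x).trans ?_
  rw [ENNReal.coe_mul, mul_assoc]
  gcongr
  refine (LN_add hp.le (m1.mul m2).aemeasurable (m3.mul m4).aemeasurable).trans ?_
  have k1 := LN_holder hp.le hp'.ne h m1.aemeasurable m2.aemeasurable
  have k2 := LN_holder hp.le hp'.ne h' m3.aemeasurable m4.aemeasurable
  calc _ ≤ (C1 * eLpNorm (Gd f) p₁ volume) * (C2 * eLpNorm (Lm (s - 1) g) p₂ volume) + (C3 * eLpNorm (Lm s f) p₃ volume) * (C4 * eLpNorm g p₄ volume) := by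
        refine add_le_add (k1.trans ?_) (k2.trans ?_)
        · gcongr; exact hC1 _ _ (Gd_adm f); exact hC2 _ _ (adm_S _)
        · gcongr; exact hC3 _ _ (adm_S _); exact hC4 _ _ (adm_S _)
    _ = ((C1 * C2 : ℝ≥0) : ℝ≥0∞) * (eLpNorm (Gd f) p₁ volume * eLpNorm (Lm (s - 1) g) p₂ volume) + ((C3 * C4 : ℝ≥0) : ℝ≥0∞) * (eLpNorm (Lm s f) p₃ volume * eLpNorm g p₄ volume) := by
        push_cast; ring
    _ ≤ _ := by
        rw [mul_add]
        gcongr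
        · exact_mod_cast (le_self_add : C1 * C2 ≤ C1 * C2 + C3 * C4)
        · exact_mod_cast (le_add_self : C3 * C4 ≤ C1 * C2 + C3 * C4)

end KP

namespace KP

open Metric Set Filter Topology
open scoped NNReal ContDiff SchwartzMap LineDeriv

lemma X_S {q : ℝ≥0∞} (h1 : 1 < q) (ht : q < ⊤) : ∃ C : ℝ≥0, ∀ (l : Fin 3) d N (u : 𝓢(E3, ℂ)),
    LN q (fun x => sq N fun k => ‖cv (ker (Xp l) (k + d)) u x‖ₑ) ≤ C * eLpNorm u q volume := by
  have : ∀ l, ∃ C : ℝ≥0, ∀ N (f : E3 → ℂ), Adm f → LN q (fun x => sq N fun k => ‖cv (ker (Xp l) k) f x‖ₑ) ≤ C * eLpNorm f q volume := fun l => by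
    obtain ⟨_, h⟩ := Xp_lin l
    exact fam_S (Xp_prof l) h h1 ht
  choose C hC using this
  refine ⟨∑ l, C l, fun l d N v => ?_⟩
  refine le_trans (LN_mono fun x => ?_) ((hC l (N + d) v (adm_S v)).trans ?_)
  · exact sq_shift N d fun k => ‖cv (ker (Xp l) k) v x‖ₑ
  · gcongr
    exact Finset.single_le_sum (f := C) (fun _ _ => bot_le) (Finset.mem_univ l)

lemma X_meas (l : Fin 3) (k : ℕ) (u : 𝓢(E3, ℂ)) : Measurable fun x => ‖cv (ker (Xp l) k) u x‖ₑ := by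
  simp_rw [← op_cv (Xp_prof l)]
  exact (adm_S _).em

/-- Riesz-type bound -/
lemma dl_Lm {q : ℝ≥0∞} (h1 : 1 < q) (ht : q < ⊤) : ∃ C : ℝ≥0, ∀ (l : Fin 3) (f : 𝓢(E3, ℂ)),
    eLpNorm (∂_{ev l} f : 𝓢(E3, ℂ)) q volume ≤ C * eLpNorm (Lm 1 f) q volume := by
  have : ∀ l, ∃ C : ℝ≥0, ∀ N (w : ℕ → E3 → ℂ), (∀ k, Adm (w k)) →
      eLpNorm (fun x => ∑ k ∈ Finset.range N, cv (ker (Yp l) k) (w k) x) q volume ≤ C * LN q (fun x => sq N fun k => ‖w k x‖ₑ) := fun l => by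
    obtain ⟨_, h⟩ := Yp_lin l
    exact fam_Sstar (Yp_prof l) h h1 ht
  choose C hC using this
  obtain ⟨D, hD⟩ := W_S (-1) h1 ht
  refine ⟨(∑ l, C l) * D, fun l f => ?_⟩
  have key : ∀ N, eLpNorm (Lo N (∂_{ev l} f : 𝓢(E3, ℂ))) q volume ≤ ((∑ l, C l) * D : ℝ≥0) * eLpNorm (Lm 1 f) q volume := fun N => by
    have e : ⇑(Lo N (∂_{ev l} f : 𝓢(E3, ℂ))) = fun x => ∑ k ∈ Finset.range (N + 1), cv (ker (Yp l) k) ⇑((2:ℂ) ^ k • Pk k f) x := by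
      funext x
      rw [← dl_Lo, Lo_sum, LineDeriv.lineDerivOp_sum, SchwartzMap.sum_apply]
      refine Finset.sum_congr rfl fun k _ => ?_
      rw [dl_Pk, op_cv (Yp_prof l)]
    rw [e]
    refine (hC l (N + 1) _ fun k => adm_S _).trans ?_
    have e2 : ∀ x k, ‖((2:ℂ) ^ k • Pk k f) x‖ₑ = ‖W (-1) (k + 0) (Lm 1 f) x‖ₑ := fun x k => by
      rw [SchwartzMap.smul_apply, enorm_smul, PkE 1, ← mul_assoc]
      have : ‖(2:ℂ) ^ k‖ₑ = P 1 k := by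
        rw [P_one, enorm_pow]; congr 1; rw [← ofReal_norm]; simp
      rw [this, P_inv, one_mul, add_zero]
    simp_rw [e2]
    rw [ENNReal.coe_mul, mul_assoc]
    gcongr
    · exact Finset.single_le_sum (f := C) (fun _ _ => bot_le) (Finset.mem_univ l)
    · exact hD 0 (N + 1) (Lm 1 f)
  refine (Lp.eLpNorm_lim_le_liminf_eLpNorm (fun N => (adm_S (Lo N (∂_{ev l} f : 𝓢(E3, ℂ)))).meas.aestronglyMeasurable) _ ?_).trans ?_
  · filter_upwards with x
    exact Lo_lim _ x
  · refine (liminf_le_liminf (Eventually.of_forall key)).trans ?_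
    simp

lemma LN_two {p : ℝ≥0∞} (hp : 1 < p) (hp' : p < ⊤) {U : E3 → ℝ≥0∞} (hU : Measurable U) :
    LN (2 * p) U ^ 2 ≤ LN ⊤ U * LN p U := by
  have h := LN_holder (p := p) (p₁ := ⊤) (p₂ := p) hp.le hp'.ne (by simp) hU.aemeasurable hU.aemeasurable
  refine le_trans (le_of_eq ?_) h
  have p0 : p ≠ 0 := (zero_lt_one.trans hp).ne'
  rw [LN_eq (by simp [p0]) (ENNReal.mul_ne_top (by simp) hp'.ne), LN_eq p0 hp'.ne]
  have pr : 0 < p.toReal := ENNReal.toReal_pos p0 hp'.ne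
  rw [← ENNReal.rpow_natCast, ← ENNReal.rpow_mul, ENNReal.toReal_mul]
  congr 1
  · refine lintegral_congr fun x => ?_
    rw [← pow_two, ← ENNReal.rpow_natCast, ← ENNReal.rpow_mul]; simp
  · simp

lemma mix {a b G F g h : ℝ≥0∞} {C : ℝ≥0} (ha : a ^ 2 ≤ G * (C * F)) (hb : b ^ 2 ≤ h * g) :
    a * b ≤ ((C + 1 : ℝ≥0) : ℝ≥0∞) * (G * g + F * h) := by
  have : (a * b) ^ 2 ≤ (((C + 1 : ℝ≥0) : ℝ≥0∞) * (G * g + F * h)) ^ 2 := by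
    calc (a * b) ^ 2 = a ^ 2 * b ^ 2 := by ring
      _ ≤ (G * (C * F)) * (h * g) := by gcongr
      _ = C * ((G * g) * (F * h)) := by ring
      _ ≤ ((C + 1 : ℝ≥0) : ℝ≥0∞) ^ 2 * ((G * g + F * h) * (G * g + F * h)) := by
          gcongr
          · rw [← ENNReal.coe_pow, ENNReal.coe_le_coe]
            rw [add_sq]; nlinarith [C.2, pow_nonneg (bot_le : (0:ℝ≥0) ≤ C) 2]
          · exact le_self_add
          · exact le_add_self
      _ = _ := by ring
  exact (ENNReal.pow_le_pow_left_iff two_ne_zero).1 this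

theorem partC_one {p p₁ p₂ p₃ p₄ : ℝ≥0∞} (hp : 1 < p) (hp' : p < ⊤) (hp₂ : 1 < p₂) (hp₂' : p₂ < ⊤) (hp₃ : 1 < p₃) (hp₃' : p₃ < ⊤)
    (h : 1 / p = 1 / p₁ + 1 / p₂) (h' : 1 / p = 1 / p₃ + 1 / p₄) (d : ℕ) :
    ∃ C : ℝ≥0, ∀ N f (g : 𝓢(E3, ℂ)), LN p (Qd 1 d N f g) ≤
      C * (eLpNorm (Gd f) p₁ volume * eLpNorm (Lm (1 - 1) g) p₂ volume + eLpNorm (Lm 1 f) p₃ volume * eLpNorm g p₄ volume) := by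
  simp_rw [sub_self, Lm_zero]
  set c : ℝ≥0∞ := P (-1) 3 * P 1 d with hc
  have hct : c ≠ ⊤ := ENNReal.mul_ne_top (P_ne_top _ _) (P_ne_top _ _)
  have hcc : (c.toNNReal : ℝ≥0∞) = c := ENNReal.coe_toNNReal hct
  have Q1 : ∀ N f (g : 𝓢(E3, ℂ)) x, Qd 1 d N f g x = c.toNNReal * ∑ j ∈ Finset.range N, (P 1 (j + 3) * ‖Pk (j + 3) f x‖ₑ) * ‖W 1 (j + d) g x‖ₑ := by
    intro N f g x
    rw [hcc, Finset.mul_sum, Qd]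
    refine Finset.sum_congr rfl fun j _ => ?_
    rw [pieceE 1 1, sub_self, Lm_zero, P_shift, P_shift, hc]
    calc _ = (P 1 3 * P (-1) 3) * (‖Pk (j + 3) f x‖ₑ * (P 1 j * P 1 d * ‖W 1 (j + d) g x‖ₑ)) := by rw [P_inv, one_mul]
      _ = _ := by ring
  have mW : ∀ (t : ℝ) e N (v : 𝓢(E3, ℂ)), Measurable fun x => sq N fun k => ‖W t (k + e) v x‖ₑ := fun t e N v => sq_meas fun k => W_meas t (k + e) v
  have mX : ∀ (l : Fin 3) e N (v : 𝓢(E3, ℂ)), Measurable fun x => sq N fun k => ‖cv (ker (Xp l) (k + e)) v x‖ₑ := fun l e N v => sq_meas fun k => X_meas l (k + e) v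
  -- reduction to a bound for the `X` square functions
  have red : ∀ {q₁ q₂ : ℝ≥0∞}, 1 / p = 1 / q₁ + 1 / q₂ → q₁ < ⊤ → q₂ < ⊤ → ∃ C : ℝ≥0, ∀ N f (g : 𝓢(E3, ℂ)), LN p (Qd 1 d N f g) ≤
      C * ∑ l, eLpNorm (∂_{ev l} f : 𝓢(E3, ℂ)) q₁ volume * eLpNorm g q₂ volume := by
    intro q₁ q₂ e t1 t2
    obtain ⟨A, hA⟩ := X_S (gt1 hp e) t1
    obtain ⟨B, hB⟩ := W_S 1 (gt1 hp (e.trans (add_comm _ _))) t2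
    refine ⟨c.toNNReal * (A * B), fun N f g => ?_⟩
    have pt : ∀ x, Qd 1 d N f g x ≤ c.toNNReal * ∑ l, (sq N fun k => ‖cv (ker (Xp l) (k + 3)) ⇑(∂_{ev l} f : 𝓢(E3, ℂ)) x‖ₑ) * (sq N fun k => ‖W 1 (k + d) g x‖ₑ) := by
      intro x
      rw [Q1]
      gcongr
      refine le_trans (Finset.sum_le_sum fun j _ => mul_le_mul_left (Pk_X (j + 2) f x) _) ?_
      simp_rw [Finset.sum_mul]
      rw [Finset.sum_comm]
      exact Finset.sum_le_sum fun l _ => cs N _ _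
    refine (LN_mul_le _ pt).trans ?_
    rw [ENNReal.coe_mul, mul_assoc]
    gcongr
    have tri : ∀ (F : Fin 3 → E3 → ℝ≥0∞), (∀ l, Measurable (F l)) → LN p (fun x => ∑ l, F l x) ≤ ∑ l, LN p (F l) := fun F hF => by
      simp_rw [Fin.sum_univ_three]
      exact (LN_add hp.le ((hF 0).add (hF 1)).aemeasurable (hF 2).aemeasurable).trans (add_le_add (LN_add hp.le (hF 0).aemeasurable (hF 1).aemeasurable) le_rfl)
    refine (tri _ fun l => (mX l 3 N _).mul (mW 1 d N g)).trans ?_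
    rw [Finset.mul_sum]
    refine Finset.sum_le_sum fun l _ => (LN_holder hp.le hp'.ne e (mX l 3 N _).aemeasurable (mW 1 d N g).aemeasurable).trans ?_
    calc _ ≤ (A * eLpNorm (∂_{ev l} f : 𝓢(E3, ℂ)) q₁ volume) * (B * eLpNorm g q₂ volume) := mul_le_mul' (hA l 3 N _) (hB d N g)
      _ = _ := by push_cast; ring
  by_cases t1 : p₁ < ⊤
  · obtain ⟨C, hC⟩ := red h t1 hp₂'
    refine ⟨C * 3, fun N f g => (hC N f g).trans ?_⟩
    rw [ENNReal.coe_mul, mul_assoc]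
    gcongr
    calc _ ≤ ∑ l : Fin 3, eLpNorm (Gd f) p₁ volume * eLpNorm g p₂ volume := by
          refine Finset.sum_le_sum fun l _ => ?_
          gcongr
          exact eLpNorm_mono_enorm fun x => dl_le l f x
      _ = 3 * (eLpNorm (Gd f) p₁ volume * eLpNorm g p₂ volume) := by simp
      _ ≤ _ := by push_cast; gcongr; exact le_self_add
  by_cases t4 : p₄ < ⊤
  · obtain ⟨A, hA⟩ := W_S (-1) hp₃ hp₃'
    obtain ⟨B, hB⟩ := W_S 1 (gt1 hp (h'.trans (add_comm _ _))) t4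
    refine ⟨c.toNNReal * (A * B), fun N f g => ?_⟩
    have pt : ∀ x, Qd 1 d N f g x ≤ c.toNNReal * ((sq N fun k => ‖W (-1) (k + 3) (Lm 1 f) x‖ₑ) * (sq N fun k => ‖W 1 (k + d) g x‖ₑ)) := by
      intro x
      rw [Q1]
      gcongr
      refine le_trans (le_of_eq ?_) (cs N _ _)
      refine Finset.sum_congr rfl fun j _ => ?_
      rw [PkE 1, ← mul_assoc (P 1 (j + 3)), P_inv, one_mul]
    refine (LN_mul_le _ pt).trans ?_
    rw [ENNReal.coe_mul, mul_assoc]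
    gcongr
    refine (LN_holder hp.le hp'.ne h' (mW _ 3 N _).aemeasurable (mW 1 d N g).aemeasurable).trans ?_
    calc _ ≤ (A * eLpNorm (Lm 1 f) p₃ volume) * (B * eLpNorm g p₄ volume) := mul_le_mul' (hA 3 N _) (hB d N g)
      _ = ((A * B : ℝ≥0) : ℝ≥0∞) * (eLpNorm (Lm 1 f) p₃ volume * eLpNorm g p₄ volume) := by push_cast; ring
      _ ≤ _ := by gcongr; exact le_add_self
  have e1 : p₁ = ⊤ := not_lt_top_iff.1 t1
  have e4 : p₄ = ⊤ := not_lt_top_iff.1 t4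
  subst e1 e4
  have e2 : p₂ = p := by simpa using h.symm
  have e3 : p₃ = p := by simpa using h'.symm
  subst e2
  rw [e3]
  obtain ⟨C, hC⟩ := red (q₁ := 2 * p₂) (q₂ := 2 * p₂) (by
    rw [one_div, one_div, ENNReal.mul_inv (by simp) (by simp), ← add_mul, ENNReal.inv_two_add_inv_two, one_mul])
    (ENNReal.mul_lt_top (by simp) hp') (ENNReal.mul_lt_top (by simp) hp')
  obtain ⟨D, hD⟩ := dl_Lm hp hp'
  refine ⟨C * (3 * (D + 1)), fun N f g => (hC N f g).trans ?_⟩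
  rw [ENNReal.coe_mul, mul_assoc]
  gcongr
  calc _ ≤ ∑ l : Fin 3, ((D + 1 : ℝ≥0) : ℝ≥0∞) * (eLpNorm (Gd f) ⊤ volume * eLpNorm g p₂ volume + eLpNorm (Lm 1 f) p₂ volume * eLpNorm g ⊤ volume) := by
        refine Finset.sum_le_sum fun l _ => mix ?_ ?_
        · rw [eLp_LN (∂_{ev l} f : 𝓢(E3, ℂ))]
          refine (LN_two hp hp' (adm_S _).em).trans ?_
          gcongr
          · rw [← eLp_LN]; exact eLpNorm_mono_enorm fun x => dl_le l f x
          · rw [← eLp_LN]; exact hD l f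
        · rw [eLp_LN g]
          refine (LN_two hp hp' (adm_S _).em).trans ?_
          rw [← eLp_LN, ← eLp_LN]
    _ = _ := by simp; ring

theorem partC {s : ℝ} {p p₁ p₂ p₃ p₄ : ℝ≥0∞} (hp : 1 < p) (hp' : p < ⊤) (hp₂ : 1 < p₂) (hp₂' : p₂ < ⊤) (hp₃ : 1 < p₃) (hp₃' : p₃ < ⊤)
    (h : 1 / p = 1 / p₁ + 1 / p₂) (h' : 1 / p = 1 / p₃ + 1 / p₄) (d : ℕ) :
    ∃ C : ℝ≥0, ∀ N f (g : 𝓢(E3, ℂ)), LN p (Qd s d N f g) ≤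
      C * (eLpNorm (Gd f) p₁ volume * eLpNorm (Lm (s - 1) g) p₂ volume + eLpNorm (Lm s f) p₃ volume * eLpNorm g p₄ volume) := by
  by_cases hs : s = 1
  · subst hs
    exact partC_one hp hp' hp₂ hp₂' hp₃ hp₃' h h' d
  · exact partC_ne hs hp hp' h h' d

end KP

namespace KP

open Metric Set Filter Topology
open scoped NNReal ContDiff SchwartzMap LineDeriv

/-- uniform bounds of a family by a fixed right-hand side -/
def UBd (p : ℝ≥0∞) (R : 𝓢(E3, ℂ) → 𝓢(E3, ℂ) → ℝ≥0∞) (F : ℕ → 𝓢(E3, ℂ) → 𝓢(E3, ℂ) → E3 → ℝ≥0∞) : Prop :=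
  ∃ C : ℝ≥0, ∀ N f g, Measurable (F N f g) ∧ LN p (F N f g) ≤ C * R f g

lemma UBd.add {p : ℝ≥0∞} (hp : 1 ≤ p) {R : 𝓢(E3, ℂ) → 𝓢(E3, ℂ) → ℝ≥0∞} {F G : ℕ → 𝓢(E3, ℂ) → 𝓢(E3, ℂ) → E3 → ℝ≥0∞}
    (hF : UBd p R F) (hG : UBd p R G) : UBd p R (fun N f g x => F N f g x + G N f g x) := by
  obtain ⟨C, hC⟩ := hF
  obtain ⟨D, hD⟩ := hG
  refine ⟨C + D, fun N f g => ⟨(hC N f g).1.add (hD N f g).1, ?_⟩⟩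
  refine (LN_add hp (hC N f g).1.aemeasurable (hD N f g).1.aemeasurable).trans ?_
  rw [ENNReal.coe_add, add_mul]
  exact add_le_add (hC N f g).2 (hD N f g).2

lemma reduce' {s : ℝ} (hs : 0 < s) {p B : ℝ≥0∞} (f g : 𝓢(E3, ℂ))
    (h : ∀ N, eLpNorm (LL s (Lo (N + 2) f) (Lo (N + 2 + 2) g)) p volume ≤ B) : eLpNorm (LL s f g) p volume ≤ B := by
  refine (Lp.eLpNorm_lim_le_liminf_eLpNorm (fun N => (adm_S (LL s (Lo (N + 2) f) (Lo (N + 2 + 2) g))).meas.aestronglyMeasurable) _ ?_).trans ?_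
  · filter_upwards with x
    exact (LL_lim hs f g x).comp (tendsto_add_atTop_nat 2)
  · refine (liminf_le_liminf (Eventually.of_forall h)).trans ?_
    simp

lemma split5 (s : ℝ) (j : ℕ) (g : 𝓢(E3, ℂ)) : Lm s (Lo (j + 3 + 2) g) =
    Lm s (Lo j g) + (Lm s (Pk (j + 1) g) + (Lm s (Pk (j + 2) g) + (Lm s (Pk (j + 3) g) + (Lm s (Pk (j + 4) g) + Lm s (Pk (j + 5) g))))) := by
  rw [show j + 3 + 2 = j + 4 + 1 from rfl, Lo_succ, Lo_succ (j + 3), Lo_succ (j + 2), Lo_succ (j + 1), Lo_succ j]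
  simp only [map_add]
  abel

lemma pt_split (s : ℝ) (N : ℕ) (f g : 𝓢(E3, ℂ)) (x : E3) :
    ‖LL s (Lo (N + 2) f) (Lo (N + 2 + 2) g) x‖ₑ ≤
      ‖∑ k ∈ Finset.range (N + 2), LL s (Lo k f) (Pk (k + 3) g) x‖ₑ +
      (‖∑ j ∈ Finset.range (N + 3), Lm s (mulS (Pk j f) (Lo (j + 2) g)) x‖ₑ +
      (‖mulS (Pk 0 f) (Lm s (Lo (0 + 2) g)) x‖ₑ + (‖mulS (Pk 1 f) (Lm s (Lo (1 + 2) g)) x‖ₑ +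
      (‖mulS (Pk 2 f) (Lm s (Lo (2 + 2) g)) x‖ₑ + (‖∑ j ∈ Finset.range N, mulS (Pk (j + 3) f) (Lm s (Lo j g)) x‖ₑ +
      (Qd s 1 N f g x + (Qd s 2 N f g x + (Qd s 3 N f g x + (Qd s 4 N f g x + Qd s 5 N f g x))))))))) := by
  have q : ∀ d, ‖∑ j ∈ Finset.range N, Pk (j + 3) f x * Lm s (Pk (j + d) g) x‖ₑ ≤ Qd s d N f g x := fun d => by
    refine (enorm_sum_le _ _).trans (le_of_eq ?_)
    simp_rw [Qd, enorm_mul]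
  have e : LL s (Lo (N + 2) f) (Lo (N + 2 + 2) g) x = ∑ k ∈ Finset.range (N + 2), LL s (Lo k f) (Pk (k + 3) g) x +
      (∑ j ∈ Finset.range (N + 3), Lm s (mulS (Pk j f) (Lo (j + 2) g)) x -
      (mulS (Pk 0 f) (Lm s (Lo (0 + 2) g)) x + (mulS (Pk 1 f) (Lm s (Lo (1 + 2) g)) x +
      (mulS (Pk 2 f) (Lm s (Lo (2 + 2) g)) x + (∑ j ∈ Finset.range N, mulS (Pk (j + 3) f) (Lm s (Lo j g)) x +
      (∑ j ∈ Finset.range N, Pk (j + 3) f x * Lm s (Pk (j + 1) g) x + (∑ j ∈ Finset.range N, Pk (j + 3) f x * Lm s (Pk (j + 2) g) x +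
      (∑ j ∈ Finset.range N, Pk (j + 3) f x * Lm s (Pk (j + 3) g) x + (∑ j ∈ Finset.range N, Pk (j + 3) f x * Lm s (Pk (j + 4) g) x +
        ∑ j ∈ Finset.range N, Pk (j + 3) f x * Lm s (Pk (j + 5) g) x))))))))) := by
    rw [decomp, SchwartzMap.add_apply, SchwartzMap.sum_apply, SchwartzMap.sum_apply]
    congr 1
    have : ∀ j, LL s (Pk j f) (Lo (j + 2) g) x = Lm s (mulS (Pk j f) (Lo (j + 2) g)) x - mulS (Pk j f) (Lm s (Lo (j + 2) g)) x := fun j => rfl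
    simp_rw [this]
    rw [Finset.sum_sub_distrib]
    congr 1
    rw [show N + 2 + 1 = N + 1 + 1 + 1 from rfl, Finset.sum_range_succ' _ (N + 1 + 1), Finset.sum_range_succ' _ (N + 1), Finset.sum_range_succ' _ N]
    have e2 : ∀ j, mulS (Pk (j + 1 + 1 + 1) f) (Lm s (Lo (j + 1 + 1 + 1 + 2) g)) x = mulS (Pk (j + 3) f) (Lm s (Lo j g)) x +
      (Pk (j + 3) f x * Lm s (Pk (j + 1) g) x + (Pk (j + 3) f x * Lm s (Pk (j + 2) g) x + (Pk (j + 3) f x * Lm s (Pk (j + 3) g) x +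
       (Pk (j + 3) f x * Lm s (Pk (j + 4) g) x + Pk (j + 3) f x * Lm s (Pk (j + 5) g) x)))) := fun j => by
      rw [show j + 1 + 1 + 1 = j + 3 from rfl, split5]
      simp only [mulS_apply, SchwartzMap.add_apply]
      ring
    simp_rw [e2, Finset.sum_add_distrib]
    ring
  rw [e]
  refine (enorm_add_le _ _).trans (add_le_add le_rfl ?_)
  refine (enorm_sub_le).trans (add_le_add le_rfl ?_)
  refine (enorm_add_le _ _).trans (add_le_add le_rfl ?_)
  refine (enorm_add_le _ _).trans (add_le_add le_rfl ?_)
  refine (enorm_add_le _ _).trans (add_le_add le_rfl ?_)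
  refine (enorm_add_le _ _).trans (add_le_add le_rfl ?_)
  refine (enorm_add_le _ _).trans (add_le_add (q 1) ?_)
  refine (enorm_add_le _ _).trans (add_le_add (q 2) ?_)
  refine (enorm_add_le _ _).trans (add_le_add (q 3) ?_)
  exact (enorm_add_le _ _).trans (add_le_add (q 4) (q 5))

theorem main {s : ℝ} (hs : 0 < s) {p p₁ p₂ p₃ p₄ : ℝ≥0∞} (hp : 1 < p) (hp' : p < ⊤) (hp₂ : 1 < p₂) (hp₂' : p₂ < ⊤) (hp₃ : 1 < p₃) (hp₃' : p₃ < ⊤)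
    (h : 1 / p = 1 / p₁ + 1 / p₂) (h' : 1 / p = 1 / p₃ + 1 / p₄) :
    ∃ C : ℝ≥0, ∀ f (g : 𝓢(E3, ℂ)), eLpNorm (LL s f g) p volume ≤
      C * (eLpNorm (Gd f) p₁ volume * eLpNorm (Lm (s - 1) g) p₂ volume + eLpNorm (Lm s f) p₃ volume * eLpNorm g p₄ volume) := by
  set R : 𝓢(E3, ℂ) → 𝓢(E3, ℂ) → ℝ≥0∞ := fun f g =>
    eLpNorm (Gd f) p₁ volume * eLpNorm (Lm (s - 1) g) p₂ volume + eLpNorm (Lm s f) p₃ volume * eLpNorm g p₄ volume with hR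
  have mS : ∀ (n : ℕ) (F : ℕ → 𝓢(E3, ℂ)), Measurable fun x => ‖∑ k ∈ Finset.range n, F k x‖ₑ := fun n F =>
    (Finset.measurable_sum _ fun k _ => (F k).continuous.measurable).enorm
  have bA : UBd p R (fun N f g x => ‖∑ k ∈ Finset.range (N + 2), LL s (Lo k f) (Pk (k + 3) g) x‖ₑ) := by
    obtain ⟨C, hC⟩ := partA s hp hp' hp₂ hp₂' h
    refine ⟨C, fun N f g => ⟨mS _ _, ?_⟩⟩
    rw [← eLp_LN]
    refine (hC (N + 2) f g).trans ?_
    gcongr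
    exact le_self_add
  have bB : UBd p R (fun N f g x => ‖∑ j ∈ Finset.range (N + 3), Lm s (mulS (Pk j f) (Lo (j + 2) g)) x‖ₑ) := by
    obtain ⟨C, hC⟩ := partB1 hs hp hp' hp₃ hp₃' h'
    refine ⟨C, fun N f g => ⟨mS _ _, ?_⟩⟩
    rw [← eLp_LN]
    refine (hC (N + 3) f g).trans ?_
    gcongr
    exact le_add_self
  have bC : UBd p R (fun N f g x => ‖∑ j ∈ Finset.range N, mulS (Pk (j + 3) f) (Lm s (Lo j g)) x‖ₑ) := by
    obtain ⟨C, hC⟩ := partB2 hs hp hp' hp₃ hp₃' h'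
    refine ⟨C, fun N f g => ⟨mS _ _, ?_⟩⟩
    rw [← eLp_LN]
    refine (hC N f g).trans ?_
    gcongr
    exact le_add_self
  have bD : ∀ j, UBd p R (fun N f g x => ‖mulS (Pk j f) (Lm s (Lo (j + 2) g)) x‖ₑ) := fun j => by
    obtain ⟨C, hC⟩ := partB3 hs hp hp' hp₃ hp₃' h' j
    refine ⟨C, fun N f g => ⟨(adm_S _).em, ?_⟩⟩
    rw [← eLp_LN]
    refine (hC f g).trans ?_
    gcongr
    exact le_add_self
  have bQ : ∀ d, UBd p R (fun N f g x => Qd s d N f g x) := fun d => by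
    obtain ⟨C, hC⟩ := partC (s := s) hp hp' hp₂ hp₂' hp₃ hp₃' h h' d
    exact ⟨C, fun N f g => ⟨Qd_meas s d N f g, hC N f g⟩⟩
  obtain ⟨C, hC⟩ := bA.add hp.le (bB.add hp.le ((bD 0).add hp.le ((bD 1).add hp.le ((bD 2).add hp.le (bC.add hp.le
    ((bQ 1).add hp.le ((bQ 2).add hp.le ((bQ 3).add hp.le ((bQ 4).add hp.le (bQ 5))))))))))
  refine ⟨C, fun f g => reduce' hs f g fun N => ?_⟩
  rw [eLp_LN]
  exact (LN_mono fun x => pt_split s N f g x).trans (hC N f g).2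

end KP

/-- Kato–Ponce commutator estimate. -/
theorem stmt8 (s : ℝ) (hs : 0 < s) (p p₁ p₂ p₃ p₄ : ℝ≥0∞)
    (hp : 1 < p) (hp' : p < ⊤) (hp₂ : 1 < p₂) (hp₂' : p₂ < ⊤)
    (hp₃ : 1 < p₃) (hp₃' : p₃ < ⊤)
    (h1 : 1 / p = 1 / p₁ + 1 / p₂) (h2 : 1 / p = 1 / p₃ + 1 / p₄) :
    ∃ C : ℝ, 0 < C ∧ ∀ f g : SchwartzMap E3 ℂ,
      eLpNorm (fun x => Lam s (fun y => f y * g y) x - f x * Lam s (⇑g) x) p volume ≤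
        ENNReal.ofReal C *
          (eLpNorm (fun x => fderiv ℝ (⇑f) x) p₁ volume *
              eLpNorm (Lam (s - 1) (⇑g)) p₂ volume +
            eLpNorm (Lam s (⇑f)) p₃ volume * eLpNorm (⇑g) p₄ volume) := by
  obtain ⟨C, hC⟩ := KP.main hs hp hp' hp₂ hp₂' hp₃ hp₃' h1 h2
  refine ⟨(C : ℝ) + 1, by positivity, fun f g => ?_⟩
  rw [KP.Lam_eq, KP.Lam_eq, KP.Lam_eq, ← KP.mulS_coe, KP.Lam_eq]
  refine (hC f g).trans ?_
  have : (C : ℝ≥0∞) ≤ ENNReal.ofReal ((C : ℝ) + 1) := by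
    rw [← ENNReal.ofReal_coe_nnreal]
    exact ENNReal.ofReal_le_ofReal (by linarith)
  exact mul_le_mul' this le_rfl
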